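/- Let 0 < 3R < T and M > 0. Set ρ = (R+T)/2. Let q₁, q₂ be C⁸ functions on the ball {|x| ≤ ρ} with ‖q₁‖_{L^∞} ≤ M and ‖q₂‖_{L^∞} ≤ M, and let u₁, u₂ be the unique C² solutions of the Goursat problems for q₁, q₂ on the double conical region D_ρ = {(x,t) : |x| ≤ ρ, |x| ≤ t ≤ 2ρ − |x|}. Then there exist constants δ > 0 and C > 0 depending only on R, T and M such that: if ‖q₂‖_{L^∞} ≤ δ, then ∫_{|x| ≤ R} |q₁ − q₂|² dx ≤ C ∫_R^T ∫_{S_R} ( |u₁ − u₂|² + |∇(u₁ − u₂)|² + |∂_t(u₁ − u₂)|² ) dσ dt, where ∇ denotes the spatial gradient, all functions in the last integral are evaluated at points (x,t) with |x| = R, and σ is the surface measure on the sphere S_R = {x : |x| = R}. -/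

import Mathlib

noncomputable section

open Real MeasureTheory Metric Set

/-- Euclidean 3-space. -/
abbrev E3 : Type := EuclideanSpace ℝ (Fin 3)

/-- The `i`-th standard basis vector of `ℝ³`. -/
def basis3 (i : Fin 3) : E3 := EuclideanSpace.single i 1

/-- The partial derivative `∂ᵢ f` of a function on `ℝ³`. -/
def pd (i : Fin 3) (f : E3 → ℝ) (x : E3) : ℝ := fderiv ℝ f x (basis3 i)

/-- The Laplacian `Δf` on `ℝ³`. -/
def lap (f : E3 → ℝ) (x : E3) : ℝ := ∑ i, pd i (pd i f) x

/-- The radial derivative `∂_r f(x) = (x/|x|)·∇f(x)`. -/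
def pdr (f : E3 → ℝ) (x : E3) : ℝ := ‖x‖⁻¹ * ∑ i, x i * pd i f x

/-- The angular derivative `Ω_{ij} f = xᵢ ∂ⱼ f − xⱼ ∂ᵢ f`. -/
def ang (i j : Fin 3) (f : E3 → ℝ) (x : E3) : ℝ := x i * pd j f x - x j * pd i f x

/-- `Ω f = Σ_{i<j} Ω_{ij}(Ω_{ij} f)`. -/
def angLap (f : E3 → ℝ) (x : E3) : ℝ :=
  ∑ i, ∑ j, if i < j then ang i j (ang i j f) x else 0

/-- The squared length `|∇f(x)|²` of the gradient. -/
def gradsq (f : E3 → ℝ) (x : E3) : ℝ := ∑ i, (pd i f x) ^ 2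

/-- `Σ_{i<j} (Ω_{ij} g)²`. -/
def angsq (g : E3 → ℝ) (x : E3) : ℝ := ∑ i, ∑ j, if i < j then (ang i j g x) ^ 2 else 0

/-- `Σ_{i<j} Σ_{k<l} (Ω_{kl} Ω_{ij} g)²`. -/
def angsq2 (g : E3 → ℝ) (x : E3) : ℝ :=
  ∑ i, ∑ j, ∑ k, ∑ l, if i < j ∧ k < l then (ang k l (ang i j g) x) ^ 2 else 0

/-- The time derivative `∂_t u` of a space-time function. -/
def pdt (u : E3 × ℝ → ℝ) (p : E3 × ℝ) : ℝ := fderiv ℝ u p (0, 1)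

/-- The spatial slice `x ↦ u(x,t)` of a space-time function, at fixed time `t`. -/
def fixT (u : E3 × ℝ → ℝ) (t : ℝ) : E3 → ℝ := fun y => u (y, t)

/-- The spatial partial derivative `∂ᵢ u` of a space-time function (`t` fixed). -/
def pdx (i : Fin 3) (u : E3 × ℝ → ℝ) (p : E3 × ℝ) : ℝ := pd i (fixT u p.2) p.1

/-- The spatial radial derivative `∂_r u` of a space-time function (`t` fixed). -/
def pdrX (u : E3 × ℝ → ℝ) (p : E3 × ℝ) : ℝ := pdr (fixT u p.2) p.1

/-- The spatial angular derivative `Ω_{ij} u` of a space-time function (`t` fixed). -/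
def angX (i j : Fin 3) (u : E3 × ℝ → ℝ) (p : E3 × ℝ) : ℝ := ang i j (fixT u p.2) p.1

/-- The spatial operator `Ω u` of a space-time function (`t` fixed). -/
def angLapX (u : E3 × ℝ → ℝ) (p : E3 × ℝ) : ℝ := angLap (fixT u p.2) p.1

/-- The spatial Laplacian `Δu` of a space-time function (`t` fixed). -/
def lapX (u : E3 × ℝ → ℝ) (p : E3 × ℝ) : ℝ := lap (fixT u p.2) p.1

/-- The squared spatial gradient `|∇u|²` of a space-time function (`t` fixed). -/
def gradsqX (u : E3 × ℝ → ℝ) (p : E3 × ℝ) : ℝ := gradsq (fixT u p.2) p.1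

/-- `Σ_{i<j} (Ω_{ij} w)²` for a space-time function (`t` fixed). -/
def angsqX (w : E3 × ℝ → ℝ) (p : E3 × ℝ) : ℝ :=
  ∑ i, ∑ j, if i < j then (angX i j w p) ^ 2 else 0

/-- The solid light cone `t ≥ |x|`. -/
def cone : Set (E3 × ℝ) := {p | ‖p.1‖ ≤ p.2}

/-- `u` is a C² solution of the Goursat problem for `q` on the cone `t ≥ |x|`:
`∂_t²u − Δu − q u = 0` for `t > |x|` and `u(x,|x|) = ∫₀¹ q(σx) dσ`. -/
def GoursatSol (q : E3 → ℝ) (u : E3 × ℝ → ℝ) : Prop :=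
  ContDiffOn ℝ 2 u cone ∧
  (∀ p : E3 × ℝ, ‖p.1‖ < p.2 → pdt (pdt u) p - lapX u p - q p.1 * u p = 0) ∧
  (∀ x : E3, u (x, ‖x‖) = ∫ σ in (0:ℝ)..1, q (σ • x))

/-- `p(x) = ∫₀^{|x|} q(σ x/|x|) dσ`. -/
def pfun (q : E3 → ℝ) (x : E3) : ℝ := ∫ σ in (0:ℝ)..‖x‖, q ((σ / ‖x‖) • x)

/-- Integral over the sphere of radius `r` with respect to surface measure. -/
def sphInt (r : ℝ) (g : E3 → ℝ) : ℝ := ∫ x in sphere (0:E3) r, g x ∂μH[2]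

/-- Squared `L²` norm on the sphere of radius `r`. -/
def L2sq (g : E3 → ℝ) (r : ℝ) : ℝ := sphInt r (fun x => (g x) ^ 2)

/-- Squared `H¹` norm on the sphere of radius `r`. -/
def H1sq (g : E3 → ℝ) (r : ℝ) : ℝ := sphInt r (fun x => (g x) ^ 2 + (r ^ 2)⁻¹ * angsq g x)

/-- Squared `H²` norm on the sphere of radius `r`. -/
def H2sq (g : E3 → ℝ) (r : ℝ) : ℝ := H1sq g r + sphInt r (fun x => (r ^ 4)⁻¹ * angsq2 g x)

/-- The class `Q_γ(R,T)`. -/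
def memQ (R T γ : ℝ) (q : E3 → ℝ) : Prop :=
  ∀ r ∈ Icc R ((R + T) / 2),
    Real.sqrt (H2sq (pfun q) r) + Real.sqrt (H1sq (pdr (pfun q)) r) ≤
      γ * (Real.sqrt (H1sq (pfun q) r) + Real.sqrt (L2sq (pdr (pfun q)) r))

/-- The closed annulus `R ≤ |x| ≤ ρ` in `ℝ³`. -/
def Ann (R ρ : ℝ) : Set E3 := {x | R ≤ ‖x‖ ∧ ‖x‖ ≤ ρ}

/-- The space-time region `K_ρ = {R ≤ |x| ≤ ρ, |x| ≤ t ≤ R+T−|x|}`. -/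
def Kreg (R T ρ : ℝ) : Set (E3 × ℝ) :=
  {p | R ≤ ‖p.1‖ ∧ ‖p.1‖ ≤ ρ ∧ ‖p.1‖ ≤ p.2 ∧ p.2 ≤ R + T - ‖p.1‖}

/-- `F = ∂_t²w − ∂_r∂_r w − |x|^{-2} Ω w`. -/
def Fop (w : E3 × ℝ → ℝ) (p : E3 × ℝ) : ℝ :=
  pdt (pdt w) p - pdrX (pdrX w) p - (‖p.1‖ ^ 2)⁻¹ * angLapX w p

/-- The sideways energy `J(ρ)`. -/
def Jfun (R T : ℝ) (w : E3 × ℝ → ℝ) (ρ : ℝ) : ℝ :=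
  ∫ t in ρ..(R + T - ρ), sphInt ρ
    (fun x => (ρ ^ 2)⁻¹ * ((w (x, t)) ^ 2 + (pdt w (x, t)) ^ 2 + gradsqX w (x, t)))

/-- The double conical region `D_ρ = {|x| ≤ ρ, |x| ≤ t ≤ 2ρ − |x|}`. -/
def Dcone (ρ : ℝ) : Set (E3 × ℝ) :=
  {p | ‖p.1‖ ≤ ρ ∧ ‖p.1‖ ≤ p.2 ∧ p.2 ≤ 2 * ρ - ‖p.1‖}

/-- `u` is a C² solution of the Goursat problem for `q` on the double conical region `D_ρ`. -/
def IsSolOn (ρ : ℝ) (q : E3 → ℝ) (u : E3 × ℝ → ℝ) : Prop :=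
  ContDiffOn ℝ 2 u (Dcone ρ) ∧
  (∀ p ∈ interior (Dcone ρ), pdt (pdt u) p - lapX u p - q p.1 * u p = 0) ∧
  (∀ x : E3, ‖x‖ ≤ ρ → u (x, ‖x‖) = ∫ σ in (0:ℝ)..1, q (σ • x))

/-- Global continuous representatives of a function, its gradient and its Hessian on `Dcone ρ`. -/
structure Pack (ρ : ℝ) (W : E3 × ℝ → ℝ) (g : E3 × ℝ → (E3 × ℝ →L[ℝ] ℝ))
    (H : E3 × ℝ → (E3 × ℝ →L[ℝ] E3 × ℝ →L[ℝ] ℝ)) : Prop where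
  cW : Continuous W
  cg : Continuous g
  cH : Continuous H
  dW : ∀ p : E3 × ℝ, ‖p.1‖ < p.2 → ‖p.1‖ + p.2 < 2 * ρ → HasFDerivAt W (g p) p
  dg : ∀ p : E3 × ℝ, ‖p.1‖ < p.2 → ‖p.1‖ + p.2 < 2 * ρ → HasFDerivAt g (H p) p
  symm : ∀ p : E3 × ℝ, ‖p.1‖ < p.2 → ‖p.1‖ + p.2 < 2 * ρ → ∀ v w, H p v w = H p w v
  dW' : ∀ p ∈ Dcone ρ, HasFDerivWithinAt W (g p) (Dcone ρ) p

theorem isClosed_Dcone (ρ : ℝ) : IsClosed (Dcone ρ) := by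
  have h1 : IsClosed {p : E3 × ℝ | ‖p.1‖ ≤ ρ} := isClosed_le (by fun_prop) (by fun_prop)
  have h2 : IsClosed {p : E3 × ℝ | ‖p.1‖ ≤ p.2} := isClosed_le (by fun_prop) (by fun_prop)
  have h3 : IsClosed {p : E3 × ℝ | p.2 ≤ 2 * ρ - ‖p.1‖} :=
    isClosed_le (by fun_prop) (by fun_prop)
  exact h1.inter (h2.inter h3)

theorem isCompact_Dcone (ρ : ℝ) : IsCompact (Dcone ρ) := by
  refine Metric.isCompact_of_isClosed_isBounded (isClosed_Dcone ρ) ?_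
  refine ((isBounded_closedBall (x := (0 : E3)) (r := ρ)).prod
    (isBounded_Icc (0 : ℝ) (2 * ρ))).subset ?_
  rintro p ⟨h1, h2, h3⟩
  have := norm_nonneg p.1
  refine ⟨by simpa using h1, by linarith, by linarith⟩

theorem isOpen_dconeInner (ρ : ℝ) :
    IsOpen {p : E3 × ℝ | ‖p.1‖ < p.2 ∧ ‖p.1‖ + p.2 < 2 * ρ} :=
  (isOpen_lt (f := fun p : E3 × ℝ => ‖p.1‖) (g := fun p => p.2) (by fun_prop) (by fun_prop)).inter
    (isOpen_lt (f := fun p : E3 × ℝ => ‖p.1‖ + p.2) (g := fun _ => 2 * ρ) (by fun_prop)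
      (by fun_prop))

theorem mem_Dcone_of_le {ρ : ℝ} {p : E3 × ℝ} (h1 : ‖p.1‖ ≤ p.2) (h2 : ‖p.1‖ + p.2 ≤ 2 * ρ) :
    p ∈ Dcone ρ := ⟨by linarith, h1, by linarith⟩

theorem mem_interior_Dcone {ρ : ℝ} {p : E3 × ℝ} (h1 : ‖p.1‖ < p.2) (h2 : ‖p.1‖ + p.2 < 2 * ρ) :
    p ∈ interior (Dcone ρ) :=
  interior_maximal (fun _ h => mem_Dcone_of_le h.1.le h.2.le) (isOpen_dconeInner ρ) ⟨h1, h2⟩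

theorem convex_Dcone (ρ : ℝ) : Convex ℝ (Dcone ρ) := by
  intro p hp p' hp' a b ha hb hab
  have key : ‖(a • p + b • p').1‖ ≤ a * ‖p.1‖ + b * ‖p'.1‖ := by
    calc ‖(a • p + b • p').1‖ = ‖a • p.1 + b • p'.1‖ := rfl
      _ ≤ _ := (norm_add_le _ _).trans (by rw [norm_smul_of_nonneg ha, norm_smul_of_nonneg hb])
  have h2 : (a • p + b • p').2 = a * p.2 + b * p'.2 := rfl
  obtain ⟨h1, h3, h4⟩ := hp
  obtain ⟨h1', h3', h4'⟩ := hp'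
  refine mem_Dcone_of_le ?_ ?_
  · rw [h2]; nlinarith
  · rw [h2]
    have e : 2 * ρ = a * (2 * ρ) + b * (2 * ρ) := by rw [← add_mul, hab, one_mul]
    have e1 := mul_le_mul_of_nonneg_left h4 ha
    have e2 := mul_le_mul_of_nonneg_left h4' hb
    linarith

theorem uniqueDiffOn_Dcone {ρ : ℝ} (hρ : 0 < ρ) : UniqueDiffOn ℝ (Dcone ρ) :=
  uniqueDiffOn_convex (convex_Dcone ρ)
    ⟨((0 : E3), ρ), mem_interior_Dcone (by simpa using hρ) (by simp; linarith)⟩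

theorem exists_continuous_eqOn {X Y : Type} [TopologicalSpace X] [NormalSpace X]
    [NormedAddCommGroup Y] [NormedSpace ℝ Y] [FiniteDimensional ℝ Y] {s : Set X} (hs : IsClosed s)
    {f : X → Y} (hf : ContinuousOn f s) : ∃ F : X → Y, Continuous F ∧ EqOn F f s := by
  have : TietzeExtension.{0, 0} Y := TietzeExtension.of_tvs ℝ
  obtain ⟨F, hF⟩ := ContinuousMap.exists_restrict_eq hs ⟨s.domRestrict f, hf.domRestrict⟩
  exact ⟨F, F.continuous, fun x hx => congrArg (fun (k : C(s, Y)) => k ⟨x, hx⟩) hF⟩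

theorem exists_pack {ρ : ℝ} (hρ : 0 < ρ) {u : E3 × ℝ → ℝ} (hu : ContDiffOn ℝ 2 u (Dcone ρ)) :
    ∃ W g H, Pack ρ W g H ∧ EqOn W u (Dcone ρ) := by
  have hU := uniqueDiffOn_Dcone hρ
  have hcl := isClosed_Dcone ρ
  have h1 : ContDiffOn ℝ 1 (fderivWithin ℝ u (Dcone ρ)) (Dcone ρ) :=
    hu.fderivWithin hU (by norm_num)
  have h0 : ContDiffOn ℝ 0 (fderivWithin ℝ (fderivWithin ℝ u (Dcone ρ)) (Dcone ρ)) (Dcone ρ) :=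
    h1.fderivWithin hU (by norm_num)
  obtain ⟨W, cW, eW⟩ := exists_continuous_eqOn hcl hu.continuousOn
  obtain ⟨g, cg, eg⟩ := exists_continuous_eqOn hcl h1.continuousOn
  obtain ⟨H, cH, eH⟩ := exists_continuous_eqOn hcl h0.continuousOn
  have nh : ∀ p : E3 × ℝ, ‖p.1‖ < p.2 → ‖p.1‖ + p.2 < 2 * ρ → Dcone ρ ∈ nhds p :=
    fun p h h' => mem_interior_iff_mem_nhds.1 (mem_interior_Dcone h h')
  have dW' : ∀ p ∈ Dcone ρ, HasFDerivWithinAt W (g p) (Dcone ρ) p := fun p hp => by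
    rw [eg hp]
    exact ((hu.differentiableOn (by norm_num)) p hp).hasFDerivWithinAt.congr eW (eW hp)
  have dg' : ∀ p ∈ Dcone ρ, HasFDerivWithinAt g (H p) (Dcone ρ) p := fun p hp => by
    rw [eH hp]
    exact ((h1.differentiableOn (by norm_num)) p hp).hasFDerivWithinAt.congr eg (eg hp)
  refine ⟨W, g, H, ⟨cW, cg, cH, fun p h h' => ?_, fun p h h' => ?_, fun p h h' v w => ?_, dW'⟩, eW⟩
  · exact (dW' p (mem_of_mem_nhds (nh p h h'))).hasFDerivAt (nh p h h')
  · exact (dg' p (mem_of_mem_nhds (nh p h h'))).hasFDerivAt (nh p h h')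
  · refine second_derivative_symmetric_of_eventually (f := W) (f' := g) (x := p) ?_ ?_ v w
    · filter_upwards [(isOpen_dconeInner ρ).mem_nhds ⟨h, h'⟩] with q hq
      exact (dW' q (mem_of_mem_nhds (nh q hq.1 hq.2))).hasFDerivAt (nh q hq.1 hq.2)
    · exact (dg' p (mem_of_mem_nhds (nh p h h'))).hasFDerivAt (nh p h h')

namespace Pack

set_option maxSynthPendingDepth 3

variable {ρ : ℝ} {W W' : E3 × ℝ → ℝ} {g g' : E3 × ℝ → (E3 × ℝ →L[ℝ] ℝ)}
  {H H' : E3 × ℝ → (E3 × ℝ →L[ℝ] E3 × ℝ →L[ℝ] ℝ)}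

theorem add (P : Pack ρ W g H) (P' : Pack ρ W' g' H') :
    Pack ρ (fun p => W p + W' p) (fun p => g p + g' p) (fun p => H p + H' p) where
  cW := P.cW.add P'.cW
  cg := P.cg.add P'.cg
  cH := P.cH.add P'.cH
  dW p h h' := (P.dW p h h').add (P'.dW p h h')
  dg p h h' := (P.dg p h h').add (P'.dg p h h')
  symm p h h' v w := by simp [P.symm p h h' v w, P'.symm p h h' v w]
  dW' p h := (P.dW' p h).add (P'.dW' p h)

theorem const_smul (P : Pack ρ W g H) (c : ℝ) :
    Pack ρ (fun p => c * W p) (fun p => c • g p) (fun p => c • H p) where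
  cW := P.cW.const_smul c
  cg := P.cg.const_smul c
  cH := P.cH.const_smul c
  dW p h h' := (P.dW p h h').const_smul c
  dg p h h' := (P.dg p h h').const_smul c
  symm p h h' v w := by simp [P.symm p h h' v w]
  dW' p h := (P.dW' p h).const_smul c

theorem sub (P : Pack ρ W g H) (P' : Pack ρ W' g' H') :
    Pack ρ (fun p => W p - W' p) (fun p => g p - g' p) (fun p => H p - H' p) where
  cW := P.cW.sub P'.cW
  cg := P.cg.sub P'.cg
  cH := P.cH.sub P'.cH
  dW p h h' := (P.dW p h h').sub (P'.dW p h h')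
  dg p h h' := (P.dg p h h').sub (P'.dg p h h')
  symm p h h' v w := by simp [P.symm p h h' v w, P'.symm p h h' v w]
  dW' p h := (P.dW' p h).sub (P'.dW' p h)

end Pack

/-- The unit vector in the time direction. -/
def eT : E3 × ℝ := (0, 1)

/-- A vector of space viewed in space-time. -/
def eX (v : E3) : E3 × ℝ := (v, 0)

/-- The wave operator read off from a Hessian. -/
def boxH (B : E3 × ℝ →L[ℝ] E3 × ℝ →L[ℝ] ℝ) : ℝ :=
  B eT eT - ∑ i, B (eX (basis3 i)) (eX (basis3 i))

theorem HasFDerivAt.apply_const {G : E3 × ℝ → (E3 × ℝ →L[ℝ] ℝ)}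
    {G' : E3 × ℝ →L[ℝ] E3 × ℝ →L[ℝ] ℝ} {p : E3 × ℝ} (h : HasFDerivAt G G' p) (v : E3 × ℝ) :
    HasFDerivAt (fun q => G q v) (G'.flip v) p :=
  ((ContinuousLinearMap.apply ℝ ℝ v : (E3 × ℝ →L[ℝ] ℝ) →L[ℝ] ℝ).hasFDerivAt (x := G p)).comp p h

theorem hasFDerivAt_prodMk_const (y : E3) (t : ℝ) :
    HasFDerivAt (fun z : E3 => (z, t)) (ContinuousLinearMap.inl ℝ E3 ℝ) y :=
  (hasFDerivAt_id y).prodMk (hasFDerivAt_const t y)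

theorem Pack.pd_fixT {ρ : ℝ} {W u : E3 × ℝ → ℝ} {g : E3 × ℝ → (E3 × ℝ →L[ℝ] ℝ)}
    {H : E3 × ℝ → (E3 × ℝ →L[ℝ] E3 × ℝ →L[ℝ] ℝ)} (P : Pack ρ W g H) (e : EqOn W u (Dcone ρ))
    {p : E3 × ℝ} (h : ‖p.1‖ < p.2) (h' : ‖p.1‖ + p.2 < 2 * ρ) (i : Fin 3) :
    pd i (fixT u p.2) p.1 = g p (eX (basis3 i)) := by
  have hu : HasFDerivAt u (g p) p := (P.dW p h h').congr_of_eventuallyEq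
    (Filter.eventuallyEq_of_mem (mem_interior_iff_mem_nhds.1 (mem_interior_Dcone h h')) e.symm)
  have hc : HasFDerivAt (fixT u p.2) ((g p).comp (ContinuousLinearMap.inl ℝ E3 ℝ)) p.1 :=
    HasFDerivAt.comp p.1 (g := u) (f := fun z : E3 => (z, p.2)) hu
      (hasFDerivAt_prodMk_const p.1 p.2)
  rw [pd, hc.fderiv]; rfl

theorem Pack.pdt_eq {ρ : ℝ} {W u : E3 × ℝ → ℝ} {g : E3 × ℝ → (E3 × ℝ →L[ℝ] ℝ)}
    {H : E3 × ℝ → (E3 × ℝ →L[ℝ] E3 × ℝ →L[ℝ] ℝ)} (P : Pack ρ W g H) (e : EqOn W u (Dcone ρ))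
    {p : E3 × ℝ} (h : ‖p.1‖ < p.2) (h' : ‖p.1‖ + p.2 < 2 * ρ) : pdt u p = g p eT := by
  have hu : HasFDerivAt u (g p) p := (P.dW p h h').congr_of_eventuallyEq
    (Filter.eventuallyEq_of_mem (mem_interior_iff_mem_nhds.1 (mem_interior_Dcone h h')) e.symm)
  rw [pdt, hu.fderiv]; rfl

theorem Pack.boxH_eq {ρ : ℝ} {W u : E3 × ℝ → ℝ} {g : E3 × ℝ → (E3 × ℝ →L[ℝ] ℝ)}
    {H : E3 × ℝ → (E3 × ℝ →L[ℝ] E3 × ℝ →L[ℝ] ℝ)} (P : Pack ρ W g H) (e : EqOn W u (Dcone ρ))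
    {p : E3 × ℝ} (h : ‖p.1‖ < p.2) (h' : ‖p.1‖ + p.2 < 2 * ρ) :
    boxH (H p) = pdt (pdt u) p - lapX u p := by
  have hev : ∀ᶠ q in nhds p, ‖q.1‖ < q.2 ∧ ‖q.1‖ + q.2 < 2 * ρ :=
    (isOpen_dconeInner ρ).mem_nhds ⟨h, h'⟩
  have h1 : pdt (pdt u) p = H p eT eT := by
    have : HasFDerivAt (pdt u) ((H p).flip eT) p := by
      refine HasFDerivAt.congr_of_eventuallyEq ((P.dg p h h').apply_const eT) ?_
      filter_upwards [hev] with q hq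
      exact P.pdt_eq e hq.1 hq.2
    rw [pdt, this.fderiv]; rfl
  have h2 : ∀ i, pd i (pd i (fixT u p.2)) p.1 = H p (eX (basis3 i)) (eX (basis3 i)) := by
    intro i
    have hd : HasFDerivAt (fun z : E3 => g (z, p.2) (eX (basis3 i)))
        (((H p).flip (eX (basis3 i))).comp (ContinuousLinearMap.inl ℝ E3 ℝ)) p.1 :=
      HasFDerivAt.comp p.1 (g := fun q => g q (eX (basis3 i))) (f := fun z : E3 => (z, p.2))
        ((P.dg p h h').apply_const (eX (basis3 i)))
        (hasFDerivAt_prodMk_const p.1 p.2)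
    have : HasFDerivAt (pd i (fixT u p.2))
        (((H p).flip (eX (basis3 i))).comp (ContinuousLinearMap.inl ℝ E3 ℝ)) p.1 := by
      refine hd.congr_of_eventuallyEq ?_
      have hc : Continuous (fun z : E3 => (z, p.2)) := by fun_prop
      filter_upwards [hc.continuousAt.eventually hev] with z hz
      exact P.pd_fixT e (p := (z, p.2)) hz.1 hz.2 i
    rw [pd, this.fderiv]; rfl
  simp only [boxH, h1, lapX, lap, h2]

/-- The unit sphere of `ℝ³`. -/
abbrev S2 : Type := sphere (0 : E3) 1

/-- The surface measure on the unit sphere. -/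
def sig : Measure S2 := (volume : Measure E3).toSphere

instance : IsFiniteMeasure sig := inferInstanceAs (IsFiniteMeasure (volume : Measure E3).toSphere)

theorem S2.norm_coe (θ : S2) : ‖(θ : E3)‖ = 1 := by simp

theorem integral_polar_aux (f : E3 → ℝ) :
    ∫ x, f x = ∫ p : S2 × Ioi (0 : ℝ), f (p.2.1 • p.1.1) ∂(sig.prod (.volumeIoiPow 2)) := by
  have hd : Module.finrank ℝ E3 - 1 = 2 := by simp
  calc ∫ x, f x = ∫ x : ({(0 : E3)}ᶜ : Set E3), f x.1 ∂((volume : Measure E3).comap (↑)) := by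
        rw [integral_subtype_comap (measurableSet_singleton _).compl f, restrict_compl_singleton]
    _ = _ := by
      have h := (volume : Measure E3).measurePreserving_homeomorphUnitSphereProd.integral_comp
        (Homeomorph.measurableEmbedding _) (fun p : S2 × Ioi (0 : ℝ) => f (p.2.1 • p.1.1))
      rw [hd] at h
      rw [sig, ← h]
      refine integral_congr_ae (Filter.Eventually.of_forall fun x => ?_)
      have := homeomorphUnitSphereProd_symm_apply_coe E3 (homeomorphUnitSphereProd E3 x)
      simp only [Homeomorph.symm_apply_apply] at this
      simp only [← this]

theorem integrable_polar_aux {f : E3 → ℝ} (hf : Integrable f) :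
    Integrable (fun p : S2 × Ioi (0 : ℝ) => f (p.2.1 • p.1.1))
      (sig.prod (.volumeIoiPow 2)) := by
  have hd : Module.finrank ℝ E3 - 1 = 2 := by simp
  have h := (volume : Measure E3).measurePreserving_homeomorphUnitSphereProd.integrable_comp_emb
    (Homeomorph.measurableEmbedding _) (g := fun p : S2 × Ioi (0 : ℝ) => f (p.2.1 • p.1.1))
  rw [hd] at h
  refine h.1 ?_
  have h2 : Integrable (fun x : ({(0 : E3)}ᶜ : Set E3) => f x.1)
      ((volume : Measure E3).comap (↑)) :=
    (integrableOn_iff_comap_subtypeVal (measurableSet_singleton _).compl).1 hf.integrableOn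
  refine h2.congr (Filter.Eventually.of_forall fun x => ?_)
  have := homeomorphUnitSphereProd_symm_apply_coe E3 (homeomorphUnitSphereProd E3 x)
  simp only [Homeomorph.symm_apply_apply] at this
  simp only [Function.comp, ← this]

theorem integral_volumeIoiPow_two (f : ℝ → ℝ) :
    ∫ r : Ioi (0 : ℝ), f r.1 ∂(.volumeIoiPow 2) = ∫ r in Ioi (0 : ℝ), r ^ 2 * f r := by
  simp only [Measure.volumeIoiPow, ENNReal.ofReal]
  rw [integral_withDensity_eq_integral_smul (measurable_subtype_coe.pow_const _).real_toNNReal,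
    integral_subtype_comap measurableSet_Ioi fun a ↦ Real.toNNReal (a ^ 2) • f a,
    setIntegral_congr_fun measurableSet_Ioi fun x hx ↦ ?_]
  rw [NNReal.smul_def, Real.coe_toNNReal _ (pow_nonneg hx.out.le _), smul_eq_mul]

theorem integral_polar {f : E3 → ℝ} (hf : Integrable f) :
    ∫ x, f x = ∫ θ : S2, (∫ r in Ioi (0 : ℝ), r ^ 2 * f (r • θ.1)) ∂sig := by
  rw [integral_polar_aux, integral_prod _ (integrable_polar_aux hf)]
  exact integral_congr_ae (Filter.Eventually.of_forall fun θ =>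
    integral_volumeIoiPow_two fun r => f (r • θ.1))

theorem integral_closedBall_polar {f : E3 → ℝ} {R : ℝ} (hR : 0 ≤ R) (hf : Continuous f) :
    ∫ x in closedBall (0 : E3) R, f x
      = ∫ θ : S2, (∫ r in (0 : ℝ)..R, r ^ 2 * f (r • θ.1)) ∂sig := by
  rw [← integral_indicator measurableSet_closedBall, integral_polar
    ((hf.continuousOn.integrableOn_compact (isCompact_closedBall _ _)).integrable_indicator
      measurableSet_closedBall)]
  refine integral_congr_ae (Filter.Eventually.of_forall fun θ => ?_)
  simp only
  rw [intervalIntegral.integral_of_le hR]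
  have : Ioc 0 R = Ioi 0 ∩ Iic R := rfl
  rw [this, ← setIntegral_indicator measurableSet_Iic]
  refine setIntegral_congr_fun measurableSet_Ioi fun r hr => ?_
  have hr' : 0 < r := hr
  have hn : ‖r • (θ : E3)‖ = r := by rw [norm_smul, S2.norm_coe, mul_one, norm_of_nonneg hr'.le]
  by_cases h : r ≤ R
  · rw [indicator_of_mem (by simpa [hn] using h), indicator_of_mem (by exact h)]
  · rw [indicator_of_notMem (by simpa [hn] using h), indicator_of_notMem (by exact h), mul_zero]

open scoped Pointwise in
theorem measurePreserving_rot (e : E3 ≃ₗᵢ[ℝ] E3) (F : S2 → S2) (hF : ∀ θ, (F θ : E3) = e θ) :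
    MeasurePreserving F sig sig := by
  have hc : Continuous F := by
    refine continuous_induced_rng.2 ?_
    have : (Subtype.val ∘ F) = fun θ : S2 => e θ.1 := funext hF
    rw [this]; exact e.continuous.comp continuous_subtype_val
  refine ⟨hc.measurable, ?_⟩
  ext s hs
  rw [Measure.map_apply hc.measurable hs, sig, Measure.toSphere_apply' _ (hc.measurable hs),
    Measure.toSphere_apply' _ hs]
  congr 1
  have hm := (LinearIsometryEquiv.measurePreserving e).measure_preimage_emb
    e.toHomeomorph.measurableEmbedding (Ioo (0 : ℝ) 1 • (Subtype.val '' s))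
  rw [← hm]
  congr 1
  ext x
  simp only [mem_smul, mem_image, mem_preimage]
  constructor
  · rintro ⟨r, hr, y, ⟨θ, hθ, rfl⟩, rfl⟩
    exact ⟨r, hr, _, ⟨F θ, hθ, rfl⟩, by rw [hF]; simp⟩
  · rintro ⟨r, hr, y, ⟨θ, hθ, rfl⟩, h⟩
    have hn : ‖e.symm θ.1‖ = 1 := by simp
    refine ⟨r, hr, _, ⟨⟨e.symm θ.1, by simp⟩, ?_, rfl⟩, ?_⟩
    · have : F ⟨e.symm θ.1, by simp⟩ = θ := Subtype.ext (by rw [hF]; simp)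
      rw [this]; exact hθ
    · apply e.injective; rw [← h]; simp

open scoped Pointwise in
theorem sig_le_of_closeTo {s : Set S2} (hs : MeasurableSet s) {e : S2} {d : ℝ} (hd : 0 ≤ d)
    (h : ∀ θ ∈ s, ‖(θ : E3) - e‖ ≤ d) : sig s ≤ ENNReal.ofReal (24 * d ^ 2) := by
  obtain ⟨b, hb⟩ := Orthonormal.exists_orthonormalBasis_extension_of_card_eq (𝕜 := ℝ) (E := E3)
    (ι := Fin 3) (by simp) (v := fun _ => (e : E3)) (s := {0}) (by
      constructor
      · intro i; simp [Set.domRestrict]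
      · intro i j hij; exact absurd (Subsingleton.elim i j) hij)
  have hb0 : b 0 = (e : E3) := hb 0 rfl
  set B : Set (Fin 3 → ℝ) := Icc ![-1, -d, -d] ![1, d, d] with hB
  have hmp : MeasurePreserving (fun x : E3 => WithLp.ofLp (b.repr x)) volume volume :=
    (PiLp.volume_preserving_ofLp (Fin 3)).comp b.measurePreserving_repr
  have hsub : Ioo (0 : ℝ) 1 • (Subtype.val '' s) ⊆
      (fun x : E3 => WithLp.ofLp (b.repr x)) ⁻¹' B := by
    rintro x ⟨r, hr, y, ⟨θ, hθ, rfl⟩, rfl⟩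
    have hc : ∀ i, (b.repr (r • (θ : E3))) i = r * inner ℝ (b i) (θ : E3) := by
      intro i; rw [b.repr_apply_apply, inner_smul_right]
    have h0 : |r * inner ℝ (b 0) (θ : E3)| ≤ 1 := by
      rw [abs_mul, abs_of_pos hr.1]
      have := abs_real_inner_le_norm (b 0) (θ : E3)
      simp only [b.norm_eq_one, S2.norm_coe] at this
      nlinarith [hr.1, hr.2, abs_nonneg (inner ℝ (b 0) (θ : E3))]
    have hi : ∀ i, i ≠ 0 → |r * inner ℝ (b i) (θ : E3)| ≤ d := by
      intro i hi
      have e1 : inner ℝ (b i) (θ : E3) = inner ℝ (b i) ((θ : E3) - e) := by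
        rw [inner_sub_right, ← hb0, b.inner_eq_zero hi, sub_zero]
      rw [e1, abs_mul, abs_of_pos hr.1]
      have := abs_real_inner_le_norm (b i) ((θ : E3) - e)
      rw [b.norm_eq_one, one_mul] at this
      have := this.trans (h θ hθ)
      nlinarith [hr.1, hr.2, abs_nonneg (inner ℝ (b i) ((θ : E3) - e))]
    have k0 := abs_le.1 ((hc 0).symm ▸ h0)
    have k1 := abs_le.1 ((hc 1).symm ▸ hi 1 (by simp))
    have k2 := abs_le.1 ((hc 2).symm ▸ hi 2 (by simp))
    refine ⟨fun i => ?_, fun i => ?_⟩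
    · fin_cases i
      exacts [k0.1, k1.1, k2.1]
    · fin_cases i
      exacts [k0.2, k1.2, k2.2]
  have hv : volume B = ENNReal.ofReal (8 * d ^ 2) := by
    rw [hB, Real.volume_Icc_pi, Fin.prod_univ_three, ← ENNReal.ofReal_mul (by simp),
      ← ENNReal.ofReal_mul (by simp; nlinarith)]
    congr 1
    simp; ring
  calc sig s = 3 * volume (Ioo (0 : ℝ) 1 • (Subtype.val '' s)) := by
        rw [sig, Measure.toSphere_apply' _ hs]; simp
    _ ≤ 3 * volume ((fun x : E3 => WithLp.ofLp (b.repr x)) ⁻¹' B) := by gcongr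
    _ = ENNReal.ofReal (24 * d ^ 2) := by
        rw [hmp.measure_preimage measurableSet_Icc.nullMeasurableSet, hv]
        rw [show (3 : ENNReal) = ENNReal.ofReal 3 by simp, ← ENNReal.ofReal_mul (by norm_num)]
        congr 1; ring

theorem sig_le_hausdorff : sig ≤ (24 : ENNReal) • (μH[2] : Measure S2) := by
  have key : (24 : ENNReal)⁻¹ • sig ≤ μH[2] := by
    refine Measure.le_hausdorffMeasure 2 _ 1 one_pos fun s hs => ?_
    rcases s.eq_empty_or_nonempty with rfl | ⟨e, he⟩
    · simp
    have hfin : ediam s ≠ ⊤ := ne_top_of_le_ne_top ENNReal.one_ne_top hs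
    have h1 : sig (closure s) ≤ ENNReal.ofReal (24 * (ediam s).toReal ^ 2) := by
      refine sig_le_of_closeTo isClosed_closure.measurableSet (e := e) ENNReal.toReal_nonneg
        fun θ hθ => ?_
      have h2 : edist θ e ≤ ediam s := by
        rw [← Metric.ediam_closure]; exact Metric.edist_le_ediam_of_mem hθ (subset_closure he)
      rw [edist_dist] at h2
      have := (ENNReal.ofReal_le_iff_le_toReal hfin).1 h2
      rwa [Subtype.dist_eq, dist_eq_norm] at this
    have h3 : ENNReal.ofReal (24 * (ediam s).toReal ^ 2) = 24 * (ediam s) ^ (2 : ℝ) := by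
      rw [ENNReal.ofReal_mul (by norm_num), ENNReal.ofReal_pow ENNReal.toReal_nonneg,
        ENNReal.ofReal_toReal hfin]
      simp
    rw [Measure.smul_apply, smul_eq_mul]
    calc (24 : ENNReal)⁻¹ * sig s ≤ (24 : ENNReal)⁻¹ * (24 * (ediam s) ^ (2 : ℝ)) := by
          gcongr; rw [← h3]; exact (measure_mono subset_closure).trans h1
      _ = _ := by rw [← mul_assoc, ENNReal.inv_mul_cancel (by norm_num) (by norm_num), one_mul]
  intro s
  have := key s
  rw [Measure.smul_apply, smul_eq_mul] at this
  rw [Measure.smul_apply, smul_eq_mul]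
  calc sig s = 24 * ((24 : ENNReal)⁻¹ * sig s) := by
        rw [← mul_assoc, ENNReal.mul_inv_cancel (by norm_num) (by norm_num), one_mul]
    _ ≤ _ := by gcongr

theorem hausdorff_cap_lt_top (i j k : Fin 3) (hij : ∀ x : E3, ‖x‖ ^ 2 = x i ^ 2 + x j ^ 2 + x k ^ 2)
    (c : ℝ) (hc : |c| = 1) : μH[2] {x : E3 | ‖x‖ = 1 ∧ 1 / 2 ≤ c * x i} < ⊤ := by
  set s : Set E3 := {x : E3 | ‖x‖ = 1 ∧ 1 / 2 ≤ c * x i} with hs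
  have hc2 : c ^ 2 = 1 := by rw [← sq_abs, hc, one_pow]
  have hle : ∀ x ∈ s, |x j| ≤ 1 ∧ |x k| ≤ 1 := by
    intro x hx
    have := hij x
    rw [hx.1] at this
    exact ⟨abs_le_one_iff_mul_self_le_one.2 (by nlinarith [sq_nonneg (x i), sq_nonneg (x k)]),
      abs_le_one_iff_mul_self_le_one.2 (by nlinarith [sq_nonneg (x i), sq_nonneg (x j)])⟩
  let P : s → ℝ × ℝ := fun x => (x.1 j, x.1 k)
  have hP : AntilipschitzWith 6 P := by
    refine AntilipschitzWith.of_le_mul_dist fun x y => ?_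
    have hd : dist (P x) (P y) = max |x.1 j - y.1 j| |x.1 k - y.1 k| := rfl
    set m := max |x.1 j - y.1 j| |x.1 k - y.1 k| with hm
    have h1 : |x.1 j - y.1 j| ≤ m := le_max_left _ _
    have h2 : |x.1 k - y.1 k| ≤ m := le_max_right _ _
    have hm0 : 0 ≤ m := (abs_nonneg _).trans h1
    obtain ⟨xj, xk⟩ := hle x.1 x.2
    obtain ⟨yj, yk⟩ := hle y.1 y.2
    have ex := hij x.1
    have ey := hij y.1
    rw [x.2.1] at ex
    rw [y.2.1] at ey
    have h3 : |x.1 i - y.1 i| ≤ 4 * m := by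
      have hx := x.2.2
      have hy := y.2.2
      have e1 : (c * x.1 i - c * y.1 i) * (c * x.1 i + c * y.1 i) =
          -((x.1 j - y.1 j) * (x.1 j + y.1 j)) - (x.1 k - y.1 k) * (x.1 k + y.1 k) := by
        have : (c * x.1 i - c * y.1 i) * (c * x.1 i + c * y.1 i)
          = c ^ 2 * (x.1 i ^ 2 - y.1 i ^ 2) := by ring
        rw [this, hc2]; linarith
      have e2 : |c * x.1 i - c * y.1 i| * (c * x.1 i + c * y.1 i) ≤ 4 * m := by
        rw [← abs_of_nonneg (show 0 ≤ c * x.1 i + c * y.1 i by linarith), ← abs_mul, e1]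
        refine (abs_sub _ _).trans ?_
        rw [abs_neg, abs_mul, abs_mul]
        have a1 : |x.1 j + y.1 j| ≤ 2 := (abs_add_le _ _).trans (by linarith)
        have a2 : |x.1 k + y.1 k| ≤ 2 := (abs_add_le _ _).trans (by linarith)
        nlinarith [mul_le_mul h1 a1 (abs_nonneg _) hm0, mul_le_mul h2 a2 (abs_nonneg _) hm0]
      have e3 : |c * x.1 i - c * y.1 i| = |x.1 i - y.1 i| := by
        rw [← mul_sub, abs_mul, hc, one_mul]
      rw [e3] at e2
      nlinarith [abs_nonneg (x.1 i - y.1 i)]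
    have h4 : ‖x.1 - y.1‖ ^ 2 ≤ (6 * m) ^ 2 := by
      rw [hij]
      simp only [PiLp.sub_apply]
      have b1 : (x.1 j - y.1 j) ^ 2 ≤ m ^ 2 := sq_le_sq' (by linarith [abs_le.1 h1]) (abs_le.1 h1).2
      have b2 : (x.1 k - y.1 k) ^ 2 ≤ m ^ 2 := sq_le_sq' (by linarith [abs_le.1 h2]) (abs_le.1 h2).2
      have b3 : (x.1 i - y.1 i) ^ 2 ≤ (4 * m) ^ 2 :=
        sq_le_sq' (by linarith [abs_le.1 h3]) (abs_le.1 h3).2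
      nlinarith
    have h5 := abs_le_of_sq_le_sq h4 (by positivity)
    rw [hd, Subtype.dist_eq, dist_eq_norm]
    simpa [abs_of_nonneg (norm_nonneg _)] using h5
  have h1 := hP.le_hausdorffMeasure_image (d := 2) (by norm_num) univ
  have h2 : μH[2] (P '' univ) ≤ volume (Icc (-1 : ℝ) 1 ×ˢ Icc (-1 : ℝ) 1) := by
    rw [hausdorffMeasure_prod_real]
    refine measure_mono ?_
    rintro _ ⟨x, -, rfl⟩
    exact ⟨abs_le.1 (hle x.1 x.2).1, abs_le.1 (hle x.1 x.2).2⟩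
  have h3 : volume (Icc (-1 : ℝ) 1 ×ˢ Icc (-1 : ℝ) 1) < ⊤ :=
    (isCompact_Icc.prod isCompact_Icc).measure_lt_top
  have h4 : μH[2] s = μH[2] (univ : Set s) := by
    rw [← (isometry_subtype_coe (s := s)).hausdorffMeasure_image (Or.inl (by norm_num)) univ]
    simp
  rw [h4]
  refine h1.trans_lt (ENNReal.mul_lt_top ?_ (h2.trans_lt h3))
  exact ENNReal.rpow_lt_top_of_nonneg (by norm_num) (by simp)

theorem E3.norm_sq (x : E3) : ‖x‖ ^ 2 = x 0 ^ 2 + x 1 ^ 2 + x 2 ^ 2 := by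
  rw [EuclideanSpace.norm_sq_eq, Fin.sum_univ_three]; simp

theorem hausdorff_sphere_one_lt_top : μH[2] (sphere (0 : E3) 1) < ⊤ := by
  have hcap : ∀ i : Fin 3, ∀ c : ℝ, |c| = 1 → μH[2] {x : E3 | ‖x‖ = 1 ∧ 1 / 2 ≤ c * x i} < ⊤ := by
    intro i c hc
    fin_cases i
    · exact hausdorff_cap_lt_top 0 1 2 (fun x => E3.norm_sq x) c hc
    · exact hausdorff_cap_lt_top 1 0 2 (fun x => by rw [E3.norm_sq]; ring) c hc
    · exact hausdorff_cap_lt_top 2 1 0 (fun x => by rw [E3.norm_sq]; ring) c hc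
  have hsub : sphere (0 : E3) 1 ⊆ ⋃ i : Fin 3, ({x : E3 | ‖x‖ = 1 ∧ 1 / 2 ≤ (1 : ℝ) * x i} ∪
      {x : E3 | ‖x‖ = 1 ∧ 1 / 2 ≤ (-1 : ℝ) * x i}) := by
    intro x hx
    have hx1 : ‖x‖ = 1 := by simpa using hx
    by_contra hcon
    simp only [mem_iUnion, mem_union, mem_ofPred_eq, hx1, true_and, not_exists, not_or, not_le]
      at hcon
    have h := E3.norm_sq x
    rw [hx1] at h
    have hh : ∀ i, x i ^ 2 < (1 / 2) ^ 2 := fun i =>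
      sq_lt_sq' (by linarith [(hcon i).2]) (by linarith [(hcon i).1])
    linarith [hh 0, hh 1, hh 2]
  refine (measure_mono hsub).trans_lt ?_
  refine (measure_iUnion_le _).trans_lt ?_
  rw [tsum_fintype]
  refine ENNReal.sum_lt_top.2 fun i _ => ?_
  exact (measure_union_le _ _).trans_lt
    (ENNReal.add_lt_top.2 ⟨hcap i 1 (by simp), hcap i (-1) (by simp)⟩)

open scoped Pointwise in
theorem hausdorff_sphere_lt_top {R : ℝ} (hR : 0 < R) : μH[2] (sphere (0 : E3) R) < ⊤ := by
  have h := Measure.hausdorffMeasure_smul₀ (𝕜 := ℝ) (E := E3) (d := 2) (by norm_num) hR.ne'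
    (sphere (0 : E3) 1)
  have h2 : R • sphere (0 : E3) 1 = sphere (0 : E3) R := by
    rw [smul_sphere' hR.ne']; simp [abs_of_pos hR]
  rw [h2] at h
  rw [h]
  exact ENNReal.mul_lt_top (by simp) hausdorff_sphere_one_lt_top

/-- Dilation of the unit sphere, as a map into `ℝ³`. -/
def dil (R : ℝ) (θ : S2) : E3 := R • (θ : E3)

theorem measurableEmbedding_dil {R : ℝ} (hR : 0 < R) : MeasurableEmbedding (dil R) := by
  have hc : Continuous (dil R) := by unfold dil; fun_prop
  refine (hc.isClosedEmbedding ?_).measurableEmbedding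
  intro θ θ' h
  exact Subtype.ext (smul_right_injective E3 hR.ne' h)

theorem map_dil_sig_le {R : ℝ} (hR : 0 < R) :
    sig.map (dil R) ≤ ((24 : ENNReal) * (Real.toNNReal R⁻¹ : ENNReal) ^ (2 : ℝ)) •
      (μH[2] : Measure E3).restrict (sphere (0 : E3) R) := by
  have hA : AntilipschitzWith (Real.toNNReal R⁻¹) (dil R) := by
    refine AntilipschitzWith.of_le_mul_dist fun x y => ?_
    rw [Real.coe_toNNReal _ (by positivity), dil, dil, dist_smul₀, norm_of_nonneg hR.le,
      ← mul_assoc, inv_mul_cancel₀ hR.ne', one_mul, Subtype.dist_eq]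
  refine Measure.le_iff.2 fun s hs => ?_
  rw [(measurableEmbedding_dil hR).map_apply, Measure.smul_apply, smul_eq_mul,
    Measure.restrict_apply hs]
  calc sig (dil R ⁻¹' s) ≤ 24 * μH[2] (dil R ⁻¹' s) := sig_le_hausdorff _
    _ ≤ 24 * ((Real.toNNReal R⁻¹ : ENNReal) ^ (2 : ℝ) * μH[2] (dil R '' (dil R ⁻¹' s))) := by
        gcongr; exact hA.le_hausdorffMeasure_image (by norm_num) _
    _ ≤ 24 * ((Real.toNNReal R⁻¹ : ENNReal) ^ (2 : ℝ) * μH[2] (s ∩ sphere (0 : E3) R)) := by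
        gcongr
        rintro _ ⟨θ, hθ, rfl⟩
        exact ⟨hθ, by simp [dil, norm_smul, abs_of_pos hR]⟩
    _ = _ := by rw [mul_assoc]

theorem exists_integral_sig_le {R : ℝ} (hR : 0 < R) : ∃ C > (0 : ℝ), ∀ F : E3 → ℝ,
    (∀ x ∈ sphere (0 : E3) R, 0 ≤ F x) → IntegrableOn F (sphere (0 : E3) R) μH[2] →
    ∫ θ : S2, F (R • θ.1) ∂sig ≤ C * sphInt R F := by
  set c : ENNReal := (24 : ENNReal) * (Real.toNNReal R⁻¹ : ENNReal) ^ (2 : ℝ) with hc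
  have hcfin : c ≠ ⊤ := ENNReal.mul_ne_top (by norm_num)
    (ENNReal.rpow_ne_top_of_nonneg (by norm_num) ENNReal.coe_ne_top)
  have hc0 : c ≠ 0 := by
    refine mul_ne_zero (by norm_num) ?_
    have : (0 : NNReal) < Real.toNNReal R⁻¹ := by simpa using hR
    exact (ENNReal.rpow_pos (by simpa using hR) ENNReal.coe_ne_top).ne'
  refine ⟨c.toReal, ENNReal.toReal_pos hc0 hcfin, fun F h0 hi => ?_⟩
  have e : ∫ θ : S2, F (R • θ.1) ∂sig = ∫ x, F x ∂(sig.map (dil R)) :=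
    ((measurableEmbedding_dil hR).integral_map F).symm
  rw [e, sphInt, ← smul_eq_mul, ← integral_smul_measure]
  refine integral_mono_measure (map_dil_sig_le hR) ?_ (Integrable.smul_measure hi hcfin)
  refine Measure.ae_smul_measure ?_ c
  exact (ae_restrict_mem isClosed_sphere.measurableSet).mono fun x hx => h0 x hx

/-- Generator of the rotations about the `k`-th axis. -/
def rotGen (k : Fin 3) : E3 →L[ℝ] E3 :=
  (EuclideanSpace.proj (𝕜 := ℝ) (k + 1)).smulRight (basis3 (k + 2))
    - (EuclideanSpace.proj (𝕜 := ℝ) (k + 2)).smulRight (basis3 (k + 1))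

theorem rotGen_apply (k : Fin 3) (x : E3) :
    rotGen k x = x (k + 1) • basis3 (k + 2) - x (k + 2) • basis3 (k + 1) := rfl

theorem rotGen_cube (k : Fin 3) (x : E3) : rotGen k (rotGen k (rotGen k x)) = -rotGen k x := by
  ext i
  fin_cases k <;> fin_cases i <;> simp [rotGen_apply, basis3]

/-- Rotation of angle `α` about the `k`-th axis. -/
def rotLin (k : Fin 3) (α : ℝ) : E3 →L[ℝ] E3 :=
  ContinuousLinearMap.id ℝ E3 + sin α • rotGen k + (1 - cos α) • (rotGen k).comp (rotGen k)

theorem rotLin_apply (k : Fin 3) (α : ℝ) (x : E3) :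
    rotLin k α x = x + sin α • rotGen k x + (1 - cos α) • rotGen k (rotGen k x) := rfl

theorem norm_rotLin (k : Fin 3) (α : ℝ) (x : E3) : ‖rotLin k α x‖ = ‖x‖ := by
  rw [← sq_eq_sq₀ (norm_nonneg _) (norm_nonneg _), E3.norm_sq, E3.norm_sq]
  have h := sin_sq_add_cos_sq α
  fin_cases k <;> simp [rotLin_apply, rotGen_apply, basis3]
  · linear_combination (x 1 ^ 2 + x 2 ^ 2) * h
  · linear_combination (x 0 ^ 2 + x 2 ^ 2) * h
  · linear_combination (x 0 ^ 2 + x 1 ^ 2) * h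

theorem hasDerivAt_rotLin (k : Fin 3) (α : ℝ) (x : E3) :
    HasDerivAt (fun α => rotLin k α x) (rotGen k (rotLin k α x)) α := by
  have h1 : HasDerivAt (fun α => sin α • rotGen k x) (cos α • rotGen k x) α :=
    (hasDerivAt_sin α).smul_const _
  have h2 : HasDerivAt (fun α => (1 - cos α) • rotGen k (rotGen k x))
      (sin α • rotGen k (rotGen k x)) α := by
    have := ((hasDerivAt_cos α).const_sub 1).smul_const (rotGen k (rotGen k x))
    simpa using this
  have h3 := (h1.const_add x).add h2
  refine h3.congr_deriv ?_
  rw [rotLin_apply, map_add, map_add, map_smul, map_smul, rotGen_cube, sub_smul, smul_neg]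
  module

/-- The action of the rotations on the unit sphere. -/
def rotS (k : Fin 3) (α : ℝ) (θ : S2) : S2 :=
  ⟨rotLin k α θ, by simp [norm_rotLin]⟩

theorem measurePreserving_rotS (k : Fin 3) (α : ℝ) : MeasurePreserving (rotS k α) sig sig := by
  let l : E3 →ₗᵢ[ℝ] E3 := ⟨(rotLin k α).toLinearMap, norm_rotLin k α⟩
  exact measurePreserving_rot (l.toLinearIsometryEquiv rfl) _ fun θ => rfl

theorem continuous_rotS (k : Fin 3) : Continuous fun p : ℝ × S2 => rotS k p.1 p.2 := by
  refine Continuous.subtype_mk ?_ _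
  simp only [rotLin_apply]
  fun_prop

theorem continuous_rotS_right (k : Fin 3) (α : ℝ) : Continuous (rotS k α) := by
  refine Continuous.subtype_mk ?_ _
  fun_prop

theorem S2.integrable {F : S2 → ℝ} (hF : Continuous F) : Integrable F sig :=
  hF.integrable_of_hasCompactSupport (HasCompactSupport.of_compactSpace F)

theorem S2.integral_intervalIntegral_swap {f : ℝ → S2 → ℝ}
    (hf : Continuous (Function.uncurry f)) (a b : ℝ) :
    ∫ θ, (∫ x in a..b, f x θ) ∂sig = ∫ x in a..b, (∫ θ, f x θ ∂sig) := by
  refine (MeasureTheory.intervalIntegral_integral_swap ?_).symm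
  have hi : IntegrableOn (Function.uncurry f)
      (uIcc a b ×ˢ (univ : Set S2)) ((volume : Measure ℝ).prod sig) :=
    ContinuousOn.integrableOn_compact (isCompact_uIcc.prod isCompact_univ) hf.continuousOn
  rw [IntegrableOn, ← Measure.prod_restrict, Measure.restrict_univ] at hi
  exact hi.mono_measure
    (Measure.prod_mono (Measure.restrict_mono uIoc_subset_uIcc le_rfl) le_rfl)

theorem integral_rotS (k : Fin 3) (α : ℝ) {f : S2 → ℝ} (hf : Continuous f) :
    ∫ θ, f (rotS k α θ) ∂sig = ∫ θ, f θ ∂sig := by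
  have hm := measurePreserving_rotS k α
  have h := integral_map (f := f) hm.measurable.aemeasurable
    (by rw [hm.map_eq]; exact hf.aestronglyMeasurable)
  rw [hm.map_eq] at h
  exact h.symm

theorem integral_eq_zero_of_eq_rotS_sub (k : Fin 3) {κ G : S2 → ℝ} (hKc : Continuous κ)
    (hG : ∀ θ, G θ = κ (rotS k 1 θ) - κ θ) : ∫ θ, G θ ∂sig = 0 := by
  have hcr : Continuous fun θ => κ (rotS k 1 θ) :=
    hKc.comp (continuous_rotS_right k 1)
  have h2 : ∫ θ, (κ (rotS k 1 θ) - κ θ) ∂sig = ∫ θ, κ (rotS k 1 θ) ∂sig - ∫ θ, κ θ ∂sig :=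
    integral_sub (S2.integrable hcr) (S2.integrable hKc)
  rw [show G = fun θ => κ (rotS k 1 θ) - κ θ from funext hG, h2, integral_rotS k 1 hKc, sub_self]

theorem integral_angular_deriv (k : Fin 3) {κ ω : S2 → ℝ} (hKc : Continuous κ) (hc : Continuous ω)
    (hK : ∀ θ α, HasDerivAt (fun α => κ (rotS k α θ)) (ω (rotS k α θ)) α) :
    ∫ θ, ω θ ∂sig = 0 := by
  have hcont : Continuous fun p : ℝ × S2 => ω (rotS k p.1 p.2) := hc.comp (continuous_rotS k)
  have hftc : ∀ θ : S2, ∫ α in (0:ℝ)..1, ω (rotS k α θ) = κ (rotS k 1 θ) - κ θ := by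
    intro θ
    have h0 : κ θ = κ (rotS k 0 θ) := by congr 1; ext1; simp [rotS, rotLin_apply]
    rw [h0]
    exact intervalIntegral.integral_eq_sub_of_hasDerivAt (f := fun α => κ (rotS k α θ))
      (fun α _ => hK θ α)
      ((hcont.comp (continuous_id.prodMk continuous_const)).intervalIntegrable _ _)
  have e1 : ∫ θ, (∫ α in (0:ℝ)..1, ω (rotS k α θ)) ∂sig = 0 :=
    integral_eq_zero_of_eq_rotS_sub k hKc hftc
  rw [S2.integral_intervalIntegral_swap (f := fun α θ => ω (rotS k α θ)) hcont] at e1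
  simp_rw [integral_rotS k _ hc] at e1
  simpa using e1

/-- Characteristic coordinates `(r, τ, x) ↦ (r x, r + τ)`. -/
def chi (r τ : ℝ) (x : E3) : E3 × ℝ := (r • x, r + τ)

/-- The outgoing null direction `(x, 1)`. -/
def eL (x : E3) : E3 × ℝ := (x, 1)

section Curves
variable {ρ : ℝ} {W : E3 × ℝ → ℝ} {g : E3 × ℝ → (E3 × ℝ →L[ℝ] ℝ)}
  {H : E3 × ℝ → (E3 × ℝ →L[ℝ] E3 × ℝ →L[ℝ] ℝ)}

theorem Pack.deriv_curve (P : Pack ρ W g H) {c : ℝ → E3 × ℝ} {c' : E3 × ℝ} {a : ℝ}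
    (h1 : ‖(c a).1‖ < (c a).2) (h2 : ‖(c a).1‖ + (c a).2 < 2 * ρ) (hc : HasDerivAt c c' a) :
    HasDerivAt (fun s => W (c s)) (g (c a) c') a :=
  HasFDerivAt.comp_hasDerivAt (f := c) a (P.dW _ h1 h2) hc

theorem Pack.deriv_curve_g (P : Pack ρ W g H) {c v : ℝ → E3 × ℝ} {c' v' : E3 × ℝ} {a : ℝ}
    (h1 : ‖(c a).1‖ < (c a).2) (h2 : ‖(c a).1‖ + (c a).2 < 2 * ρ) (hc : HasDerivAt c c' a)
    (hv : HasDerivAt v v' a) :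
    HasDerivAt (fun s => g (c s) (v s)) (H (c a) c' (v a) + g (c a) v') a := by
  have h := HasFDerivAt.comp_hasDerivAt (f := c) a (P.dg _ h1 h2) hc
  exact h.clm_apply hv

theorem Pack.deriv_curve_g_const (P : Pack ρ W g H) {c : ℝ → E3 × ℝ} {c' v : E3 × ℝ} {a : ℝ}
    (h1 : ‖(c a).1‖ < (c a).2) (h2 : ‖(c a).1‖ + (c a).2 < 2 * ρ) (hc : HasDerivAt c c' a) :
    HasDerivAt (fun s => g (c s) v) (H (c a) c' v) a := by
  simpa using P.deriv_curve_g h1 h2 hc (hasDerivAt_const a v)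

theorem hasDerivAt_chi_r (r τ : ℝ) (x : E3) : HasDerivAt (fun r => chi r τ x) (eL x) r := by
  have h := ((hasDerivAt_id r).smul_const x).prodMk ((hasDerivAt_id r).add_const τ)
  simpa [chi, eL] using h

theorem hasDerivAt_chi_τ (r τ : ℝ) (x : E3) : HasDerivAt (fun τ => chi r τ x) eT τ :=
  (hasDerivAt_const τ (r • x)).prodMk ((hasDerivAt_id τ).const_add r)

theorem norm_chi_fst {r : ℝ} (hr : 0 ≤ r) (τ : ℝ) (θ : S2) : ‖(chi r τ θ).1‖ = r := by
  simp [chi, norm_smul, abs_of_nonneg hr]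

theorem chi_snd (r τ : ℝ) (x : E3) : (chi r τ x).2 = r + τ := rfl

theorem eX_smul (c : ℝ) (v : E3) : eX (c • v) = c • eX v := by simp [eX]
theorem eX_add (v w : E3) : eX (v + w) = eX v + eX w := by simp [eX]
theorem eX_sub (v w : E3) : eX (v - w) = eX v - eX w := by simp [eX]
theorem eL_eq (x : E3) : eL x = eX x + eT := by simp [eX, eL, eT]

theorem sum_rotGen_rotGen (x : E3) : ∑ k, rotGen k (rotGen k x) = (-2 : ℝ) • x := by
  ext i
  simp only [Fin.sum_univ_three]
  fin_cases i <;> simp [rotGen_apply, basis3] <;> ring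

theorem E3.eq_sum (x : E3) : x = ∑ i, x i • basis3 i := by
  ext i
  fin_cases i <;> simp [Fin.sum_univ_three, basis3]

theorem sum_rotGen_bilin (B : E3 × ℝ →L[ℝ] E3 × ℝ →L[ℝ] ℝ) (θ : S2) :
    ∑ k, B (eX (rotGen k θ)) (eX (rotGen k θ)) =
      (∑ i, B (eX (basis3 i)) (eX (basis3 i))) - B (eX θ) (eX θ) := by
  have h := E3.norm_sq θ
  rw [S2.norm_coe] at h
  rw [E3.eq_sum θ]
  conv_lhs => rw [← E3.eq_sum θ]
  simp only [rotGen_apply, eX_smul, eX_sub, eX_add, map_sub, map_add, map_smul, Fin.sum_univ_three,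
    _root_.add_apply, _root_.sub_apply, _root_.smul_apply,
    smul_eq_mul]
  simp only [show (0:Fin 3)+1 = 1 from rfl, show (0:Fin 3)+2 = 2 from rfl,
    show (1:Fin 3)+1 = 2 from rfl, show (1:Fin 3)+2 = 0 from rfl, show (2:Fin 3)+1 = 0 from rfl,
    show (2:Fin 3)+2 = 1 from rfl]
  set b := fun i j => B (eX (basis3 i)) (eX (basis3 j)) with hb
  linear_combination (-(b 0 0 + b 1 1 + b 2 2)) * h

/-- The angular part of the operator applied to `r W`, written in characteristic coordinates. -/
def angTerm (r : ℝ) (θ : E3) (γ : E3 × ℝ →L[ℝ] ℝ) (B : E3 × ℝ →L[ℝ] E3 × ℝ →L[ℝ] ℝ) : ℝ :=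
  ∑ k, (r * B (eX (rotGen k θ)) (eX (rotGen k θ)) + γ (eX (rotGen k (rotGen k θ))))

theorem angTerm_eq (r : ℝ) (θ : S2) (γ : E3 × ℝ →L[ℝ] ℝ) (B : E3 × ℝ →L[ℝ] E3 × ℝ →L[ℝ] ℝ) :
    angTerm r θ γ B = r * ((∑ i, B (eX (basis3 i)) (eX (basis3 i))) - B (eX θ) (eX θ))
      - 2 * γ (eX θ) := by
  have h : ∑ k, γ (eX (rotGen k (rotGen k (θ : E3)))) = -2 * γ (eX θ) := by
    rw [← smul_eq_mul, ← map_smul, ← eX_smul, ← sum_rotGen_rotGen]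
    simp only [Fin.sum_univ_three, eX_add, map_add]
  rw [angTerm, Finset.sum_add_distrib, ← Finset.mul_sum, sum_rotGen_bilin, h]
  ring

theorem box_identity (r : ℝ) (θ : S2) (γ : E3 × ℝ →L[ℝ] ℝ) (B : E3 × ℝ →L[ℝ] E3 × ℝ →L[ℝ] ℝ)
    (hB : ∀ v w, B v w = B w v) :
    2 * (γ eT + r * B (eL θ) eT) - (2 * γ (eL θ) + r * B (eL θ) (eL θ))
      = r * boxH B + angTerm r θ γ B := by
  rw [angTerm_eq, boxH, eL_eq]
  simp only [map_add, _root_.add_apply]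
  rw [hB eT (eX θ)]
  ring

section Rot
variable {r τ : ℝ} (k : Fin 3) (θ : S2) (α : ℝ)

theorem hasDerivAt_rotGen_rotS :
    HasDerivAt (fun α => eX (rotGen k (rotS k α θ))) (eX (rotGen k (rotGen k (rotS k α θ)))) α :=
  ((rotGen k).hasFDerivAt.comp_hasDerivAt α (hasDerivAt_rotLin k α θ)).prodMk (hasDerivAt_const α 0)

theorem hasDerivAt_eL_rotS :
    HasDerivAt (fun α => eL (rotS k α θ)) (eX (rotGen k (rotS k α θ))) α :=
  (hasDerivAt_rotLin k α θ).prodMk (hasDerivAt_const α 1)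

theorem hasDerivAt_chi_rotS :
    HasDerivAt (fun α => chi r τ (rotS k α θ)) (r • eX (rotGen k (rotS k α θ))) α := by
  have h := ((hasDerivAt_rotLin k α θ).const_smul r).prodMk (hasDerivAt_const α (r + τ))
  rw [← eX_smul]
  exact h

end Rot

theorem continuous_chi_S2 (r τ : ℝ) : Continuous fun θ : S2 => chi r τ θ := by
  unfold chi; fun_prop

theorem continuous_eX : Continuous eX := by unfold eX; fun_prop

theorem continuous_eL : Continuous eL := by unfold eL; fun_prop

theorem Pack.integral_multiplier (P : Pack ρ W g H) {r τ : ℝ} (hr : 0 ≤ r) (hτ : 0 < τ)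
    (hrτ : 2 * r + τ < 2 * ρ) (c0 c1 c2 : ℝ) :
    ∫ θ : S2, (angTerm r θ (g (chi r τ θ)) (H (chi r τ θ)) *
        (c0 * W (chi r τ θ) + c1 * g (chi r τ θ) (eL θ) + c2 * g (chi r τ θ) eT)
      + ∑ k, g (chi r τ θ) (eX (rotGen k θ)) * (c0 * (r * g (chi r τ θ) (eX (rotGen k θ)))
        + c1 * (r * H (chi r τ θ) (eX (rotGen k θ)) (eL θ) + g (chi r τ θ) (eX (rotGen k θ)))
        + c2 * (r * H (chi r τ θ) (eX (rotGen k θ)) eT))) ∂sig = 0 := by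
  have hin : ∀ θ : S2, ‖(chi r τ θ).1‖ < (chi r τ θ).2 ∧ ‖(chi r τ θ).1‖ + (chi r τ θ).2 < 2 * ρ :=
    fun θ => by rw [norm_chi_fst hr, chi_snd]; constructor <;> linarith
  have cχ := continuous_chi_S2 r τ
  have cW := P.cW.comp cχ
  have cg := P.cg.comp cχ
  have cH := P.cH.comp cχ
  have cA : ∀ k, Continuous fun θ : S2 => eX (rotGen k θ) := fun k =>
    continuous_eX.comp (by fun_prop)
  have cAA : ∀ k, Continuous fun θ : S2 => eX (rotGen k (rotGen k θ)) := fun k =>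
    continuous_eX.comp (by fun_prop)
  have cL : Continuous fun θ : S2 => eL θ := continuous_eL.comp (by fun_prop)
  have hM : Continuous fun θ : S2 =>
      c0 * W (chi r τ θ) + c1 * g (chi r τ θ) (eL θ) + c2 * g (chi r τ θ) eT :=
    ((continuous_const.mul cW).add (continuous_const.mul (cg.clm_apply cL))).add
      (continuous_const.mul (cg.clm_apply continuous_const))
  have hγ : ∀ k, Continuous fun θ : S2 => g (chi r τ θ) (eX (rotGen k θ)) :=
    fun k => cg.clm_apply (cA k)
  have hω : ∀ k, Continuous fun θ : S2 => (r * H (chi r τ θ) (eX (rotGen k θ)) (eX (rotGen k θ))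
        + g (chi r τ θ) (eX (rotGen k (rotGen k θ)))) *
        (c0 * W (chi r τ θ) + c1 * g (chi r τ θ) (eL θ) + c2 * g (chi r τ θ) eT)
      + g (chi r τ θ) (eX (rotGen k θ)) * (c0 * (r * g (chi r τ θ) (eX (rotGen k θ)))
        + c1 * (r * H (chi r τ θ) (eX (rotGen k θ)) (eL θ) + g (chi r τ θ) (eX (rotGen k θ)))
        + c2 * (r * H (chi r τ θ) (eX (rotGen k θ)) eT)) := fun k => by
    have h1 := (cH.clm_apply (cA k)).clm_apply (cA k)
    have h2 := cg.clm_apply (cAA k)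
    have h3 := (cH.clm_apply (cA k)).clm_apply cL
    have h4 := (cH.clm_apply (cA k)).clm_apply (continuous_const (y := eT))
    exact (((continuous_const.mul h1).add h2).mul hM).add ((hγ k).mul
      (((continuous_const.mul (continuous_const.mul (hγ k))).add
        (continuous_const.mul ((continuous_const.mul h3).add (hγ k)))).add
        (continuous_const.mul (continuous_const.mul h4))))
  have hz := fun k => integral_angular_deriv k ((hγ k).mul hM) (hω k) fun θ α => by
      have hc := hasDerivAt_chi_rotS (r := r) (τ := τ) k θ α
      obtain ⟨h1, h2⟩ := hin (rotS k α θ)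
      have d1 := P.deriv_curve_g (c := fun α => chi r τ (rotS k α θ)) h1 h2 hc
        (hasDerivAt_rotGen_rotS k θ α)
      have d2 := P.deriv_curve (c := fun α => chi r τ (rotS k α θ)) h1 h2 hc
      have d3 := P.deriv_curve_g (c := fun α => chi r τ (rotS k α θ)) h1 h2 hc
        (hasDerivAt_eL_rotS k θ α)
      have d4 := P.deriv_curve_g_const (v := eT) (c := fun α => chi r τ (rotS k α θ)) h1 h2 hc
      have d := d1.mul (((d2.const_mul c0).add (d3.const_mul c1)).add (d4.const_mul c2))
      refine d.congr_deriv ?_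
      simp only [map_smul, _root_.smul_apply, smul_eq_mul]
      rfl
  have hsum := integral_finsetSum (μ := sig) Finset.univ (fun k _ => S2.integrable (hω k))
  rw [Finset.sum_eq_zero fun k _ => hz k] at hsum
  rw [← hsum]
  refine integral_congr_ae (Filter.Eventually.of_forall fun θ => ?_)
  simp only [angTerm]
  rw [Finset.sum_mul, ← Finset.sum_add_distrib]

end Curves

theorem Pack.integral_angular_symm {ρ : ℝ} {W W₂ : E3 × ℝ → ℝ} {g g₂ : E3 × ℝ → (E3 × ℝ →L[ℝ] ℝ)}
    {H H₂ : E3 × ℝ → (E3 × ℝ →L[ℝ] E3 × ℝ →L[ℝ] ℝ)} (P : Pack ρ W g H) (P₂ : Pack ρ W₂ g₂ H₂)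
    {r τ : ℝ} (hr : 0 ≤ r) (hτ : 0 < τ) (hrτ : 2 * r + τ < 2 * ρ) :
    ∫ θ : S2, (angTerm r θ (g (chi r τ θ)) (H (chi r τ θ)) * W₂ (chi r τ θ)
      - W (chi r τ θ) * angTerm r θ (g₂ (chi r τ θ)) (H₂ (chi r τ θ))) ∂sig = 0 := by
  have hin : ∀ θ : S2, ‖(chi r τ θ).1‖ < (chi r τ θ).2 ∧ ‖(chi r τ θ).1‖ + (chi r τ θ).2 < 2 * ρ :=
    fun θ => by rw [norm_chi_fst hr, chi_snd]; constructor <;> linarith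
  have cχ := continuous_chi_S2 r τ
  have cW := P.cW.comp cχ
  have cg := P.cg.comp cχ
  have cH := P.cH.comp cχ
  have cW₂ := P₂.cW.comp cχ
  have cg₂ := P₂.cg.comp cχ
  have cH₂ := P₂.cH.comp cχ
  have cA : ∀ k, Continuous fun θ : S2 => eX (rotGen k θ) := fun k =>
    continuous_eX.comp (by fun_prop)
  have cAA : ∀ k, Continuous fun θ : S2 => eX (rotGen k (rotGen k θ)) := fun k =>
    continuous_eX.comp (by fun_prop)
  have hω : ∀ k, Continuous fun θ : S2 => (r * H (chi r τ θ) (eX (rotGen k θ)) (eX (rotGen k θ))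
        + g (chi r τ θ) (eX (rotGen k (rotGen k θ)))) * W₂ (chi r τ θ)
      - W (chi r τ θ) * (r * H₂ (chi r τ θ) (eX (rotGen k θ)) (eX (rotGen k θ))
        + g₂ (chi r τ θ) (eX (rotGen k (rotGen k θ)))) := fun k => by
    have h1 := (cH.clm_apply (cA k)).clm_apply (cA k)
    have h2 := cg.clm_apply (cAA k)
    have h3 := (cH₂.clm_apply (cA k)).clm_apply (cA k)
    have h4 := cg₂.clm_apply (cAA k)
    exact (((continuous_const.mul h1).add h2).mul cW₂).sub
      (cW.mul ((continuous_const.mul h3).add h4))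
  have hκ : ∀ k, Continuous fun θ : S2 => g (chi r τ θ) (eX (rotGen k θ)) * W₂ (chi r τ θ)
      - W (chi r τ θ) * g₂ (chi r τ θ) (eX (rotGen k θ)) := fun k =>
    ((cg.clm_apply (cA k)).mul cW₂).sub (cW.mul (cg₂.clm_apply (cA k)))
  have hz := fun k => integral_angular_deriv k (hκ k) (hω k) fun θ α => by
      have hc := hasDerivAt_chi_rotS (r := r) (τ := τ) k θ α
      obtain ⟨h1, h2⟩ := hin (rotS k α θ)
      have d1 := P.deriv_curve_g (c := fun α => chi r τ (rotS k α θ)) h1 h2 hc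
        (hasDerivAt_rotGen_rotS k θ α)
      have d2 := P₂.deriv_curve (c := fun α => chi r τ (rotS k α θ)) h1 h2 hc
      have d3 := P₂.deriv_curve_g (c := fun α => chi r τ (rotS k α θ)) h1 h2 hc
        (hasDerivAt_rotGen_rotS k θ α)
      have d4 := P.deriv_curve (c := fun α => chi r τ (rotS k α θ)) h1 h2 hc
      have d := (d1.mul d2).sub (d4.mul d3)
      refine d.congr_deriv ?_
      simp only [map_smul, _root_.smul_apply, smul_eq_mul]
      ring
  have hsum := integral_finsetSum (μ := sig) Finset.univ (fun k _ => S2.integrable (hω k))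
  rw [Finset.sum_eq_zero fun k _ => hz k] at hsum
  rw [← hsum]
  refine integral_congr_ae (Filter.Eventually.of_forall fun θ => ?_)
  simp only [angTerm]
  rw [Finset.sum_mul, Finset.mul_sum, ← Finset.sum_sub_distrib]

/-- Iterated integral over `S² × [0, X] × [0, Y]`. -/
def boxInt (X Y : ℝ) (f : S2 → ℝ → ℝ → ℝ) : ℝ :=
  ∫ θ, (∫ x in (0:ℝ)..X, ∫ τ in (0:ℝ)..Y, f θ x τ) ∂sig

section Box
variable {f f₁ f₂ : S2 → ℝ → ℝ → ℝ} {X Y : ℝ}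

theorem continuous_integral_tau (hf : Continuous fun p : S2 × ℝ × ℝ => f p.1 p.2.1 p.2.2) (Y : ℝ) :
    Continuous fun p : S2 × ℝ => ∫ τ in (0:ℝ)..Y, f p.1 p.2 τ :=
  intervalIntegral.continuous_parametric_intervalIntegral_of_continuous'
    (f := fun (p : S2 × ℝ) τ => f p.1 p.2 τ)
    (hf.comp (continuous_fst.fst.prodMk (continuous_fst.snd.prodMk continuous_snd))) 0 Y

theorem continuous_integral_r {f : S2 → ℝ → ℝ} (hf : Continuous fun p : S2 × ℝ => f p.1 p.2)
    (X : ℝ) :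
    Continuous fun θ : S2 => ∫ x in (0:ℝ)..X, f θ x :=
  intervalIntegral.continuous_parametric_intervalIntegral_of_continuous' (f := f) hf 0 X

theorem continuous_tau (hf : Continuous fun p : S2 × ℝ × ℝ => f p.1 p.2.1 p.2.2) (θ : S2) (x : ℝ) :
    Continuous fun τ => f θ x τ :=
  hf.comp (continuous_const.prodMk (continuous_const.prodMk continuous_id))

theorem boxInt_mono (hX : 0 ≤ X) (hY : 0 ≤ Y)
    (h₁ : Continuous fun p : S2 × ℝ × ℝ => f₁ p.1 p.2.1 p.2.2)
    (h₂ : Continuous fun p : S2 × ℝ × ℝ => f₂ p.1 p.2.1 p.2.2)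
    (h : ∀ θ, ∀ x ∈ Ioo 0 X, ∀ τ ∈ Ioo 0 Y, f₁ θ x τ ≤ f₂ θ x τ) :
    boxInt X Y f₁ ≤ boxInt X Y f₂ := by
  have c₁ := continuous_integral_tau h₁ Y
  have c₂ := continuous_integral_tau h₂ Y
  refine integral_mono (S2.integrable (continuous_integral_r c₁ X))
    (S2.integrable (continuous_integral_r c₂ X)) fun θ => ?_
  refine intervalIntegral.integral_mono_on_of_le_Ioo hX
    ((c₁.comp (continuous_const.prodMk continuous_id)).intervalIntegrable _ _)
    ((c₂.comp (continuous_const.prodMk continuous_id)).intervalIntegrable _ _) fun x hx => ?_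
  exact intervalIntegral.integral_mono_on_of_le_Ioo hY
    ((continuous_tau h₁ θ x).intervalIntegrable _ _)
    ((continuous_tau h₂ θ x).intervalIntegrable _ _) fun τ hτ => h θ x hx τ hτ

theorem iterated_integral_add (h₁ : Continuous fun p : S2 × ℝ × ℝ => f₁ p.1 p.2.1 p.2.2)
    (h₂ : Continuous fun p : S2 × ℝ × ℝ => f₂ p.1 p.2.1 p.2.2) (θ : S2) :
    ∫ x in (0:ℝ)..X, ∫ τ in (0:ℝ)..Y, (f₁ θ x τ + f₂ θ x τ) =
      (∫ x in (0:ℝ)..X, ∫ τ in (0:ℝ)..Y, f₁ θ x τ) +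
        ∫ x in (0:ℝ)..X, ∫ τ in (0:ℝ)..Y, f₂ θ x τ := by
  have c₁ : Continuous fun x => ∫ τ in (0:ℝ)..Y, f₁ θ x τ :=
    (continuous_integral_tau h₁ Y).comp (continuous_const.prodMk continuous_id)
  have c₂ : Continuous fun x => ∫ τ in (0:ℝ)..Y, f₂ θ x τ :=
    (continuous_integral_tau h₂ Y).comp (continuous_const.prodMk continuous_id)
  rw [← intervalIntegral.integral_add (c₁.intervalIntegrable _ _) (c₂.intervalIntegrable _ _)]
  congr 1; ext x
  exact intervalIntegral.integral_add ((continuous_tau h₁ θ x).intervalIntegrable _ _)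
    ((continuous_tau h₂ θ x).intervalIntegrable _ _)

theorem boxInt_add (h₁ : Continuous fun p : S2 × ℝ × ℝ => f₁ p.1 p.2.1 p.2.2)
    (h₂ : Continuous fun p : S2 × ℝ × ℝ => f₂ p.1 p.2.1 p.2.2) :
    boxInt X Y (fun θ x τ => f₁ θ x τ + f₂ θ x τ) = boxInt X Y f₁ + boxInt X Y f₂ := by
  have c₁ := continuous_integral_tau h₁ Y
  have c₂ := continuous_integral_tau h₂ Y
  unfold boxInt
  rw [← integral_add (S2.integrable (continuous_integral_r c₁ X))
    (S2.integrable (continuous_integral_r c₂ X))]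
  congr 1; ext θ
  exact iterated_integral_add h₁ h₂ θ

theorem boxInt_eq_zero (hX : 0 ≤ X) (hY : 0 ≤ Y)
    (hf : Continuous fun p : S2 × ℝ × ℝ => f p.1 p.2.1 p.2.2)
    (h : ∀ x ∈ Ioo 0 X, ∀ τ ∈ Ioo 0 Y, ∫ θ, f θ x τ ∂sig = 0) : boxInt X Y f = 0 := by
  have c := continuous_integral_tau hf Y
  unfold boxInt
  rw [S2.integral_intervalIntegral_swap (f := fun x θ => ∫ τ in (0:ℝ)..Y, f θ x τ)
    (c.comp continuous_swap), intervalIntegral.integral_of_le hX, integral_Ioc_eq_integral_Ioo]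
  refine setIntegral_eq_zero_of_forall_eq_zero fun x hx => ?_
  rw [S2.integral_intervalIntegral_swap (f := fun τ θ => f θ x τ)
    (hf.comp (continuous_snd.prodMk (continuous_const.prodMk continuous_fst))),
    intervalIntegral.integral_of_le hY, integral_Ioc_eq_integral_Ioo]
  exact setIntegral_eq_zero_of_forall_eq_zero fun τ hτ => h x hx τ hτ

/-- Divergence theorem on `S² × [0, X] × [0, Y]`. -/
theorem boxInt_div (hX : 0 ≤ X) (hY : 0 ≤ Y) {K₁ K₂ D₁ D₂ : S2 → ℝ → ℝ → ℝ}
    (hK₁ : Continuous fun p : S2 × ℝ × ℝ => K₁ p.1 p.2.1 p.2.2)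
    (hK₂ : Continuous fun p : S2 × ℝ × ℝ => K₂ p.1 p.2.1 p.2.2)
    (hD₁ : Continuous fun p : S2 × ℝ × ℝ => D₁ p.1 p.2.1 p.2.2)
    (hD₂ : Continuous fun p : S2 × ℝ × ℝ => D₂ p.1 p.2.1 p.2.2)
    (h₁ : ∀ θ, ∀ x ∈ Ioo 0 X, ∀ τ ∈ Ioo 0 Y, HasDerivAt (fun x => K₁ θ x τ) (D₁ θ x τ) x)
    (h₂ : ∀ θ, ∀ x ∈ Ioo 0 X, ∀ τ ∈ Ioo 0 Y, HasDerivAt (fun τ => K₂ θ x τ) (D₂ θ x τ) τ) :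
    boxInt X Y (fun θ x τ => D₁ θ x τ + D₂ θ x τ) =
      ∫ θ, ((∫ τ in (0:ℝ)..Y, (K₁ θ X τ - K₁ θ 0 τ)) +
        ∫ x in (0:ℝ)..X, (K₂ θ x Y - K₂ θ x 0)) ∂sig := by
  unfold boxInt
  congr 1; ext θ
  have cx : ∀ {f : S2 → ℝ → ℝ → ℝ}, (Continuous fun p : S2 × ℝ × ℝ => f p.1 p.2.1 p.2.2) → ∀ τ,
      Continuous fun x => f θ x τ := fun hf τ =>
    hf.comp (continuous_const.prodMk (continuous_id.prodMk continuous_const))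
  rw [iterated_integral_add hD₁ hD₂ θ]
  congr 1
  · have hsw : ∫ x in (0:ℝ)..X, ∫ τ in (0:ℝ)..Y, D₁ θ x τ =
        ∫ τ in (0:ℝ)..Y, ∫ x in (0:ℝ)..X, D₁ θ x τ := by
      refine intervalIntegral_intervalIntegral_swap ?_
      have hc : Continuous (Function.uncurry fun x τ => D₁ θ x τ) :=
        hD₁.comp (continuous_const.prodMk continuous_id)
      have hi : IntegrableOn (Function.uncurry fun x τ => D₁ θ x τ) (uIcc 0 X ×ˢ uIcc 0 Y)
          ((volume : Measure ℝ).prod volume) :=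
        ContinuousOn.integrableOn_compact (isCompact_uIcc.prod isCompact_uIcc) hc.continuousOn
      exact hi.mono_set (prod_mono uIoc_subset_uIcc uIoc_subset_uIcc)
    rw [hsw, intervalIntegral.integral_of_le hY, intervalIntegral.integral_of_le hY,
      integral_Ioc_eq_integral_Ioo, integral_Ioc_eq_integral_Ioo]
    refine setIntegral_congr_fun measurableSet_Ioo fun τ hτ => ?_
    exact intervalIntegral.integral_eq_sub_of_hasDerivAt_of_le hX (cx hK₁ τ).continuousOn
      (fun x hx => h₁ θ x hx τ hτ) ((cx hD₁ τ).intervalIntegrable _ _)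
  · rw [intervalIntegral.integral_of_le hX, intervalIntegral.integral_of_le hX,
      integral_Ioc_eq_integral_Ioo, integral_Ioc_eq_integral_Ioo]
    refine setIntegral_congr_fun measurableSet_Ioo fun x hx => ?_
    exact intervalIntegral.integral_eq_sub_of_hasDerivAt_of_le hY
      (continuous_tau hK₂ θ x).continuousOn
      (fun τ hτ => h₂ θ x hx τ hτ) ((continuous_tau hD₂ θ x).intervalIntegrable _ _)

end Box

/-! ### A Carleman identity in characteristic coordinates -/

theorem hasDerivAt_posPart_pow (n : ℕ) (y : ℝ) :
    HasDerivAt (fun y : ℝ => (max y 0) ^ (n + 2)) ((n + 2 : ℕ) * (max y 0) ^ (n + 1)) y := by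
  rcases lt_trichotomy y 0 with h | h | h
  · have e : (fun y : ℝ => (max y 0) ^ (n + 2)) =ᶠ[nhds y] fun _ => 0 := by
      filter_upwards [Iio_mem_nhds h] with z hz
      simp [max_eq_right (le_of_lt (Set.mem_Iio.1 hz))]
    simpa [max_eq_right h.le] using (hasDerivAt_const y (0:ℝ)).congr_of_eventuallyEq e
  · subst h
    simp only [max_self, ne_eq, Nat.add_eq_zero_iff, one_ne_zero, and_false, not_false_eq_true,
      zero_pow, mul_zero]
    rw [hasDerivAt_iff_isLittleO_nhds_zero]
    simp only [zero_add, max_self, ne_eq, Nat.add_eq_zero_iff, OfNat.ofNat_ne_zero, and_false,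
      not_false_eq_true, zero_pow, sub_zero, smul_zero]
    refine Asymptotics.IsBigO.trans_isLittleO (g := fun h : ℝ => h ^ (n + 2)) ?_ ?_
    · refine Asymptotics.IsBigO.of_bound 1 (Filter.Eventually.of_forall fun h => ?_)
      rw [norm_pow, norm_pow, one_mul]
      refine pow_le_pow_left₀ (norm_nonneg _) ?_ _
      rw [Real.norm_eq_abs, Real.norm_eq_abs, abs_of_nonneg (le_max_right _ _)]
      exact max_le (le_abs_self _) (abs_nonneg _)
    · simpa using Asymptotics.isLittleO_pow_pow (𝕜 := ℝ) (m := 1) (n := n + 2) (by omega)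
  · have e : (fun y : ℝ => (max y 0) ^ (n + 2)) =ᶠ[nhds y] fun y => y ^ (n + 2) := by
      filter_upwards [Ioi_mem_nhds h] with z hz
      simp [max_eq_left (le_of_lt (Set.mem_Ioi.1 hz))]
    simpa [max_eq_left h.le] using (hasDerivAt_pow (n + 2) y).congr_of_eventuallyEq e

/-- The Carleman weight. -/
def cwt (β t0 ε x τ : ℝ) : ℝ := ((x + ε) ^ 2 - β * (x + τ - t0) ^ 2) / 2

/-- The `x`-component of the Carleman flux, divided by the weight. -/
def cflux₁ (l β κ a b η η1 v p q n : ℝ) : ℝ :=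
  let P := p + l * (b - a) * v;
  let Q := q - l * a * v;
  -a * Q * (P - Q) - b / 2 * (Q ^ 2 + (P - Q) ^ 2)
    + (l ^ 2 * (a ^ 2 - b ^ 2) * b / 2 + l * (1 + β) * b / 2 - b * (κ * l * η1)
      + l ^ 2 * κ * η * b) * v ^ 2
    - l * κ * η * v * (P - Q) + b / 2 * n

/-- The `τ`-component of the Carleman flux, divided by the weight. -/
def cflux₂ (l β κ a b η η1 v p n : ℝ) : ℝ :=
  let P := p + l * (b - a) * v;
  (a + b) / 2 * P ^ 2
    + (l ^ 2 * (a ^ 2 - b ^ 2) * (a - b) / 2 + l * (1 + β) * (a - b) / 2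
      + l ^ 2 * κ * η * (a - b) - l * κ * η1 * (β * a - b)) * v ^ 2
    + l * κ * η * v * P + (a - b) / 2 * n

/-- The `x`-derivative of the first flux component, divided by the weight. -/
def cdflux₁ (l β κ a b η η1 η2 v p q n vxx vxt nx : ℝ) : ℝ :=
  let P := p + l * (b - a) * v;
  let Q := q - l * a * v;
  let Px := vxx + l * (1 - β) * v + l * (b - a) * p;
  let Qx := vxt - l * β * v - l * a * p;
  let yx := 2 * β * a - 2 * b;
  2 * l * (b - a) * cflux₁ l β κ a b η η1 v p q n
    - β * Q * (P - Q) - a * Qx * (P - Q) - a * Q * (Px - Qx)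
    - 1 / 2 * (Q ^ 2 + (P - Q) ^ 2) - b * (Q * Qx + (P - Q) * (Px - Qx))
    + (l ^ 2 * yx * b / 2 + l ^ 2 * (a ^ 2 - b ^ 2) / 2 + l * (1 + β) / 2 - κ * l * η1
      - b * κ * l * η2 * yx + l ^ 2 * κ * η1 * yx * b + l ^ 2 * κ * η) * v ^ 2
    + 2 * (l ^ 2 * (a ^ 2 - b ^ 2) * b / 2 + l * (1 + β) * b / 2 - b * (κ * l * η1)
      + l ^ 2 * κ * η * b) * v * p
    - l * κ * (η1 * yx * v * (P - Q) + η * p * (P - Q) + η * v * (Px - Qx)) + 1 / 2 * n + b / 2 * nx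

/-- The `τ`-derivative of the second flux component, divided by the weight. -/
def cdflux₂ (l β κ a b η η1 η2 v p q n vxt nt : ℝ) : ℝ :=
  let P := p + l * (b - a) * v;
  let Pt := vxt - l * β * v + l * (b - a) * q;
  let yt := 2 * β * a;
  -(2 * l * a) * cflux₂ l β κ a b η η1 v p n
    + β / 2 * P ^ 2 + (a + b) * P * Pt
    + (l ^ 2 * yt * (a - b) / 2 + l ^ 2 * (a ^ 2 - b ^ 2) * β / 2 + l * (1 + β) * β / 2
      + l ^ 2 * κ * η1 * yt * (a - b) + l ^ 2 * κ * η * β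
      - l * κ * η2 * yt * (β * a - b) - l * κ * η1 * β ^ 2) * v ^ 2
    + 2 * (l ^ 2 * (a ^ 2 - b ^ 2) * (a - b) / 2 + l * (1 + β) * (a - b) / 2
      + l ^ 2 * κ * η * (a - b) - l * κ * η1 * (β * a - b)) * v * q
    + l * κ * (η1 * yt * v * P + η * q * P + η * v * Pt) + β / 2 * n + (a - b) / 2 * nt

theorem cwt_deriv_x (β t0 ε x τ : ℝ) :
    HasDerivAt (fun x => cwt β t0 ε x τ) ((x + ε) - β * (x + τ - t0)) x := by
  unfold cwt
  have h := (((((hasDerivAt_id x).add_const ε).pow 2).sub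
    (((((hasDerivAt_id x).add_const τ).sub_const t0).pow 2).const_mul β)).div_const 2)
  refine h.congr_deriv ?_
  simp
  ring

theorem cwt_deriv_τ (β t0 ε x τ : ℝ) :
    HasDerivAt (fun τ => cwt β t0 ε x τ) (-(β * (x + τ - t0))) τ := by
  unfold cwt
  have h := ((hasDerivAt_const τ ((x + ε) ^ 2)).sub
    (((((hasDerivAt_id τ).const_add x).sub_const t0).pow 2).const_mul β)).div_const 2
  refine h.congr_deriv ?_
  simp
  ring

theorem cflux₁_deriv {l β κ x da db dη dη1 : ℝ} {a b η η1 v p q n : ℝ → ℝ}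
    {vxx vxt nx dv : ℝ} (ha : HasDerivAt a da x) (hb : HasDerivAt b db x)
    (hη : HasDerivAt η dη x) (hη1 : HasDerivAt η1 dη1 x) (hv : HasDerivAt v dv x)
    (hp : HasDerivAt p vxx x) (hq : HasDerivAt q vxt x) (hn : HasDerivAt n nx x)
    {ω : ℝ → ℝ} {dω : ℝ} (hω : HasDerivAt ω dω x) (eω : dω = b x - a x)
    (e1 : da = β) (e2 : db = 1) (e5 : dv = p x)
    {η2 : ℝ} (e3 : dη = η1 x * (2 * β * a x - 2 * b x)) (e4 : dη1 = η2 * (2 * β * a x - 2 * b x)) :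
    HasDerivAt (fun x => exp (2 * l * ω x) *
      cflux₁ l β κ (a x) (b x) (η x) (η1 x) (v x) (p x) (q x) (n x))
      (exp (2 * l * ω x) *
      cdflux₁ l β κ (a x) (b x) (η x) (η1 x) η2 (v x) (p x) (q x) (n x) vxx vxt nx) x := by
  have hP := hp.add (((hb.sub ha).const_mul l).mul hv)
  have hQ := hq.sub ((ha.const_mul l).mul hv)
  have hR := hP.sub hQ
  have hy := (ha.pow 2).sub (hb.pow 2)
  have t1 := ((ha.neg.mul hQ).mul hR)
  have t2 := (hb.div_const 2).mul ((hQ.pow 2).add (hR.pow 2))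
  have t3 := (((((hy.const_mul (l ^ 2)).mul hb).div_const 2).add
    ((hb.const_mul (l * (1 + β))).div_const 2)).sub (hb.mul (hη1.const_mul (κ * l)))).add
    ((hη.const_mul (l ^ 2 * κ)).mul hb)
  have t4 := ((hη.const_mul (l * κ)).mul hv).mul hR
  have t5 := (hb.div_const 2).mul hn
  have t := (((t1.sub t2).add (t3.mul (hv.pow 2))).sub t4).add t5
  have h := ((hω.const_mul (2 * l)).exp).mul t
  refine h.congr_deriv ?_
  subst e1 e2 e3 e4 e5 eω
  simp only [cdflux₁, cflux₁, Pi.add_apply, Pi.mul_apply, Pi.sub_apply, Pi.neg_apply, Pi.pow_apply]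
  push_cast
  ring

theorem cflux₂_deriv {l β κ x da db dη dη1 : ℝ} {a b η η1 v p q n : ℝ → ℝ}
    {vxt nt dv : ℝ} (ha : HasDerivAt a da x) (hb : HasDerivAt b db x)
    (hη : HasDerivAt η dη x) (hη1 : HasDerivAt η1 dη1 x) (hv : HasDerivAt v dv x)
    (hp : HasDerivAt p vxt x) (hn : HasDerivAt n nt x)
    {ω : ℝ → ℝ} {dω : ℝ} (hω : HasDerivAt ω dω x) (eω : dω = - a x)
    (e1 : da = β) (e2 : db = 0) (e5 : dv = q x)
    {η2 : ℝ} (e3 : dη = η1 x * (2 * β * a x)) (e4 : dη1 = η2 * (2 * β * a x)) :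
    HasDerivAt (fun x => exp (2 * l * ω x) *
      cflux₂ l β κ (a x) (b x) (η x) (η1 x) (v x) (p x) (n x))
      (exp (2 * l * ω x) *
      cdflux₂ l β κ (a x) (b x) (η x) (η1 x) η2 (v x) (p x) (q x) (n x) vxt nt) x := by
  have hP := hp.add (((hb.sub ha).const_mul l).mul hv)
  have hy := (ha.pow 2).sub (hb.pow 2)
  have t1 := ((ha.add hb).div_const 2).mul (hP.pow 2)
  have t3 := (((((hy.const_mul (l ^ 2)).mul (ha.sub hb)).div_const 2).add
    (((ha.sub hb).const_mul (l * (1 + β))).div_const 2)).add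
    ((hη.const_mul (l ^ 2 * κ)).mul (ha.sub hb))).sub
    ((hη1.const_mul (l * κ)).mul ((ha.const_mul β).sub hb))
  have t4 := ((hη.const_mul (l * κ)).mul hv).mul hP
  have t5 := ((ha.sub hb).div_const 2).mul hn
  have t := ((t1.add (t3.mul (hv.pow 2))).add t4).add t5
  have h := ((hω.const_mul (2 * l)).exp).mul t
  refine h.congr_deriv ?_
  subst e1 e2 e3 e4 e5 eω
  simp only [cdflux₂, cflux₂, Pi.add_apply, Pi.mul_apply, Pi.sub_apply, Pi.pow_apply]
  push_cast
  ring

/-- The zeroth order bulk coefficient. -/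
def cbulk₀ (l β κ a b η η1 η2 : ℝ) : ℝ :=
  -(l ^ 2) / 2 * ((1 + β) * (a ^ 2 - b ^ 2) + 2 * β * a ^ 2 - 2 * b ^ 2) - l * (1 + β) ^ 2 / 2
    + l * κ * (2 * η2 * (β ^ 2 * a ^ 2 - b ^ 2) + η1 * (β ^ 2 + 1))
    - l * (l * κ * η1 * (2 * β * a ^ 2 - 2 * b ^ 2)) + l ^ 2 * (l * κ * η) * (a ^ 2 - b ^ 2)

theorem carleman_identity (l β κ a b η η1 η2 v p q n vxx vxt nx nt : ℝ) :
    cdflux₁ l β κ a b η η1 η2 v p q n vxx vxt nx + cdflux₂ l β κ a b η η1 η2 v p q n vxt nt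
      = (2 * vxt - vxx) * (a * (q - l * a * v) + b * (p - q + l * b * v) + l * κ * η * v)
        - ((1 - β) / 2 * ((q - l * a * v) ^ 2 + (p - q + l * b * v) ^ 2)
          + 2 * l * (a * (q - l * a * v) + b * (p - q + l * b * v)) ^ 2
          + l * κ * η * ((p - q + l * b * v) ^ 2 - (q - l * a * v) ^ 2)
          + cbulk₀ l β κ a b η η1 η2 * v ^ 2)
        + (-l * (a ^ 2 - b ^ 2) + (1 + β) / 2) * n + b / 2 * nx + (a - b) / 2 * nt := by
  simp only [cdflux₁, cdflux₂, cflux₁, cflux₂, cbulk₀]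
  ring

/-! ### Positivity of the bulk and boundary terms -/

theorem quad_form_nonneg {a b μ Q S : ℝ} (h0 : 0 ≤ μ) (h1 : μ * (a ^ 2 - b ^ 2 - μ) ≥ 0)
    (hb : 0 < b) : 0 ≤ (a * Q + b * S) ^ 2 + μ * (S ^ 2 - Q ^ 2) := by
  have hp : 0 < b ^ 2 + μ := by positivity
  have e : (b ^ 2 + μ) * ((a * Q + b * S) ^ 2 + μ * (S ^ 2 - Q ^ 2))
      = ((b ^ 2 + μ) * S + a * b * Q) ^ 2 + μ * (a ^ 2 - b ^ 2 - μ) * Q ^ 2 := by ring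
  have h : 0 ≤ (b ^ 2 + μ) * ((a * Q + b * S) ^ 2 + μ * (S ^ 2 - Q ^ 2)) := by
    rw [e]; positivity
  exact nonneg_of_mul_nonneg_right h hp

theorem posPart_cases (y : ℝ) : (y ≤ 0 ∧ max y 0 = 0) ∨ (0 < y ∧ max y 0 = y) := by
  rcases le_or_gt y 0 with h | h
  · exact Or.inl ⟨h, max_eq_right h⟩
  · exact Or.inr ⟨h, max_eq_left h.le⟩

set_option maxHeartbeats 1000000 in
theorem cbulk₀_lower {l β κ a b B e : ℝ} (hβ0 : 0 < β) (hβ1 : β < 1) (hκ : 0 < κ)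
    (ha : |a| ≤ B) (hb0 : 0 < b) (hb : b ≤ B) (hκB : κ * B ^ 4 = 1 / 4) (hl : 1 ≤ l)
    (he : 0 < e) (heb : e ≤ (1 - β) * b ^ 2) (hl2 : 20 ≤ l * e)
    (hl1 : ∀ y ≥ 0, 7 / 2 * y ≤ e / 4 + l * κ * y ^ 4) :
    e / 2 * l ^ 2 ≤ cbulk₀ l β κ a b ((max (a ^ 2 - b ^ 2) 0) ^ 3)
      (3 * (max (a ^ 2 - b ^ 2) 0) ^ 2) (6 * max (a ^ 2 - b ^ 2) 0) := by
  have ha2 : a ^ 2 ≤ B ^ 2 := sq_le_sq' (by linarith [neg_abs_le a]) (by linarith [le_abs_self a])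
  have hb2 : b ^ 2 ≤ B ^ 2 := by nlinarith
  have hl0 : 0 < l := by linarith
  have hlin : 5 * l ≤ e / 4 * l ^ 2 := by nlinarith
  have hβ4 : (1 + β) ^ 2 ≤ 4 := by nlinarith
  have hβ2 : l * (1 + β) ^ 2 / 2 ≤ 2 * l := by nlinarith
  unfold cbulk₀
  have hid : a ^ 2 = (a ^ 2 - b ^ 2) + b ^ 2 := by ring
  rcases posPart_cases (a ^ 2 - b ^ 2) with ⟨hy, hm⟩ | ⟨hy, hm⟩
  · rw [hm]
    have h1 : (1 + β) * (a ^ 2 - b ^ 2) + 2 * β * a ^ 2 - 2 * b ^ 2 ≤ -(2 * e) := by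
      nlinarith
    have h2 : l ^ 2 * ((1 + β) * (a ^ 2 - b ^ 2) + 2 * β * a ^ 2 - 2 * b ^ 2) ≤
        l ^ 2 * (-(2 * e)) :=
      mul_le_mul_of_nonneg_left h1 (by positivity)
    have : 0 ≤ l ^ 2 * e := by positivity
    norm_num
    nlinarith
  · rw [hm]
    obtain ⟨y, hyd⟩ : ∃ y, y = a ^ 2 - b ^ 2 := ⟨_, rfl⟩
    have ea : a ^ 2 = y + b ^ 2 := by linarith
    rw [← hyd] at hy ⊢
    rw [ea]
    have hyB : y ≤ B ^ 2 := by nlinarith [sq_nonneg b]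
    have hκy : κ * y ^ 2 ≤ 1 / 4 := by
      rw [← hκB]
      have : y ^ 2 ≤ (B ^ 2) ^ 2 := pow_le_pow_left₀ hy.le hyB 2
      nlinarith
    have k1 := hl1 y hy.le
    -- the leading terms
    have m1 : e - 7 / 2 * y ≤ -(1 / 2) * ((1 + β) * y + 2 * β * (y + b ^ 2) - 2 * b ^ 2)
        - κ * (3 * y ^ 2) * (2 * β * (y + b ^ 2) - 2 * b ^ 2) := by
      have t1 : κ * (3 * y ^ 2) * (2 * β * (y + b ^ 2) - 2 * b ^ 2) ≤ 3 / 2 * y := by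
        have : κ * (3 * y ^ 2) * (2 * β * (y + b ^ 2) - 2 * b ^ 2)
            = 6 * β * (κ * y ^ 2) * y - 6 * (κ * y ^ 2) * ((1 - β) * b ^ 2) := by ring
        rw [this]
        have p1 : 0 ≤ κ * y ^ 2 := by positivity
        have p2 : 0 ≤ (κ * y ^ 2) * ((1 - β) * b ^ 2) :=
          mul_nonneg p1 (by linarith)
        have p3 : β * (κ * y ^ 2) ≤ 1 / 4 := by nlinarith
        nlinarith
      nlinarith
    have m2 : -3 ≤ κ * (2 * (6 * y) * (β ^ 2 * (y + b ^ 2) - b ^ 2) + 3 * y ^ 2 * (β ^ 2 + 1)) := by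
      have t1 : κ * (y * b ^ 2) ≤ 1 / 4 := by
        rw [← hκB]
        have : y * b ^ 2 ≤ B ^ 2 * B ^ 2 := mul_le_mul hyB hb2 (by positivity) (by positivity)
        nlinarith
      have t2 : 0 ≤ κ * y * (β ^ 2 * (y + b ^ 2)) := by positivity
      have t3 : 0 ≤ κ * (3 * y ^ 2 * (β ^ 2 + 1)) := by positivity
      nlinarith
    have m1' := mul_le_mul_of_nonneg_left m1 (by positivity : 0 ≤ l ^ 2)
    have m2' := mul_le_mul_of_nonneg_left m2 hl0.le
    have k1' := mul_le_mul_of_nonneg_left k1 (by positivity : 0 ≤ l ^ 2)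
    linarith

set_option maxHeartbeats 1000000 in
theorem carleman_pointwise {l β κ a b B e M x : ℝ} (hβ0 : 0 < β) (hβ1 : β < 1) (hκ : 0 < κ)
    (ha : |a| ≤ B) (hb0 : 0 < b) (hb : b ≤ B) (hκB : κ * B ^ 4 = 1 / 4) (hl : 1 ≤ l)
    (he : 0 < e) (heb : e ≤ (1 - β) * b ^ 2) (hl2 : 20 ≤ l * e)
    (hl1 : ∀ y ≥ 0, 7 / 2 * y ≤ e / 4 + l * κ * y ^ 4)
    (hl3 : (1 / 4 + B ^ 4 / (16 * e)) * (2 * M ^ 2) ≤ l * (e / 4))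
    (hx : 0 ≤ x) (hxb : x ≤ b) {X Q S v f N : ℝ} (hN : 0 ≤ N)
    (hX : X ^ 2 ≤ 2 * M ^ 2 * v ^ 2 + 2 * f) :
    X * (a * Q + b * S + l * κ * (max (a ^ 2 - b ^ 2) 0) ^ 3 * v)
      - ((1 - β) / 2 * (Q ^ 2 + S ^ 2) + 2 * l * (a * Q + b * S) ^ 2
        + l * κ * (max (a ^ 2 - b ^ 2) 0) ^ 3 * (S ^ 2 - Q ^ 2)
        + cbulk₀ l β κ a b ((max (a ^ 2 - b ^ 2) 0) ^ 3)
          (3 * (max (a ^ 2 - b ^ 2) 0) ^ 2) (6 * max (a ^ 2 - b ^ 2) 0) * v ^ 2)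
      + ((1 + β) / 2 * x ^ 2 - b * x - l * κ * (max (a ^ 2 - b ^ 2) 0) ^ 3 * x ^ 2) * N
      ≤ (1 / 4 + B ^ 4 / (16 * e)) * (2 * f) := by
  have hz := cbulk₀_lower hβ0 hβ1 hκ ha hb0 hb hκB hl he heb hl2 hl1
  obtain ⟨Z, hZ⟩ : ∃ Z, Z = cbulk₀ l β κ a b ((max (a ^ 2 - b ^ 2) 0) ^ 3)
          (3 * (max (a ^ 2 - b ^ 2) 0) ^ 2) (6 * max (a ^ 2 - b ^ 2) 0) := ⟨_, rfl⟩
  rw [← hZ] at hz ⊢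
  obtain ⟨μ, hμ⟩ : ∃ μ, μ = κ * (max (a ^ 2 - b ^ 2) 0) ^ 3 := ⟨_, rfl⟩
  have hl0 : 0 < l := by linarith
  have ha2 : a ^ 2 ≤ B ^ 2 := sq_le_sq' (by linarith [neg_abs_le a]) (by linarith [le_abs_self a])
  have hμ0 : 0 ≤ μ := by rw [hμ]; positivity
  have hμB : μ ≤ B ^ 2 / 4 ∧ μ * (a ^ 2 - b ^ 2 - μ) ≥ 0 := by
    rcases posPart_cases (a ^ 2 - b ^ 2) with ⟨hy, hm⟩ | ⟨hy, hm⟩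
    · rw [hμ, hm]; norm_num; positivity
    · have hyB : a ^ 2 - b ^ 2 ≤ B ^ 2 := by nlinarith [sq_nonneg b]
      have : (a ^ 2 - b ^ 2) ^ 2 ≤ (B ^ 2) ^ 2 := pow_le_pow_left₀ hy.le hyB 2
      have hκy : κ * (a ^ 2 - b ^ 2) ^ 2 ≤ 1 / 4 := by rw [← hκB]; nlinarith
      have e1 : μ = κ * (a ^ 2 - b ^ 2) ^ 2 * (a ^ 2 - b ^ 2) := by rw [hμ, hm]; ring
      have e2 : μ ≤ (a ^ 2 - b ^ 2) / 4 := by rw [e1]; nlinarith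
      exact ⟨by linarith, mul_nonneg hμ0 (by linarith)⟩
  have hq := quad_form_nonneg (Q := Q) (S := S) hμ0 hμB.2 hb0
  rw [mul_assoc l κ, ← hμ]
  have hNc : ((1 + β) / 2 * x ^ 2 - b * x - l * μ * x ^ 2) * N ≤ 0 := by
    refine mul_nonpos_of_nonpos_of_nonneg ?_ hN
    have : 0 ≤ l * μ * x ^ 2 := by positivity
    nlinarith
  have hQS : 0 ≤ (1 - β) / 2 * (Q ^ 2 + S ^ 2) := mul_nonneg (by linarith) (by positivity)
  obtain ⟨Y, hY⟩ : ∃ Y, Y = a * Q + b * S := ⟨_, rfl⟩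
  rw [← hY] at hq ⊢
  have i1 : X * Y ≤ l * Y ^ 2 + 1 / 4 * X ^ 2 := by
    have h1 : 0 ≤ (l - 1) * Y ^ 2 := mul_nonneg (by linarith) (sq_nonneg _)
    have h2 := sq_nonneg (2 * Y - X)
    linarith
  have i2 : X * (l * μ * v) ≤ l ^ 2 * (e / 4) * v ^ 2 + B ^ 4 / (16 * e) * X ^ 2 := by
    have j1 : X * (l * μ * v) ≤ l ^ 2 * (e / 4) * v ^ 2 + μ ^ 2 / e * X ^ 2 := by
      have : l ^ 2 * (e / 4) * v ^ 2 + μ ^ 2 / e * X ^ 2 - X * (l * μ * v)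
          = (l * e * v / 2 - μ * X) ^ 2 / e := by field_simp; ring
      have : 0 ≤ (l * e * v / 2 - μ * X) ^ 2 / e := by positivity
      linarith
    have j2 : μ ^ 2 / e ≤ B ^ 4 / (16 * e) := by
      have : μ ^ 2 ≤ (B ^ 2 / 4) ^ 2 := pow_le_pow_left₀ hμ0 hμB.1 2
      rw [div_le_div_iff₀ he (by positivity)]
      have : μ ^ 2 * (16 * e) ≤ (B ^ 2 / 4) ^ 2 * (16 * e) :=
        mul_le_mul_of_nonneg_right this (by positivity)
      linarith
    have j3 := mul_le_mul_of_nonneg_right j2 (sq_nonneg X)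
    linarith
  have i3 : (1 / 4 + B ^ 4 / (16 * e)) * X ^ 2
      ≤ (1 / 4 + B ^ 4 / (16 * e)) * (2 * M ^ 2 * v ^ 2 + 2 * f) :=
    mul_le_mul_of_nonneg_left hX (by positivity)
  have i4 : (1 / 4 + B ^ 4 / (16 * e)) * (2 * M ^ 2) * v ^ 2 ≤ l * (e / 4) * v ^ 2 :=
    mul_le_mul_of_nonneg_right hl3 (sq_nonneg _)
  have i5 : l * (e / 4) * v ^ 2 ≤ l ^ 2 * (e / 4) * v ^ 2 := by
    have h1 : 0 ≤ (e / 4) * v ^ 2 := by positivity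
    have h2 := mul_nonneg (mul_nonneg hl0.le (sub_nonneg.2 hl)) h1
    linarith
  have i6 : e / 2 * l ^ 2 * v ^ 2 ≤ Z * v ^ 2 := mul_le_mul_of_nonneg_right hz (sq_nonneg _)
  have i7 := mul_nonneg hl0.le hq
  linarith

theorem cflux₂_nonneg {l β κ a b B v p n : ℝ} (hβ1 : β < 1) (hβ0 : 0 < β) (hκ : 0 < κ) (hb0 : 0 < b)
    (hab : b ≤ a) (ha : a ≤ B) (hκB : κ * B ^ 4 = 1 / 4) (hl : 1 ≤ l) (hl4 : 24 * κ * B ^ 2 ≤ l)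
    (hn : 0 ≤ n) :
    0 ≤ cflux₂ l β κ a b ((max (a ^ 2 - b ^ 2) 0) ^ 3) (3 * (max (a ^ 2 - b ^ 2) 0) ^ 2) v p n := by
  have hy0 : 0 ≤ a ^ 2 - b ^ 2 := by nlinarith
  rw [max_eq_left hy0]
  obtain ⟨y, hyd⟩ : ∃ y, y = a ^ 2 - b ^ 2 := ⟨_, rfl⟩
  have hyB : y ≤ B ^ 2 := by nlinarith [sq_nonneg b]
  simp only [cflux₂]
  rw [← hyd] at hy0 ⊢
  obtain ⟨P, hP⟩ : ∃ P, P = p + l * (b - a) * v := ⟨_, rfl⟩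
  rw [← hP]
  have hκy : κ * y ^ 2 ≤ 1 / 4 := by
    rw [← hκB]
    have : y ^ 2 ≤ (B ^ 2) ^ 2 := pow_le_pow_left₀ hy0 hyB 2
    nlinarith
  have hl0 : 0 < l := by linarith
  have s1 : l * κ * (3 * y ^ 2) * (β * a - b) ≤ l ^ 2 * y * (a - b) / 8 := by
    have h1 : β * a - b ≤ a - b := by nlinarith
    have h2 : l * κ * (3 * y ^ 2) * (β * a - b) ≤ l * κ * (3 * y ^ 2) * (a - b) :=
      mul_le_mul_of_nonneg_left h1 (by positivity)
    have h3 : 24 * κ * y ≤ l := by nlinarith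
    have h4 : 0 ≤ (l - 24 * κ * y) * (l * y * (a - b)) :=
      mul_nonneg (by linarith) (mul_nonneg (by positivity) (by linarith))
    nlinarith
  have s2 : -(l * κ * y ^ 3 * v * P) ≤ (a + b) / 2 * P ^ 2 + l ^ 2 * y * (a - b) / 8 * v ^ 2 := by
    obtain ⟨z, hz⟩ : ∃ z, z = κ * y ^ 2 := ⟨_, rfl⟩
    have hz0 : 0 ≤ z := by rw [hz]; positivity
    have e1 : (a + b) * ((a + b) / 2 * P ^ 2 + l ^ 2 * y * (a - b) / 8 * v ^ 2 +
        l * κ * y ^ 3 * v * P)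
        = ((a + b) * P + l * z * y * v) ^ 2 / 2 + l ^ 2 * y ^ 2 * v ^ 2 * (1 / 8 - z ^ 2 / 2)
          := by rw [hz, hyd]; ring
    have h1 : 0 ≤ (a + b) * ((a + b) / 2 * P ^ 2 + l ^ 2 * y * (a - b) / 8 * v ^ 2 +
        l * κ * y ^ 3 * v * P) := by
      rw [e1]
      have : 0 ≤ 1 / 8 - z ^ 2 / 2 := by nlinarith
      positivity
    have := nonneg_of_mul_nonneg_right h1 (by linarith)
    linarith
  have s3 : l * κ * (3 * y ^ 2) * (β * a - b) * v ^ 2 ≤ l ^ 2 * y * (a - b) / 8 * v ^ 2 :=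
    mul_le_mul_of_nonneg_right s1 (sq_nonneg _)
  have hd : 0 ≤ a - b := by linarith
  have s4 : 0 ≤ l ^ 2 * y * (a - b) / 4 * v ^ 2 := by positivity
  have s5 : 0 ≤ (l * (1 + β) * (a - b) / 2 + l ^ 2 * κ * y ^ 3 * (a - b)) * v ^ 2 := by positivity
  have s6 : 0 ≤ (a - b) / 2 * n := by positivity
  linarith

theorem le_neg_cflux₂ {l β κ α b B v p n : ℝ} (hβ1 : β < 1) (hβ0 : 0 < β) (hκ : 0 < κ) (hb0 : 0 < b)
    (hab : b ≤ α) (ha : α ≤ B) (hκB : κ * B ^ 4 = 1 / 4) (hl : 1 ≤ l) (hl4 : 24 * κ * B ^ 2 ≤ l)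
    (hn : 0 ≤ n) :
    (α - b) / 8 * p ^ 2 ≤ -cflux₂ l β κ (-α) b ((max ((-α) ^ 2 - b ^ 2) 0) ^ 3)
      (3 * (max ((-α) ^ 2 - b ^ 2) 0) ^ 2) v p n := by
  rw [neg_sq]
  have hy0 : 0 ≤ α ^ 2 - b ^ 2 := by nlinarith
  rw [max_eq_left hy0]
  obtain ⟨y, hyd⟩ : ∃ y, y = α ^ 2 - b ^ 2 := ⟨_, rfl⟩
  have hyB : y ≤ B ^ 2 := by nlinarith [sq_nonneg b]
  simp only [cflux₂]
  rw [neg_sq, ← hyd]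
  rw [← hyd] at hy0
  obtain ⟨P, hP⟩ : ∃ P, P = p + l * (b - -α) * v := ⟨_, rfl⟩
  rw [← hP]
  have hp : p = P - l * (α + b) * v := by rw [hP]; ring
  have hκy : κ * y ^ 2 ≤ 1 / 4 := by
    rw [← hκB]
    have : y ^ 2 ≤ (B ^ 2) ^ 2 := pow_le_pow_left₀ hy0 hyB 2
    nlinarith
  have hl0 : 0 < l := by linarith
  have hα : 0 < α + b := by linarith
  have hd : 0 ≤ α - b := by linarith
  have s1 : l * κ * (3 * y ^ 2) * (β * α + b) ≤ l ^ 2 * y * (α + b) / 8 := by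
    have h1 : β * α + b ≤ α + b := by nlinarith
    have h2 : l * κ * (3 * y ^ 2) * (β * α + b) ≤ l * κ * (3 * y ^ 2) * (α + b) :=
      mul_le_mul_of_nonneg_left h1 (by positivity)
    have h3 : 24 * κ * y ≤ l := by nlinarith
    have h4 : 0 ≤ (l - 24 * κ * y) * (l * y * (α + b)) :=
      mul_nonneg (by linarith) (by positivity)
    nlinarith
  have s2 : l * κ * y ^ 3 * v * P ≤ (α - b) / 4 * P ^ 2 + l ^ 2 * y * (α + b) / 8 * v ^ 2 := by
    obtain ⟨z, hz⟩ : ∃ z, z = κ * y ^ 2 := ⟨_, rfl⟩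
    have hz0 : 0 ≤ z := by rw [hz]; positivity
    have e2 : (α - b) / 4 * P ^ 2 + l ^ 2 * y * (α + b) / 8 * v ^ 2 - l * κ * y ^ 3 * v * P
        = (α - b) * ((P - 2 * l * z * (α + b) * v) ^ 2 / 4 +
          l ^ 2 * (α + b) ^ 2 * v ^ 2 * (1 / 8 - z ^ 2)) := by
      rw [show l * κ * y ^ 3 * v * P = l * z * y * v * P by rw [hz]; ring, hyd]
      ring
    have : 0 ≤ 1 / 8 - z ^ 2 := by nlinarith
    have : 0 ≤ (α - b) / 4 * P ^ 2 + l ^ 2 * y * (α + b) / 8 * v ^ 2 - l * κ * y ^ 3 * v * P := by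
      rw [e2]; positivity
    linarith
  have s3 : l * κ * (3 * y ^ 2) * (β * α + b) * v ^ 2 ≤ l ^ 2 * y * (α + b) / 8 * v ^ 2 :=
    mul_le_mul_of_nonneg_right s1 (sq_nonneg _)
  have s5 : 0 ≤ (l * (1 + β) * (α + b) / 2 + l ^ 2 * κ * y ^ 3 * (α + b)) * v ^ 2 := by positivity
  have s6 : 0 ≤ (α + b) / 2 * n := by positivity
  have s7 : (α - b) / 8 * p ^ 2 ≤ (α - b) / 4 * P ^ 2 + l ^ 2 * y * (α + b) / 4 * v ^ 2 := by
    have e3 : (α - b) / 4 * P ^ 2 + l ^ 2 * y * (α + b) / 4 * v ^ 2 - (α - b) / 8 * p ^ 2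
        = (α - b) / 8 * (P + l * (α + b) * v) ^ 2 := by rw [hp, hyd]; ring
    have : 0 ≤ (α - b) / 8 * (P + l * (α + b) * v) ^ 2 := by positivity
    linarith
  linarith

/-! ### The Carleman estimate -/

theorem exists_carleman_params {R τ₁ : ℝ} (M : ℝ) (hR : 0 < R) (hτ₁ : 2 * R < τ₁) :
    ∃ β t0 ε κ l B e c : ℝ, 0 < β ∧ β < 1 ∧ 0 < ε ∧ 0 < κ ∧ 1 ≤ l ∧ 0 < B ∧ 0 < e ∧ 0 < c ∧
      κ * B ^ 4 = 1 / 4 ∧ 24 * κ * B ^ 2 ≤ l ∧ 20 ≤ l * e ∧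
      (∀ y ≥ 0, 7 / 2 * y ≤ e / 4 + l * κ * y ^ 4) ∧
      (1 / 4 + B ^ 4 / (16 * e)) * (2 * M ^ 2) ≤ l * (e / 4) ∧
      ∀ x ∈ Icc 0 R, x + ε ≤ B ∧ e ≤ (1 - β) * (x + ε) ^ 2 ∧
        (∀ τ ∈ Icc 0 τ₁, |β * (x + τ - t0)| ≤ B ∧ |x + τ - t0| ≤ B) ∧
        x + ε + c ≤ β * (x + τ₁ - t0) ∧ x + ε + c ≤ β * (t0 - x) := by
  obtain ⟨d, hd⟩ : ∃ d, d = (τ₁ - 2 * R) / 8 := ⟨_, rfl⟩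
  have hd0 : 0 < d := by rw [hd]; linarith
  have hτ : τ₁ = 2 * R + 8 * d := by rw [hd]; ring
  have hRd : 0 < R + 4 * d := by linarith
  obtain ⟨β, hβ⟩ : ∃ β, β = 1 - d / (R + 4 * d) := ⟨_, rfl⟩
  have hdR : 0 < d / (R + 4 * d) := by positivity
  have hdR1 : d / (R + 4 * d) < 1 := by rw [div_lt_one hRd]; linarith
  have hβ0 : 0 < β := by rw [hβ]; linarith
  have hβ1 : β < 1 := by rw [hβ]; linarith
  have hβd : β * (R + 4 * d) = R + 3 * d := by rw [hβ]; field_simp; ring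
  obtain ⟨B, hB⟩ : ∃ B, B = R + τ₁ := ⟨_, rfl⟩
  have hB0 : 0 < B := by rw [hB]; linarith
  obtain ⟨κ, hκ⟩ : ∃ κ, κ = 1 / (4 * B ^ 4) := ⟨_, rfl⟩
  have hκ0 : 0 < κ := by rw [hκ]; positivity
  obtain ⟨e, he⟩ : ∃ e, e = (1 - β) * d ^ 2 := ⟨_, rfl⟩
  have he0 : 0 < e := by rw [he]; exact mul_pos (by linarith) (by positivity)
  obtain ⟨l, hl⟩ : ∃ l, l = 1 + 24 * κ * B ^ 2 + 20 / e + 7 / 2 * (14 / e) ^ 3 / κ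
      + (1 / 4 + B ^ 4 / (16 * e)) * (2 * M ^ 2) * (4 / e) := ⟨_, rfl⟩
  have p1 : 0 ≤ 24 * κ * B ^ 2 := by positivity
  have p2 : 0 ≤ 20 / e := by positivity
  have p3 : 0 ≤ 7 / 2 * (14 / e) ^ 3 / κ := by positivity
  have p4 : 0 ≤ (1 / 4 + B ^ 4 / (16 * e)) * (2 * M ^ 2) * (4 / e) := by positivity
  refine ⟨β, 2 * R + 4 * d, d, κ, l, B, e, 2 * d, hβ0, hβ1, hd0, hκ0, by linarith, hB0, he0,
    by linarith, ?_, by linarith, ?_, ?_, ?_, ?_⟩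
  · rw [hκ]; field_simp
  · have h : 20 / e ≤ l := by linarith
    rwa [div_le_iff₀ he0] at h
  · intro y hy
    have h : 7 / 2 * (14 / e) ^ 3 / κ ≤ l := by linarith
    rw [div_le_iff₀ hκ0] at h
    rcases le_total y (e / 14) with h1 | h1
    · have hl0 : 0 < l := by linarith
      have : 0 ≤ l * κ * y ^ 4 := by positivity
      linarith
    · have h2 : 1 ≤ (14 / e * y) ^ 3 := by
        refine one_le_pow₀ ?_
        rw [div_mul_eq_mul_div, one_le_div he0]; linarith [hy]
      have h3 : 7 / 2 * (14 / e) ^ 3 * y ^ 4 ≤ l * κ * y ^ 4 :=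
        mul_le_mul_of_nonneg_right h (by positivity)
      have h4 := mul_le_mul_of_nonneg_left h2 hy
      have h5 : 7 / 2 * (14 / e) ^ 3 * y ^ 4 = 7 / 2 * (y * (14 / e * y) ^ 3) := by ring
      linarith
  · have h : (1 / 4 + B ^ 4 / (16 * e)) * (2 * M ^ 2) * (4 / e) ≤ l := by linarith
    rw [← mul_div_assoc, div_le_iff₀ he0] at h
    linarith
  · rintro x ⟨hx0, hxR⟩
    have k1 : 0 ≤ (1 - β) * (R - x) := mul_nonneg (by linarith) (by linarith)
    have k2 : 0 ≤ β * (R - x) := mul_nonneg (by linarith) (by linarith)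
    refine ⟨by rw [hB]; linarith, ?_, ?_, ?_, ?_⟩
    · rw [he]
      exact mul_le_mul_of_nonneg_left (pow_le_pow_left₀ hd0.le (by linarith) 2) (by linarith)
    · rintro τ ⟨h1, h2⟩
      have h3 : |x + τ - (2 * R + 4 * d)| ≤ B := by
        rw [abs_le, hB]; constructor <;> linarith
      refine ⟨?_, h3⟩
      rw [abs_mul, abs_of_pos hβ0]
      nlinarith [abs_nonneg (x + τ - (2 * R + 4 * d))]
    · rw [hτ]; nlinarith
    · nlinarith

section Fields
variable {ρ : ℝ} {W : E3 × ℝ → ℝ} {g : E3 × ℝ → (E3 × ℝ →L[ℝ] ℝ)}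
  {H : E3 × ℝ → (E3 × ℝ →L[ℝ] E3 × ℝ →L[ℝ] ℝ)}

def rv (W : E3 × ℝ → ℝ) (θ : S2) (x τ : ℝ) : ℝ := x * W (chi x τ θ)

def rvx (W : E3 × ℝ → ℝ) (g : E3 × ℝ → (E3 × ℝ →L[ℝ] ℝ)) (θ : S2) (x τ : ℝ) : ℝ :=
  W (chi x τ θ) + x * g (chi x τ θ) (eL θ)

def rvt (g : E3 × ℝ → (E3 × ℝ →L[ℝ] ℝ)) (θ : S2) (x τ : ℝ) : ℝ := x * g (chi x τ θ) eT

def rvxx (g : E3 × ℝ → (E3 × ℝ →L[ℝ] ℝ)) (H : E3 × ℝ → (E3 × ℝ →L[ℝ] E3 × ℝ →L[ℝ] ℝ))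
    (θ : S2) (x τ : ℝ) : ℝ :=
  2 * g (chi x τ θ) (eL θ) + x * H (chi x τ θ) (eL θ) (eL θ)

def rvxt (g : E3 × ℝ → (E3 × ℝ →L[ℝ] ℝ)) (H : E3 × ℝ → (E3 × ℝ →L[ℝ] E3 × ℝ →L[ℝ] ℝ))
    (θ : S2) (x τ : ℝ) : ℝ :=
  g (chi x τ θ) eT + x * H (chi x τ θ) (eL θ) eT

/-- The squared length of the angular gradient of `rv`. -/
def rang (g : E3 × ℝ → (E3 × ℝ →L[ℝ] ℝ)) (θ : S2) (x τ : ℝ) : ℝ :=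
  x ^ 2 * ∑ k, g (chi x τ θ) (eX (rotGen k θ)) ^ 2

def rangx (g : E3 × ℝ → (E3 × ℝ →L[ℝ] ℝ)) (H : E3 × ℝ → (E3 × ℝ →L[ℝ] E3 × ℝ →L[ℝ] ℝ))
    (θ : S2) (x τ : ℝ) : ℝ :=
  2 * x * ∑ k, g (chi x τ θ) (eX (rotGen k θ)) ^ 2
    + x ^ 2 * ∑ k, 2 * g (chi x τ θ) (eX (rotGen k θ)) * H (chi x τ θ) (eL θ) (eX (rotGen k θ))

def rangt (g : E3 × ℝ → (E3 × ℝ →L[ℝ] ℝ)) (H : E3 × ℝ → (E3 × ℝ →L[ℝ] E3 × ℝ →L[ℝ] ℝ))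
    (θ : S2) (x τ : ℝ) : ℝ :=
  x ^ 2 * ∑ k, 2 * g (chi x τ θ) (eX (rotGen k θ)) * H (chi x τ θ) eT (eX (rotGen k θ))

theorem chi_mem {x τ : ℝ} (hx : 0 ≤ x) (hτ : 0 < τ) (h : 2 * x + τ < 2 * ρ) (θ : S2) :
    ‖(chi x τ θ).1‖ < (chi x τ θ).2 ∧ ‖(chi x τ θ).1‖ + (chi x τ θ).2 < 2 * ρ := by
  rw [norm_chi_fst hx, chi_snd]
  constructor <;> linarith

variable (P : Pack ρ W g H)
include P

theorem Pack.deriv_rv_x {x τ : ℝ} (hx : 0 ≤ x) (hτ : 0 < τ) (h : 2 * x + τ < 2 * ρ) (θ : S2) :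
    HasDerivAt (fun x => rv W θ x τ) (rvx W g θ x τ) x := by
  obtain ⟨h1, h2⟩ := chi_mem hx hτ h θ
  refine ((hasDerivAt_id x).mul (P.deriv_curve (c := fun x => chi x τ θ) h1 h2
    (hasDerivAt_chi_r x τ θ))).congr_deriv ?_
  simp [rvx]

theorem Pack.deriv_rv_t {x τ : ℝ} (hx : 0 ≤ x) (hτ : 0 < τ) (h : 2 * x + τ < 2 * ρ) (θ : S2) :
    HasDerivAt (fun τ => rv W θ x τ) (rvt g θ x τ) τ := by
  obtain ⟨h1, h2⟩ := chi_mem hx hτ h θ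
  exact (P.deriv_curve (c := fun τ => chi x τ θ) h1 h2 (hasDerivAt_chi_τ x τ θ)).const_mul x

theorem Pack.deriv_rvx_x {x τ : ℝ} (hx : 0 ≤ x) (hτ : 0 < τ) (h : 2 * x + τ < 2 * ρ) (θ : S2) :
    HasDerivAt (fun x => rvx W g θ x τ) (rvxx g H θ x τ) x := by
  obtain ⟨h1, h2⟩ := chi_mem hx hτ h θ
  have d := hasDerivAt_chi_r x τ θ
  refine ((P.deriv_curve (c := fun x => chi x τ θ) h1 h2 d).add ((hasDerivAt_id x).mul
    (P.deriv_curve_g_const (c := fun x => chi x τ θ) (v := eL θ) h1 h2 d))).congr_deriv ?_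
  simp [rvxx]; ring

theorem Pack.deriv_rvx_t {x τ : ℝ} (hx : 0 ≤ x) (hτ : 0 < τ) (h : 2 * x + τ < 2 * ρ) (θ : S2) :
    HasDerivAt (fun τ => rvx W g θ x τ) (rvxt g H θ x τ) τ := by
  obtain ⟨h1, h2⟩ := chi_mem hx hτ h θ
  have d := hasDerivAt_chi_τ x τ θ
  refine ((P.deriv_curve (c := fun τ => chi x τ θ) h1 h2 d).add
    ((P.deriv_curve_g_const (c := fun τ => chi x τ θ) (v := eL θ) h1 h2 d).const_mul
      x)).congr_deriv ?_
  simp only [rvxt]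
  rw [P.symm _ h1 h2 eT]

theorem Pack.deriv_rvt_x {x τ : ℝ} (hx : 0 ≤ x) (hτ : 0 < τ) (h : 2 * x + τ < 2 * ρ) (θ : S2) :
    HasDerivAt (fun x => rvt g θ x τ) (rvxt g H θ x τ) x := by
  obtain ⟨h1, h2⟩ := chi_mem hx hτ h θ
  have d := hasDerivAt_chi_r x τ θ
  refine ((hasDerivAt_id x).mul
    (P.deriv_curve_g_const (c := fun x => chi x τ θ) (v := eT) h1 h2 d)).congr_deriv ?_
  simp [rvxt]

theorem Pack.deriv_rang_x {x τ : ℝ} (hx : 0 ≤ x) (hτ : 0 < τ) (h : 2 * x + τ < 2 * ρ) (θ : S2) :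
    HasDerivAt (fun x => rang g θ x τ) (rangx g H θ x τ) x := by
  obtain ⟨h1, h2⟩ := chi_mem hx hτ h θ
  have d := hasDerivAt_chi_r x τ θ
  have s := HasDerivAt.fun_sum (u := Finset.univ) fun k (_ : k ∈ Finset.univ) =>
    (P.deriv_curve_g_const (c := fun x => chi x τ θ) (v := eX (rotGen k θ)) h1 h2 d).pow 2
  refine (((hasDerivAt_id x).pow 2).mul s).congr_deriv ?_
  simp [rangx]

theorem Pack.deriv_rang_t {x τ : ℝ} (hx : 0 ≤ x) (hτ : 0 < τ) (h : 2 * x + τ < 2 * ρ) (θ : S2) :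
    HasDerivAt (fun τ => rang g θ x τ) (rangt g H θ x τ) τ := by
  obtain ⟨h1, h2⟩ := chi_mem hx hτ h θ
  have d := hasDerivAt_chi_τ x τ θ
  have s := HasDerivAt.fun_sum (u := Finset.univ) fun k (_ : k ∈ Finset.univ) =>
    (P.deriv_curve_g_const (c := fun τ => chi x τ θ) (v := eX (rotGen k θ)) h1 h2 d).pow 2
  refine (s.const_mul (x ^ 2)).congr_deriv ?_
  simp [rangt]

end Fields

section Fluxes
variable {ρ : ℝ} {W : E3 × ℝ → ℝ} {g : E3 × ℝ → (E3 × ℝ →L[ℝ] ℝ)}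
  {H : E3 × ℝ → (E3 × ℝ →L[ℝ] E3 × ℝ →L[ℝ] ℝ)}

/-- The positive part of the Lorentzian length of the gradient of the weight. -/
def cpos (β t0 ε x τ : ℝ) : ℝ := max ((β * (x + τ - t0)) ^ 2 - (x + ε) ^ 2) 0

def fluxX (l β κ t0 ε : ℝ) (W : E3 × ℝ → ℝ) (g : E3 × ℝ → (E3 × ℝ →L[ℝ] ℝ))
    (θ : S2) (x τ : ℝ) : ℝ :=
  exp (2 * l * cwt β t0 ε x τ) * cflux₁ l β κ (β * (x + τ - t0)) (x + ε) (cpos β t0 ε x τ ^ 3)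
    (3 * cpos β t0 ε x τ ^ 2) (rv W θ x τ) (rvx W g θ x τ) (rvt g θ x τ) (rang g θ x τ)

def fluxT (l β κ t0 ε : ℝ) (W : E3 × ℝ → ℝ) (g : E3 × ℝ → (E3 × ℝ →L[ℝ] ℝ))
    (θ : S2) (x τ : ℝ) : ℝ :=
  exp (2 * l * cwt β t0 ε x τ) * cflux₂ l β κ (β * (x + τ - t0)) (x + ε) (cpos β t0 ε x τ ^ 3)
    (3 * cpos β t0 ε x τ ^ 2) (rv W θ x τ) (rvx W g θ x τ) (rang g θ x τ)

def dfluxX (l β κ t0 ε : ℝ) (W : E3 × ℝ → ℝ) (g : E3 × ℝ → (E3 × ℝ →L[ℝ] ℝ))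
    (H : E3 × ℝ → (E3 × ℝ →L[ℝ] E3 × ℝ →L[ℝ] ℝ)) (θ : S2) (x τ : ℝ) : ℝ :=
  exp (2 * l * cwt β t0 ε x τ) * cdflux₁ l β κ (β * (x + τ - t0)) (x + ε) (cpos β t0 ε x τ ^ 3)
    (3 * cpos β t0 ε x τ ^ 2) (6 * cpos β t0 ε x τ) (rv W θ x τ) (rvx W g θ x τ) (rvt g θ x τ)
    (rang g θ x τ) (rvxx g H θ x τ) (rvxt g H θ x τ) (rangx g H θ x τ)

def dfluxT (l β κ t0 ε : ℝ) (W : E3 × ℝ → ℝ) (g : E3 × ℝ → (E3 × ℝ →L[ℝ] ℝ))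
    (H : E3 × ℝ → (E3 × ℝ →L[ℝ] E3 × ℝ →L[ℝ] ℝ)) (θ : S2) (x τ : ℝ) : ℝ :=
  exp (2 * l * cwt β t0 ε x τ) * cdflux₂ l β κ (β * (x + τ - t0)) (x + ε) (cpos β t0 ε x τ ^ 3)
    (3 * cpos β t0 ε x τ ^ 2) (6 * cpos β t0 ε x τ) (rv W θ x τ) (rvx W g θ x τ) (rvt g θ x τ)
    (rang g θ x τ) (rvxt g H θ x τ) (rangt g H θ x τ)

theorem hasDerivAt_carleman_a_x (β t0 x τ : ℝ) :
    HasDerivAt (fun x => β * (x + τ - t0)) β x := by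
  simpa using (((hasDerivAt_id x).add_const τ).sub_const t0).const_mul β

theorem hasDerivAt_carleman_a_t (β t0 x τ : ℝ) :
    HasDerivAt (fun τ => β * (x + τ - t0)) β τ := by
  simpa using (((hasDerivAt_id τ).const_add x).sub_const t0).const_mul β

theorem hasDerivAt_cpos_pow_x (n : ℕ) (β t0 ε x τ : ℝ) :
    HasDerivAt (fun x => cpos β t0 ε x τ ^ (n + 2)) ((n + 2 : ℕ) * cpos β t0 ε x τ ^ (n + 1)
      * (2 * β * (β * (x + τ - t0)) - 2 * (x + ε))) x := by
  have h := ((hasDerivAt_carleman_a_x β t0 x τ).pow 2).sub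
    (((hasDerivAt_id x).add_const ε).pow 2)
  refine ((hasDerivAt_posPart_pow n _).comp x h).congr_deriv ?_
  simp only [cpos]
  simp
  left; ring

theorem hasDerivAt_cpos_pow_t (n : ℕ) (β t0 ε x τ : ℝ) :
    HasDerivAt (fun τ => cpos β t0 ε x τ ^ (n + 2)) ((n + 2 : ℕ) * cpos β t0 ε x τ ^ (n + 1)
      * (2 * β * (β * (x + τ - t0)))) τ := by
  have h := ((hasDerivAt_carleman_a_t β t0 x τ).pow 2).sub_const ((x + ε) ^ 2)
  refine ((hasDerivAt_posPart_pow n _).comp τ h).congr_deriv ?_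
  simp only [cpos]
  simp
  left; ring

theorem Pack.deriv_fluxX (P : Pack ρ W g H) (l β κ t0 ε : ℝ) {x τ : ℝ} (hx : 0 ≤ x) (hτ : 0 < τ)
    (h : 2 * x + τ < 2 * ρ) (θ : S2) :
    HasDerivAt (fun x => fluxX l β κ t0 ε W g θ x τ) (dfluxX l β κ t0 ε W g H θ x τ) x := by
  refine cflux₁_deriv (hasDerivAt_carleman_a_x β t0 x τ) ((hasDerivAt_id x).add_const ε)
    (hasDerivAt_cpos_pow_x 1 β t0 ε x τ) ((hasDerivAt_cpos_pow_x 0 β t0 ε x τ).const_mul 3)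
    (P.deriv_rv_x hx hτ h θ) (P.deriv_rvx_x hx hτ h θ) (P.deriv_rvt_x hx hτ h θ)
    (P.deriv_rang_x hx hτ h θ) (cwt_deriv_x β t0 ε x τ) rfl rfl rfl rfl ?_ ?_
  · simp only [id]; push_cast; ring
  · simp only [id]; push_cast; ring

theorem Pack.deriv_fluxT (P : Pack ρ W g H) (l β κ t0 ε : ℝ) {x τ : ℝ} (hx : 0 ≤ x) (hτ : 0 < τ)
    (h : 2 * x + τ < 2 * ρ) (θ : S2) :
    HasDerivAt (fun τ => fluxT l β κ t0 ε W g θ x τ) (dfluxT l β κ t0 ε W g H θ x τ) τ := by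
  refine cflux₂_deriv (hasDerivAt_carleman_a_t β t0 x τ) (hasDerivAt_const τ (x + ε))
    (hasDerivAt_cpos_pow_t 1 β t0 ε x τ) ((hasDerivAt_cpos_pow_t 0 β t0 ε x τ).const_mul 3)
    (P.deriv_rv_t hx hτ h θ) (P.deriv_rvx_t hx hτ h θ)
    (P.deriv_rang_t hx hτ h θ) (cwt_deriv_τ β t0 ε x τ) rfl rfl rfl rfl ?_ ?_
  · push_cast; ring
  · push_cast; ring

/-- The multiplier terms which integrate to zero over the sphere. -/
def angMul (c0 c1 c2 : ℝ) (W : E3 × ℝ → ℝ) (g : E3 × ℝ → (E3 × ℝ →L[ℝ] ℝ))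
    (H : E3 × ℝ → (E3 × ℝ →L[ℝ] E3 × ℝ →L[ℝ] ℝ)) (θ : S2) (r τ : ℝ) : ℝ :=
  angTerm r θ (g (chi r τ θ)) (H (chi r τ θ)) *
        (c0 * W (chi r τ θ) + c1 * g (chi r τ θ) (eL θ) + c2 * g (chi r τ θ) eT)
      + ∑ k, g (chi r τ θ) (eX (rotGen k θ)) * (c0 * (r * g (chi r τ θ) (eX (rotGen k θ)))
        + c1 * (r * H (chi r τ θ) (eX (rotGen k θ)) (eL θ) + g (chi r τ θ) (eX (rotGen k θ)))
        + c2 * (r * H (chi r τ θ) (eX (rotGen k θ)) eT))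

def cmul₀ (l β κ t0 ε x τ : ℝ) : ℝ := x + ε + x * (-l * ((β * (x + τ - t0)) ^ 2 - (x + ε) ^ 2)
  + l * κ * cpos β t0 ε x τ ^ 3)

/-- The error term in the Carleman identity. -/
def angErr (l β κ t0 ε : ℝ) (W : E3 × ℝ → ℝ) (g : E3 × ℝ → (E3 × ℝ →L[ℝ] ℝ))
    (H : E3 × ℝ → (E3 × ℝ →L[ℝ] E3 × ℝ →L[ℝ] ℝ)) (θ : S2) (x τ : ℝ) : ℝ :=
  exp (2 * l * cwt β t0 ε x τ) * angMul (cmul₀ l β κ t0 ε x τ) ((x + ε) * x)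
    ((β * (x + τ - t0) - (x + ε)) * x) W g H θ x τ

theorem Pack.dflux_sum (P : Pack ρ W g H) (l β κ t0 ε : ℝ) {x τ : ℝ} (hx : 0 ≤ x) (hτ : 0 < τ)
    (h : 2 * x + τ < 2 * ρ) (θ : S2) :
    dfluxX l β κ t0 ε W g H θ x τ + dfluxT l β κ t0 ε W g H θ x τ = angErr l β κ t0 ε W g H θ x τ
      + exp (2 * l * cwt β t0 ε x τ) *
      ((x * boxH (H (chi x τ θ))) *
        ((β * (x + τ - t0)) * (rvt g θ x τ - l * (β * (x + τ - t0)) * rv W θ x τ)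
          + (x + ε) * (rvx W g θ x τ - rvt g θ x τ + l * (x + ε) * rv W θ x τ)
          + l * κ * cpos β t0 ε x τ ^ 3 * rv W θ x τ)
        - ((1 - β) / 2 * ((rvt g θ x τ - l * (β * (x + τ - t0)) * rv W θ x τ) ^ 2
            + (rvx W g θ x τ - rvt g θ x τ + l * (x + ε) * rv W θ x τ) ^ 2)
          + 2 * l * ((β * (x + τ - t0)) * (rvt g θ x τ - l * (β * (x + τ - t0)) * rv W θ x τ)
          + (x + ε) * (rvx W g θ x τ - rvt g θ x τ + l * (x + ε) * rv W θ x τ)) ^ 2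
          + l * κ * cpos β t0 ε x τ ^ 3 *
            ((rvx W g θ x τ - rvt g θ x τ + l * (x + ε) * rv W θ x τ) ^ 2
            - (rvt g θ x τ - l * (β * (x + τ - t0)) * rv W θ x τ) ^ 2)
          + cbulk₀ l β κ (β * (x + τ - t0)) (x + ε) (cpos β t0 ε x τ ^ 3) (3 * cpos β t0 ε x τ ^ 2)
            (6 * cpos β t0 ε x τ) * rv W θ x τ ^ 2)
        + ((1 + β) / 2 * x ^ 2 - (x + ε) * x - l * κ * cpos β t0 ε x τ ^ 3 * x ^ 2) *
          ∑ k, g (chi x τ θ) (eX (rotGen k θ)) ^ 2) := by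
  obtain ⟨h1, h2⟩ := chi_mem hx hτ h θ
  have hs := P.symm _ h1 h2
  have hb := box_identity x θ (g (chi x τ θ)) (H (chi x τ θ)) hs
  have e : 2 * rvxt g H θ x τ - rvxx g H θ x τ
      = x * boxH (H (chi x τ θ)) + angTerm x θ (g (chi x τ θ)) (H (chi x τ θ)) := by
    rw [← hb]; simp only [rvxt, rvxx]
  rw [dfluxX, dfluxT, ← mul_add, carleman_identity, e, angErr, ← mul_add]
  congr 1
  generalize cbulk₀ l β κ (β * (x + τ - t0)) (x + ε) (cpos β t0 ε x τ ^ 3) (3 * cpos β t0 ε x τ ^ 2)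
            (6 * cpos β t0 ε x τ) = Z
  generalize hA : angTerm x θ (g (chi x τ θ)) (H (chi x τ θ)) = A
  simp only [angMul, hA, rv, rvx, rvt, rang, rangx, rangt, cmul₀, Fin.sum_univ_three]
  rw [hs (eX (rotGen 0 θ)) (eL θ), hs (eX (rotGen 1 θ)) (eL θ), hs (eX (rotGen 2 θ)) (eL θ),
    hs (eX (rotGen 0 θ)) eT, hs (eX (rotGen 1 θ)) eT, hs (eX (rotGen 2 θ)) eT]
  ring

theorem Pack.integral_angErr (P : Pack ρ W g H) (l β κ t0 ε : ℝ) {x τ : ℝ} (hx : 0 ≤ x) (hτ : 0 < τ)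
    (h : 2 * x + τ < 2 * ρ) : ∫ θ, angErr l β κ t0 ε W g H θ x τ ∂sig = 0 := by
  simp only [angErr]
  rw [integral_const_mul]
  have := P.integral_multiplier hx hτ h (cmul₀ l β κ t0 ε x τ) ((x + ε) * x)
    ((β * (x + τ - t0) - (x + ε)) * x)
  simp only [angMul]
  rw [this, mul_zero]

end Fluxes

section Fluxes
variable {ρ : ℝ} {W : E3 × ℝ → ℝ} {g : E3 × ℝ → (E3 × ℝ →L[ℝ] ℝ)}
  {H : E3 × ℝ → (E3 × ℝ →L[ℝ] E3 × ℝ →L[ℝ] ℝ)}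

theorem continuous_chi₃ : Continuous fun p : S2 × ℝ × ℝ => chi p.2.1 p.2.2 p.1 := by
  unfold chi; fun_prop

theorem continuous_cpos (β t0 ε : ℝ) :
    Continuous fun p : S2 × ℝ × ℝ => cpos β t0 ε p.2.1 p.2.2 := by
  unfold cpos; fun_prop

theorem continuous_cwt (β t0 ε : ℝ) :
    Continuous fun p : S2 × ℝ × ℝ => cwt β t0 ε p.2.1 p.2.2 := by
  unfold cwt; fun_prop

theorem continuous_rotGen₃ (k : Fin 3) :
    Continuous fun p : S2 × ℝ × ℝ => eX (rotGen k p.1) := by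
  have : Continuous fun p : S2 × ℝ × ℝ => rotGen k (p.1 : E3) := by fun_prop
  exact continuous_eX.comp this

theorem continuous_eL₃ : Continuous fun p : S2 × ℝ × ℝ => eL (p.1 : E3) :=
  continuous_eL.comp (by fun_prop)

theorem continuous_carleman_a (β t0 : ℝ) :
    Continuous fun p : S2 × ℝ × ℝ => β * (p.2.1 + p.2.2 - t0) := by fun_prop

theorem continuous_carleman_b (ε : ℝ) : Continuous fun p : S2 × ℝ × ℝ => p.2.1 + ε := by fun_prop

theorem continuous_cflux₁ {X : Type*} [TopologicalSpace X] (l β κ : ℝ) {a b η η1 v p q n : X → ℝ}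
    (ha : Continuous a) (hb : Continuous b) (hη : Continuous η) (hη1 : Continuous η1)
    (hv : Continuous v) (hp : Continuous p) (hq : Continuous q) (hn : Continuous n) :
    Continuous fun z => cflux₁ l β κ (a z) (b z) (η z) (η1 z) (v z) (p z) (q z) (n z) := by
  unfold cflux₁; fun_prop

theorem continuous_cflux₂ {X : Type*} [TopologicalSpace X] (l β κ : ℝ) {a b η η1 v p n : X → ℝ}
    (ha : Continuous a) (hb : Continuous b) (hη : Continuous η) (hη1 : Continuous η1)
    (hv : Continuous v) (hp : Continuous p) (hn : Continuous n) :
    Continuous fun z => cflux₂ l β κ (a z) (b z) (η z) (η1 z) (v z) (p z) (n z) := by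
  unfold cflux₂; fun_prop

theorem continuous_cdflux₁ {X : Type*} [TopologicalSpace X] (l β κ : ℝ)
    {a b η η1 η2 v p q n vxx vxt nx : X → ℝ}
    (ha : Continuous a) (hb : Continuous b) (hη : Continuous η) (hη1 : Continuous η1)
    (hη2 : Continuous η2) (hv : Continuous v) (hp : Continuous p) (hq : Continuous q)
    (hn : Continuous n) (hvxx : Continuous vxx) (hvxt : Continuous vxt) (hnx : Continuous nx) :
    Continuous fun z => cdflux₁ l β κ (a z) (b z) (η z) (η1 z) (η2 z) (v z) (p z) (q z) (n z)
      (vxx z) (vxt z) (nx z) := by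
  unfold cdflux₁ cflux₁; fun_prop

theorem continuous_cdflux₂ {X : Type*} [TopologicalSpace X] (l β κ : ℝ)
    {a b η η1 η2 v p q n vxt nt : X → ℝ}
    (ha : Continuous a) (hb : Continuous b) (hη : Continuous η) (hη1 : Continuous η1)
    (hη2 : Continuous η2) (hv : Continuous v) (hp : Continuous p) (hq : Continuous q)
    (hn : Continuous n) (hvxt : Continuous vxt) (hnt : Continuous nt) :
    Continuous fun z => cdflux₂ l β κ (a z) (b z) (η z) (η1 z) (η2 z) (v z) (p z) (q z) (n z)
      (vxt z) (nt z) := by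
  unfold cdflux₂ cflux₂; fun_prop

theorem continuous_exp_cwt (l β t0 ε : ℝ) :
    Continuous fun p : S2 × ℝ × ℝ => exp (2 * l * cwt β t0 ε p.2.1 p.2.2) :=
  ((continuous_cwt β t0 ε).const_mul (2 * l)).rexp

section
variable (P : Pack ρ W g H)
include P

theorem Pack.continuous_W₃ : Continuous fun p : S2 × ℝ × ℝ => W (chi p.2.1 p.2.2 p.1) :=
  P.cW.comp continuous_chi₃

theorem Pack.continuous_g₃ {v : S2 × ℝ × ℝ → E3 × ℝ} (hv : Continuous v) :
    Continuous fun p : S2 × ℝ × ℝ => g (chi p.2.1 p.2.2 p.1) (v p) :=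
  (P.cg.comp continuous_chi₃).clm_apply hv

theorem Pack.continuous_H₃ {v w : S2 × ℝ × ℝ → E3 × ℝ} (hv : Continuous v) (hw : Continuous w) :
    Continuous fun p : S2 × ℝ × ℝ => H (chi p.2.1 p.2.2 p.1) (v p) (w p) :=
  ((P.cH.comp continuous_chi₃).clm_apply hv).clm_apply hw

theorem Pack.continuous_rv : Continuous fun p : S2 × ℝ × ℝ => rv W p.1 p.2.1 p.2.2 :=
  (continuous_fst.comp continuous_snd).mul P.continuous_W₃

theorem Pack.continuous_rvx : Continuous fun p : S2 × ℝ × ℝ => rvx W g p.1 p.2.1 p.2.2 :=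
  P.continuous_W₃.add ((continuous_fst.comp continuous_snd).mul (P.continuous_g₃ continuous_eL₃))

theorem Pack.continuous_rvt : Continuous fun p : S2 × ℝ × ℝ => rvt g p.1 p.2.1 p.2.2 :=
  (continuous_fst.comp continuous_snd).mul (P.continuous_g₃ continuous_const)

theorem Pack.continuous_rvxx : Continuous fun p : S2 × ℝ × ℝ => rvxx g H p.1 p.2.1 p.2.2 :=
  ((P.continuous_g₃ continuous_eL₃).const_mul 2).add
    ((continuous_fst.comp continuous_snd).mul (P.continuous_H₃ continuous_eL₃ continuous_eL₃))

theorem Pack.continuous_rvxt : Continuous fun p : S2 × ℝ × ℝ => rvxt g H p.1 p.2.1 p.2.2 :=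
  (P.continuous_g₃ continuous_const).add
    ((continuous_fst.comp continuous_snd).mul (P.continuous_H₃ continuous_eL₃ continuous_const))

theorem Pack.continuous_sum_rotGen_sq :
    Continuous fun p : S2 × ℝ × ℝ => ∑ k, g (chi p.2.1 p.2.2 p.1) (eX (rotGen k p.1)) ^ 2 :=
  continuous_finsetSum _ fun k _ => (P.continuous_g₃ (continuous_rotGen₃ k)).pow 2

theorem Pack.continuous_rang : Continuous fun p : S2 × ℝ × ℝ => rang g p.1 p.2.1 p.2.2 :=
  ((continuous_fst.comp continuous_snd).pow 2).mul P.continuous_sum_rotGen_sq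

theorem Pack.continuous_sum_rotGen_mul {v : S2 × ℝ × ℝ → E3 × ℝ} (hv : Continuous v) :
    Continuous fun p : S2 × ℝ × ℝ => ∑ k, 2 * g (chi p.2.1 p.2.2 p.1) (eX (rotGen k p.1))
      * H (chi p.2.1 p.2.2 p.1) (v p) (eX (rotGen k p.1)) :=
  continuous_finsetSum _ fun k _ => ((P.continuous_g₃ (continuous_rotGen₃ k)).const_mul 2).mul
    (P.continuous_H₃ hv (continuous_rotGen₃ k))

theorem Pack.continuous_rangx : Continuous fun p : S2 × ℝ × ℝ => rangx g H p.1 p.2.1 p.2.2 :=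
  (((continuous_fst.comp continuous_snd).const_mul 2).mul P.continuous_sum_rotGen_sq).add
    (((continuous_fst.comp continuous_snd).pow 2).mul (P.continuous_sum_rotGen_mul continuous_eL₃))

theorem Pack.continuous_rangt : Continuous fun p : S2 × ℝ × ℝ => rangt g H p.1 p.2.1 p.2.2 :=
  ((continuous_fst.comp continuous_snd).pow 2).mul (P.continuous_sum_rotGen_mul continuous_const)

theorem Pack.continuous_fluxX (l β κ t0 ε : ℝ) :
    Continuous fun p : S2 × ℝ × ℝ => fluxX l β κ t0 ε W g p.1 p.2.1 p.2.2 :=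
  (continuous_exp_cwt l β t0 ε).mul (continuous_cflux₁ l β κ (continuous_carleman_a β t0)
    (continuous_carleman_b ε) ((continuous_cpos β t0 ε).pow 3)
    (((continuous_cpos β t0 ε).pow 2).const_mul 3) P.continuous_rv P.continuous_rvx P.continuous_rvt
    P.continuous_rang)

theorem Pack.continuous_fluxT (l β κ t0 ε : ℝ) :
    Continuous fun p : S2 × ℝ × ℝ => fluxT l β κ t0 ε W g p.1 p.2.1 p.2.2 :=
  (continuous_exp_cwt l β t0 ε).mul (continuous_cflux₂ l β κ (continuous_carleman_a β t0)
    (continuous_carleman_b ε) ((continuous_cpos β t0 ε).pow 3)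
    (((continuous_cpos β t0 ε).pow 2).const_mul 3) P.continuous_rv P.continuous_rvx
    P.continuous_rang)

theorem Pack.continuous_dfluxX (l β κ t0 ε : ℝ) :
    Continuous fun p : S2 × ℝ × ℝ => dfluxX l β κ t0 ε W g H p.1 p.2.1 p.2.2 :=
  (continuous_exp_cwt l β t0 ε).mul (continuous_cdflux₁ l β κ (continuous_carleman_a β t0)
    (continuous_carleman_b ε) ((continuous_cpos β t0 ε).pow 3)
    (((continuous_cpos β t0 ε).pow 2).const_mul 3) ((continuous_cpos β t0 ε).const_mul 6)
    P.continuous_rv P.continuous_rvx P.continuous_rvt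
    P.continuous_rang P.continuous_rvxx P.continuous_rvxt P.continuous_rangx)

theorem Pack.continuous_dfluxT (l β κ t0 ε : ℝ) :
    Continuous fun p : S2 × ℝ × ℝ => dfluxT l β κ t0 ε W g H p.1 p.2.1 p.2.2 :=
  (continuous_exp_cwt l β t0 ε).mul (continuous_cdflux₂ l β κ (continuous_carleman_a β t0)
    (continuous_carleman_b ε) ((continuous_cpos β t0 ε).pow 3)
    (((continuous_cpos β t0 ε).pow 2).const_mul 3) ((continuous_cpos β t0 ε).const_mul 6)
    P.continuous_rv P.continuous_rvx P.continuous_rvt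
    P.continuous_rang P.continuous_rvxt P.continuous_rangt)

theorem Pack.continuous_angTerm :
    Continuous fun p : S2 × ℝ × ℝ => angTerm p.2.1 p.1 (g (chi p.2.1 p.2.2 p.1))
      (H (chi p.2.1 p.2.2 p.1)) := by
  have h (k : Fin 3) : Continuous fun p : S2 × ℝ × ℝ => eX (rotGen k (rotGen k p.1)) :=
    continuous_eX.comp (by fun_prop)
  unfold angTerm
  exact continuous_finsetSum _ fun k _ => ((continuous_fst.comp continuous_snd).mul
    (P.continuous_H₃ (continuous_rotGen₃ k) (continuous_rotGen₃ k))).add (P.continuous_g₃ (h k))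

theorem Pack.continuous_angErr (l β κ t0 ε : ℝ) :
    Continuous fun p : S2 × ℝ × ℝ => angErr l β κ t0 ε W g H p.1 p.2.1 p.2.2 := by
  have hr : Continuous fun p : S2 × ℝ × ℝ => p.2.1 := continuous_fst.comp continuous_snd
  have c0 : Continuous fun p : S2 × ℝ × ℝ => cmul₀ l β κ t0 ε p.2.1 p.2.2 :=
    (continuous_carleman_b ε).add (hr.mul (((((continuous_carleman_a β t0).pow 2).sub
      ((continuous_carleman_b ε).pow 2)).const_mul (-l)).add
      (((continuous_cpos β t0 ε).pow 3).const_mul (l * κ))))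
  have c1 : Continuous fun p : S2 × ℝ × ℝ => (p.2.1 + ε) * p.2.1 := by fun_prop
  have c2 : Continuous fun p : S2 × ℝ × ℝ => (β * (p.2.1 + p.2.2 - t0) - (p.2.1 + ε)) * p.2.1 := by
    fun_prop
  have hg := fun k => P.continuous_g₃ (continuous_rotGen₃ k)
  refine (continuous_exp_cwt l β t0 ε).mul ?_
  unfold angMul
  refine (P.continuous_angTerm.mul (((c0.mul P.continuous_W₃).add (c1.mul
    (P.continuous_g₃ continuous_eL₃))).add (c2.mul (P.continuous_g₃ continuous_const)))).add ?_
  exact continuous_finsetSum _ fun k _ => (hg k).mul (((c0.mul (hr.mul (hg k))).add (c1.mul ((hr.mul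
    (P.continuous_H₃ (continuous_rotGen₃ k) continuous_eL₃)).add (hg k)))).add (c2.mul (hr.mul
    (P.continuous_H₃ (continuous_rotGen₃ k) continuous_const))))

end

/-- The full first-order data of `W` at a point. -/
def jetSq (W : E3 × ℝ → ℝ) (g : E3 × ℝ → (E3 × ℝ →L[ℝ] ℝ)) (p : E3 × ℝ) : ℝ :=
  W p ^ 2 + ∑ i, g p (eX (basis3 i)) ^ 2 + g p eT ^ 2

theorem sum_rotGen_sq (γ : E3 × ℝ →L[ℝ] ℝ) (θ : S2) :
    ∑ k, γ (eX (rotGen k θ)) ^ 2 + γ (eX θ) ^ 2 = ∑ i, γ (eX (basis3 i)) ^ 2 := by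
  have := sum_rotGen_bilin (γ.smulRight γ) θ
  simp only [ContinuousLinearMap.smulRight_apply, smul_apply, smul_eq_mul] at this
  simp only [pow_two]
  linarith

theorem neg_cflux₁_le {l β κ a b B k K η η1 v p q n : ℝ} (hB : 0 ≤ B) (ha : |a| ≤ B) (hb : |b| ≤ B)
    (hk : |l ^ 2 * (a ^ 2 - b ^ 2) * b / 2 + l * (1 + β) * b / 2 - b * (κ * l * η1)
      + l ^ 2 * κ * η * b| ≤ k) (hK : |l * κ * η| ≤ K) (hn : 0 ≤ n) :
    -cflux₁ l β κ a b η η1 v p q n ≤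
      ((B + K) * (2 * (3 + 3 * l ^ 2 * B ^ 2)) + k + K + B) * (v ^ 2 + p ^ 2 + q ^ 2 + n) := by
  have hk0 : 0 ≤ k := (abs_nonneg _).trans hk
  have hK0 : 0 ≤ K := (abs_nonneg _).trans hK
  simp only [cflux₁]
  obtain ⟨Q, hQ⟩ : ∃ Q, Q = q - l * a * v := ⟨_, rfl⟩
  obtain ⟨S, hS⟩ : ∃ S, S = p - q + l * b * v := ⟨_, rfl⟩
  rw [show p + l * (b - a) * v - (q - l * a * v) = S by rw [hS]; ring, ← hQ]
  have ha2 : a ^ 2 ≤ B ^ 2 := sq_le_sq' (by linarith [neg_abs_le a]) (by linarith [le_abs_self a])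
  have hb2 : b ^ 2 ≤ B ^ 2 := sq_le_sq' (by linarith [neg_abs_le b]) (by linarith [le_abs_self b])
  have s1 : Q ^ 2 ≤ 2 * q ^ 2 + 2 * (l ^ 2 * B ^ 2 * v ^ 2) := by
    have h1 : l ^ 2 * v ^ 2 * a ^ 2 ≤ l ^ 2 * v ^ 2 * B ^ 2 :=
      mul_le_mul_of_nonneg_left ha2 (by positivity)
    have h2 := sq_nonneg (q + l * a * v)
    rw [hQ]; linarith
  have s2 : S ^ 2 ≤ 3 * (p ^ 2 + q ^ 2 + l ^ 2 * B ^ 2 * v ^ 2) := by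
    have h1 : l ^ 2 * v ^ 2 * b ^ 2 ≤ l ^ 2 * v ^ 2 * B ^ 2 :=
      mul_le_mul_of_nonneg_left hb2 (by positivity)
    have h2 := sq_nonneg (p + q)
    have h3 := sq_nonneg (p - l * b * v)
    have h4 := sq_nonneg (q + l * b * v)
    rw [hS]; linarith
  have t1 : a * Q * S ≤ B * (Q ^ 2 + S ^ 2) / 2 := by
    have h1 : a * Q * S ≤ |a| * (|Q| * |S|) := by
      rw [← abs_mul, ← abs_mul, mul_assoc]
      exact le_abs_self _
    have h2 : |Q| * |S| ≤ (Q ^ 2 + S ^ 2) / 2 := by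
      have := sq_nonneg (|Q| - |S|)
      rw [sub_sq, sq_abs, sq_abs] at this; linarith
    have h3 := mul_le_mul ha h2 (by positivity) hB
    linarith
  have t2 : b / 2 * (Q ^ 2 + S ^ 2) ≤ B * (Q ^ 2 + S ^ 2) / 2 := by
    have := mul_le_mul_of_nonneg_right ((le_abs_self b).trans hb)
      (by positivity : 0 ≤ Q ^ 2 + S ^ 2)
    linarith
  have t3 := mul_le_mul_of_nonneg_right ((neg_le_abs _).trans hk) (sq_nonneg v)
  have t4 : l * κ * η * v * S ≤ K * (v ^ 2 + S ^ 2) / 2 := by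
    have h1 : l * κ * η * v * S ≤ |l * κ * η| * (|v| * |S|) := by
      rw [← abs_mul, ← abs_mul, mul_assoc (l * κ * η)]
      exact le_abs_self _
    have h2 : |v| * |S| ≤ (v ^ 2 + S ^ 2) / 2 := by
      have := sq_nonneg (|v| - |S|)
      rw [sub_sq, sq_abs, sq_abs] at this; linarith
    have h3 := mul_le_mul hK h2 (by positivity) hK0
    linarith
  have t5 : -(b / 2 * n) ≤ B * n := by
    have := mul_le_mul_of_nonneg_right ((neg_le_abs b).trans hb) hn
    have := mul_nonneg hB hn
    linarith
  obtain ⟨E, hE⟩ : ∃ E, E = v ^ 2 + p ^ 2 + q ^ 2 + n := ⟨_, rfl⟩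
  have hv0 := sq_nonneg v
  have hp0 := sq_nonneg p
  have hq0 := sq_nonneg q
  have hL : 0 ≤ l ^ 2 * B ^ 2 := by positivity
  have hLE : l ^ 2 * B ^ 2 * v ^ 2 ≤ l ^ 2 * B ^ 2 * E := mul_le_mul_of_nonneg_left (by linarith) hL
  have s1' : Q ^ 2 ≤ (3 + 3 * l ^ 2 * B ^ 2) * E := by
    have : 0 ≤ l ^ 2 * B ^ 2 * v ^ 2 := by positivity
    linarith
  have s2' : S ^ 2 ≤ (3 + 3 * l ^ 2 * B ^ 2) * E := by linarith
  have u1 := mul_le_mul_of_nonneg_left s1' hB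
  have u2 := mul_le_mul_of_nonneg_left s2' hB
  have u3 := mul_le_mul_of_nonneg_left s2' hK0
  have u4 : k * v ^ 2 ≤ k * E := mul_le_mul_of_nonneg_left (by linarith) hk0
  have u5 : K * v ^ 2 ≤ K * E := mul_le_mul_of_nonneg_left (by linarith) hK0
  have u6 : B * n ≤ B * E := mul_le_mul_of_nonneg_left (by linarith) hB
  have u7 : 0 ≤ K * ((3 + 3 * l ^ 2 * B ^ 2) * E) := le_trans (by positivity) u3
  have u8 : 0 ≤ K * E := le_trans (by positivity) u5
  rw [← hE]
  linarith

theorem jet_boundary_le {R : ℝ} (θ : S2) (τ : ℝ) :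
    rv W θ R τ ^ 2 + rvx W g θ R τ ^ 2 + rvt g θ R τ ^ 2 + rang g θ R τ
      ≤ (2 + 6 * R ^ 2) * jetSq W g (chi R τ θ) := by
  have hs := sum_rotGen_sq (g (chi R τ θ)) θ
  have h1 : 0 ≤ ∑ k, g (chi R τ θ) (eX (rotGen k θ)) ^ 2 := Finset.sum_nonneg fun _ _ => sq_nonneg _
  simp only [rv, rvx, rvt, rang, jetSq]
  rw [← hs, eL_eq, map_add]
  obtain ⟨w, hw⟩ : ∃ w, w = W (chi R τ θ) := ⟨_, rfl⟩
  obtain ⟨x, hx⟩ : ∃ x, x = g (chi R τ θ) (eX θ) := ⟨_, rfl⟩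
  obtain ⟨t, ht⟩ : ∃ t, t = g (chi R τ θ) eT := ⟨_, rfl⟩
  rw [← hw, ← hx, ← ht]
  generalize ∑ k, g (chi R τ θ) (eX (rotGen k θ)) ^ 2 = N at *
  have e1 := sq_nonneg (w - R * (x + t))
  have e2 : 0 ≤ R ^ 2 * (x - t) ^ 2 := by positivity
  have e3 : 0 ≤ R ^ 2 * w ^ 2 := by positivity
  have e4 : 0 ≤ R ^ 2 * N := by positivity
  have e5 : 0 ≤ R ^ 2 * x ^ 2 := by positivity
  have e6 : 0 ≤ R ^ 2 * t ^ 2 := by positivity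
  nlinarith [sq_nonneg x, sq_nonneg t]

end Fluxes

theorem cwt_bounds {β t0 ε B x τ : ℝ} (hβ0 : 0 ≤ β) (hβ1 : β ≤ 1) (h0 : 0 ≤ x + ε)
    (h1 : x + ε ≤ B) (h2 : |x + τ - t0| ≤ B) :
    -B ^ 2 ≤ 2 * cwt β t0 ε x τ ∧ 2 * cwt β t0 ε x τ ≤ B ^ 2 := by
  have e1 : (x + ε) ^ 2 ≤ B ^ 2 := pow_le_pow_left₀ h0 h1 2
  have e2 : (x + τ - t0) ^ 2 ≤ B ^ 2 := sq_le_sq' (by linarith [neg_abs_le (x + τ - t0)])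
    (by linarith [le_abs_self (x + τ - t0)])
  have e3 := sq_nonneg (x + ε)
  have e4 := sq_nonneg (x + τ - t0)
  unfold cwt
  constructor <;> nlinarith

theorem fluxX_zero_nonpos (l β κ t0 ε : ℝ) (hε : 0 ≤ ε) (W : E3 × ℝ → ℝ)
    (g : E3 × ℝ → (E3 × ℝ →L[ℝ] ℝ)) (θ : S2) (τ : ℝ) : fluxX l β κ t0 ε W g θ 0 τ ≤ 0 := by
  refine mul_nonpos_of_nonneg_of_nonpos (exp_pos _).le ?_
  simp only [cflux₁, rv, rvt, rang, zero_mul, mul_zero, zero_add, add_zero, sub_zero]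
  have : 0 ≤ ε * (rvx W g θ 0 τ) ^ 2 := by positivity
  norm_num
  linarith

theorem rang_nonneg (g : E3 × ℝ → (E3 × ℝ →L[ℝ] ℝ)) (θ : S2) (x τ : ℝ) : 0 ≤ rang g θ x τ :=
  mul_nonneg (sq_nonneg _) (Finset.sum_nonneg fun _ _ => sq_nonneg _)

theorem jetSq_nonneg (W : E3 × ℝ → ℝ) (g : E3 × ℝ → (E3 × ℝ →L[ℝ] ℝ)) (p : E3 × ℝ) :
    0 ≤ jetSq W g p := by
  unfold jetSq; positivity

theorem Pack.continuous_jetSq {ρ : ℝ} {W : E3 × ℝ → ℝ} {g : E3 × ℝ → (E3 × ℝ →L[ℝ] ℝ)}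
    {H : E3 × ℝ → (E3 × ℝ →L[ℝ] E3 × ℝ →L[ℝ] ℝ)} (P : Pack ρ W g H) : Continuous (jetSq W g) := by
  have := P.cW
  have h (v : E3 × ℝ) : Continuous fun p => g p v := P.cg.clm_apply continuous_const
  exact ((P.cW.pow 2).add (continuous_finsetSum _ fun i _ => (h _).pow 2)).add ((h _).pow 2)

theorem sq_box_le {M X w f x : ℝ} (h : |X| ≤ M * |w| + |f|) :
    (x * X) ^ 2 ≤ 2 * M ^ 2 * (x * w) ^ 2 + 2 * (x ^ 2 * f ^ 2) := by
  have h1 : X ^ 2 ≤ (M * |w| + |f|) ^ 2 := by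
    rw [← sq_abs X]; exact pow_le_pow_left₀ (abs_nonneg _) h 2
  have h2 : (M * |w| + |f|) ^ 2 ≤ 2 * M ^ 2 * w ^ 2 + 2 * f ^ 2 := by
    rw [← sq_abs w, ← sq_abs f]; nlinarith [sq_nonneg (M * |w| - |f|)]
  have h3 := mul_le_mul_of_nonneg_left (h1.trans h2) (sq_nonneg x)
  linarith

set_option maxHeartbeats 1000000 in
theorem carleman_estimate {R τ₁ ρ : ℝ} (M : ℝ) (hR : 0 < R) (hτ₁ : 2 * R < τ₁)
    (hρ : 2 * R + τ₁ < 2 * ρ) :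
    ∃ C > 0, ∀ (W : E3 × ℝ → ℝ) (g : E3 × ℝ → (E3 × ℝ →L[ℝ] ℝ))
      (H : E3 × ℝ → (E3 × ℝ →L[ℝ] E3 × ℝ →L[ℝ] ℝ)), Pack ρ W g H →
      ∀ F : E3 × ℝ → ℝ, Continuous F →
      (∀ θ : S2, ∀ x ∈ Ioo 0 R, ∀ τ ∈ Ioo 0 τ₁,
        |boxH (H (chi x τ θ))| ≤ M * |W (chi x τ θ)| + |F (chi x τ θ)|) →
      ∫ θ, (∫ x in (0:ℝ)..R, rvx W g θ x 0 ^ 2) ∂sig ≤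
        C * (boxInt R τ₁ (fun θ x τ => x ^ 2 * F (chi x τ θ) ^ 2)
          + ∫ θ : S2, (∫ τ in (0:ℝ)..τ₁, jetSq W g (chi R τ θ)) ∂sig) := by
  obtain ⟨β, t0, ε, κ, l, B, e, c, hβ0, hβ1, hε, hκ, hl, hB, he, hc, hκB,
    hl4, hl2, hl1, hl3, hbox⟩ :=
    exists_carleman_params M hR hτ₁
  have hl0 : 0 < l := by linarith
  have hτ₁0 : 0 < τ₁ := by linarith
  have hRm : R ∈ Icc 0 R := ⟨hR.le, le_rfl⟩
  obtain ⟨k, hk⟩ := (isCompact_Icc (a := (0:ℝ)) (b := τ₁)).exists_bound_of_continuousOn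
    (f := fun τ => l ^ 2 * ((β * (R + τ - t0)) ^ 2 - (R + ε) ^ 2) * (R + ε) / 2
      + l * (1 + β) * (R + ε) / 2 - (R + ε) * (κ * l * (3 * cpos β t0 ε R τ ^ 2))
      + l ^ 2 * κ * cpos β t0 ε R τ ^ 3 * (R + ε)) (by unfold cpos; fun_prop)
  obtain ⟨K, hK⟩ := (isCompact_Icc (a := (0:ℝ)) (b := τ₁)).exists_bound_of_continuousOn
    (f := fun τ => l * κ * cpos β t0 ε R τ ^ 3) (by unfold cpos; fun_prop)
  obtain ⟨Cb, hCb⟩ : ∃ Cb, Cb = (B + K) * (2 * (3 + 3 * l ^ 2 * B ^ 2)) + k + K + B := ⟨_, rfl⟩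
  have h0m : (0:ℝ) ∈ Icc 0 τ₁ := ⟨le_rfl, hτ₁0.le⟩
  have hK0 : 0 ≤ K := (norm_nonneg _).trans (hK 0 h0m)
  have hk0 : 0 ≤ k := (norm_nonneg _).trans (hk 0 h0m)
  have hCb0 : 0 < Cb := by rw [hCb]; positivity
  obtain ⟨A, hA⟩ : ∃ A, A = (1 / 4 + B ^ 4 / (16 * e)) * 2 := ⟨_, rfl⟩
  have hA0 : 0 < A := by rw [hA]; positivity
  have hEx : ∀ x ∈ Icc 0 R, ∀ τ ∈ Icc 0 τ₁, exp (-(l * B ^ 2)) ≤ exp (2 * l * cwt β t0 ε x τ) ∧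
      exp (2 * l * cwt β t0 ε x τ) ≤ exp (l * B ^ 2) := by
    intro x hx τ hτ
    obtain ⟨b1, b2, b3, b4, b5⟩ := hbox x hx
    obtain ⟨c1, c2⟩ := cwt_bounds (β := β) (ε := ε) hβ0.le hβ1.le
      (by linarith [hx.1]) b1 (b3 τ hτ).2
    have d1 := mul_le_mul_of_nonneg_left c1 hl0.le
    have d2 := mul_le_mul_of_nonneg_left c2 hl0.le
    constructor <;> apply exp_le_exp.2 <;> linarith
  obtain ⟨E, hE⟩ : ∃ E, E = exp (l * B ^ 2) := ⟨_, rfl⟩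
  obtain ⟨E', hE'⟩ : ∃ E', E' = exp (-(l * B ^ 2)) := ⟨_, rfl⟩
  have hE0 : 0 < E := by rw [hE]; exact exp_pos _
  have hE'0 : 0 < E' := by rw [hE']; exact exp_pos _
  rw [← hE, ← hE'] at hEx
  obtain ⟨m, hm⟩ : ∃ m, m = E' * (c / 8) := ⟨_, rfl⟩
  obtain ⟨D, hD⟩ : ∃ D, D = E * Cb * (2 + 6 * R ^ 2) := ⟨_, rfl⟩
  have hm0 : 0 < m := by rw [hm]; positivity
  have hD0 : 0 < D := by rw [hD]; positivity
  refine ⟨(E * A + D) / m, by positivity, ?_⟩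
  intro W g H P F hF hbd
  have cF : Continuous fun p : S2 × ℝ × ℝ => p.2.1 ^ 2 * F (chi p.2.1 p.2.2 p.1) ^ 2 :=
    ((continuous_fst.comp continuous_snd).pow 2).mul ((hF.comp continuous_chi₃).pow 2)
  have cJ : Continuous fun p : S2 × ℝ => jetSq W g (chi R p.2 p.1) := by
    refine P.continuous_jetSq.comp ?_
    unfold chi; fun_prop
  -- interior estimate
  have s1 : boxInt R τ₁ (fun θ x τ => dfluxX l β κ t0 ε W g H θ x τ + dfluxT l β κ t0 ε W g H θ x τ)
      ≤ E * A * boxInt R τ₁ (fun θ x τ => x ^ 2 * F (chi x τ θ) ^ 2) := by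
    have t1 := boxInt_mono hR.le hτ₁0.le
      (f₁ := fun θ x τ => dfluxX l β κ t0 ε W g H θ x τ + dfluxT l β κ t0 ε W g H θ x τ)
      (f₂ := fun θ x τ => angErr l β κ t0 ε W g H θ x τ + E * A * (x ^ 2 * F (chi x τ θ) ^ 2))
      ((P.continuous_dfluxX l β κ t0 ε).add (P.continuous_dfluxT l β κ t0 ε))
      ((P.continuous_angErr l β κ t0 ε).add (cF.const_mul (E * A)))
      (by
        intro θ x hx τ hτ
        have hx' : x ∈ Icc 0 R := ⟨hx.1.le, hx.2.le⟩
        have hτ' : τ ∈ Icc 0 τ₁ := ⟨hτ.1.le, hτ.2.le⟩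
        obtain ⟨b1, b2, b3, b4, b5⟩ := hbox x hx'
        rw [P.dflux_sum l β κ t0 ε hx.1.le hτ.1 (by linarith [hx.2, hτ.2]) θ]
        have hN : 0 ≤ ∑ k, g (chi x τ θ) (eX (rotGen k θ)) ^ 2 :=
          Finset.sum_nonneg fun _ _ => sq_nonneg _
        have key := carleman_pointwise (a := β * (x + τ - t0)) (b := x + ε) (x := x)
          (X := x * boxH (H (chi x τ θ))) (Q := rvt g θ x τ - l * (β * (x + τ - t0)) * rv W θ x τ)
          (S := rvx W g θ x τ - rvt g θ x τ + l * (x + ε) * rv W θ x τ) (v := rv W θ x τ)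
          (f := x ^ 2 * F (chi x τ θ) ^ 2) hβ0 hβ1 hκ (b3 τ hτ').1 (by linarith [hx.1])
          b1 hκB hl he b2
          hl2 hl1 hl3 hx.1.le (by linarith) hN (sq_box_le (hbd θ x hx τ hτ))
        have e1 := mul_le_mul_of_nonneg_left key (exp_pos (2 * l * cwt β t0 ε x τ)).le
        have e2 : exp (2 * l * cwt β t0 ε x τ) * (A * (x ^ 2 * F (chi x τ θ) ^ 2))
            ≤ E * (A * (x ^ 2 * F (chi x τ θ) ^ 2)) :=
          mul_le_mul_of_nonneg_right (hEx x hx' τ hτ').2 (by positivity)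
        refine add_le_add_right ?_ _
        refine e1.trans ?_
        rw [hA] at e2 ⊢
        linarith)
    refine t1.trans_eq ?_
    rw [boxInt_add (P.continuous_angErr l β κ t0 ε) (cF.const_mul (E * A)),
      boxInt_eq_zero hR.le hτ₁0.le (P.continuous_angErr l β κ t0 ε)
        (fun x hx τ hτ => P.integral_angErr l β κ t0 ε hx.1.le hτ.1 (by linarith [hx.2, hτ.2])),
      zero_add]
    simp only [boxInt, intervalIntegral.integral_const_mul, integral_const_mul]
  rw [boxInt_div hR.le hτ₁0.le (P.continuous_fluxX l β κ t0 ε) (P.continuous_fluxT l β κ t0 ε)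
    (P.continuous_dfluxX l β κ t0 ε) (P.continuous_dfluxT l β κ t0 ε)
    (fun θ x hx τ hτ => P.deriv_fluxX l β κ t0 ε hx.1.le hτ.1 (by linarith [hx.2, hτ.2]) θ)
    (fun θ x hx τ hτ => P.deriv_fluxT l β κ t0 ε hx.1.le hτ.1 (by linarith [hx.2, hτ.2]) θ)] at s1
  -- boundary estimate
  have cX (x : ℝ) : Continuous fun p : S2 × ℝ => fluxX l β κ t0 ε W g p.1 x p.2 :=
    (P.continuous_fluxX l β κ t0 ε).comp (f := fun p : S2 × ℝ => (p.1, x, p.2)) (by fun_prop)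
  have cT (τ : ℝ) : Continuous fun p : S2 × ℝ => fluxT l β κ t0 ε W g p.1 p.2 τ :=
    (P.continuous_fluxT l β κ t0 ε).comp (f := fun p : S2 × ℝ => (p.1, p.2, τ)) (by fun_prop)
  have cp : Continuous fun p : S2 × ℝ => rvx W g p.1 p.2 0 ^ 2 :=
    (P.continuous_rvx.comp (f := fun p : S2 × ℝ => (p.1, p.2, (0:ℝ))) (by fun_prop)).pow 2
  have sl {f : S2 × ℝ → ℝ} (hf : Continuous f) (θ : S2) : Continuous fun x => f (θ, x) :=
    hf.comp (by fun_prop)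
  have c1 : Continuous fun θ : S2 => ∫ τ in (0:ℝ)..τ₁, jetSq W g (chi R τ θ) :=
    continuous_integral_r cJ τ₁
  have c2 : Continuous fun θ : S2 => ∫ x in (0:ℝ)..R, rvx W g θ x 0 ^ 2 :=
    continuous_integral_r cp R
  have c3 : Continuous fun θ : S2 => ∫ τ in (0:ℝ)..τ₁,
      (fluxX l β κ t0 ε W g θ R τ - fluxX l β κ t0 ε W g θ 0 τ) :=
    continuous_integral_r ((cX R).sub (cX 0)) τ₁
  have c4 : Continuous fun θ : S2 => ∫ x in (0:ℝ)..R,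
      (fluxT l β κ t0 ε W g θ x τ₁ - fluxT l β κ t0 ε W g θ x 0) :=
    continuous_integral_r ((cT τ₁).sub (cT 0)) R
  have s2 : ∫ θ, ((-D) * (∫ τ in (0:ℝ)..τ₁, jetSq W g (chi R τ θ))
      + m * ∫ x in (0:ℝ)..R, rvx W g θ x 0 ^ 2) ∂sig ≤
      ∫ θ, ((∫ τ in (0:ℝ)..τ₁, (fluxX l β κ t0 ε W g θ R τ - fluxX l β κ t0 ε W g θ 0 τ))
      + ∫ x in (0:ℝ)..R, (fluxT l β κ t0 ε W g θ x τ₁ - fluxT l β κ t0 ε W g θ x 0)) ∂sig := by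
    refine integral_mono (S2.integrable ((c1.const_mul (-D)).add (c2.const_mul m)))
      (S2.integrable (c3.add c4)) fun θ => add_le_add ?_ ?_
    · rw [← intervalIntegral.integral_const_mul]
      refine intervalIntegral.integral_mono_on hτ₁0.le
        ((sl cJ θ).const_mul (-D) |>.intervalIntegrable _ _)
        (((sl (cX R) θ).sub (sl (cX 0) θ)).intervalIntegrable _ _) fun τ hτ => ?_
      have q1 := fluxX_zero_nonpos l β κ t0 ε hε.le W g θ τ
      obtain ⟨b1, b2, b3, b4, b5⟩ := hbox R hRm
      have q2 := neg_cflux₁_le (l := l) (β := β) (κ := κ) (a := β * (R + τ - t0)) (b := R + ε)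
        (η := cpos β t0 ε R τ ^ 3) (η1 := 3 * cpos β t0 ε R τ ^ 2) (v := rv W θ R τ)
        (p := rvx W g θ R τ) (q := rvt g θ R τ) (n := rang g θ R τ) hB.le (b3 τ hτ).1
        (by rwa [abs_of_pos (by linarith)]) (hk τ hτ) (hK τ hτ) (rang_nonneg g θ R τ)
      rw [← hCb] at q2
      have q3 := mul_le_mul_of_nonneg_left (jet_boundary_le (W := W) (g := g) (R := R) θ τ) hCb0.le
      have q4 := mul_le_mul_of_nonneg_left (q2.trans q3) (exp_pos (2 * l * cwt β t0 ε R τ)).le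
      have q5 := mul_le_mul_of_nonneg_right (hEx R hRm τ hτ).2
        (by have := jetSq_nonneg W g (chi R τ θ); positivity :
          0 ≤ Cb * ((2 + 6 * R ^ 2) * jetSq W g (chi R τ θ)))
      have q6 : fluxX l β κ t0 ε W g θ R τ = exp (2 * l * cwt β t0 ε R τ) * cflux₁ l β κ
        (β * (R + τ - t0)) (R + ε) (cpos β t0 ε R τ ^ 3) (3 * cpos β t0 ε R τ ^ 2) (rv W θ R τ)
        (rvx W g θ R τ) (rvt g θ R τ) (rang g θ R τ) := rfl
      rw [hD]
      linarith
    · rw [← intervalIntegral.integral_const_mul]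
      refine intervalIntegral.integral_mono_on hR.le
        ((sl cp θ).const_mul m |>.intervalIntegrable _ _)
        (((sl (cT τ₁) θ).sub (sl (cT 0) θ)).intervalIntegrable _ _) fun x hx => ?_
      obtain ⟨b1, b2, b3, b4, b5⟩ := hbox x hx
      have hxε : 0 < x + ε := by linarith [hx.1]
      have q1 : 0 ≤ fluxT l β κ t0 ε W g θ x τ₁ := by
        refine mul_nonneg (exp_pos _).le ?_
        exact cflux₂_nonneg hβ1 hβ0 hκ hxε (by linarith)
          ((le_abs_self _).trans (b3 τ₁ ⟨hτ₁0.le, le_rfl⟩).1) hκB hl hl4 (rang_nonneg g θ x τ₁)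
      have hα : β * (x + 0 - t0) = -(β * (t0 - x)) := by ring
      have q2 := le_neg_cflux₂ (v := rv W θ x 0) (p := rvx W g θ x 0) hβ1 hβ0 hκ hxε
        (by linarith : x + ε ≤ β * (t0 - x)) (by
          have := (neg_le_abs _).trans (b3 0 h0m).1
          rwa [hα, neg_neg] at this) hκB hl hl4 (rang_nonneg g θ x 0)
      have q3 : c / 8 * rvx W g θ x 0 ^ 2 ≤ (β * (t0 - x) - (x + ε)) / 8 * rvx W g θ x 0 ^ 2 :=
        mul_le_mul_of_nonneg_right (by linarith) (sq_nonneg _)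
      have q4 := mul_le_mul_of_nonneg_left (q3.trans q2) (exp_pos (2 * l * cwt β t0 ε x 0)).le
      have q5 := mul_le_mul_of_nonneg_right (hEx x hx 0 h0m).1
        (by positivity : 0 ≤ c / 8 * rvx W g θ x 0 ^ 2)
      have q6 : fluxT l β κ t0 ε W g θ x 0 = exp (2 * l * cwt β t0 ε x 0) * cflux₂ l β κ
          (-(β * (t0 - x))) (x + ε) ((max ((-(β * (t0 - x))) ^ 2 - (x + ε) ^ 2) 0) ^ 3)
          (3 * (max ((-(β * (t0 - x))) ^ 2 - (x + ε) ^ 2) 0) ^ 2) (rv W θ x 0)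
          (rvx W g θ x 0) (rang g θ x 0) := by
        simp only [fluxT, cpos, hα]
      rw [hm]
      linarith
  rw [integral_add (S2.integrable (c1.const_mul (-D))) (S2.integrable (c2.const_mul m)),
    integral_const_mul, integral_const_mul] at s2
  have hbF : 0 ≤ boxInt R τ₁ (fun θ x τ => x ^ 2 * F (chi x τ θ) ^ 2) := by
    refine integral_nonneg fun θ => ?_
    refine intervalIntegral.integral_nonneg hR.le fun x _ => ?_
    exact intervalIntegral.integral_nonneg hτ₁0.le fun τ _ => by positivity
  have hJ : 0 ≤ ∫ θ : S2, (∫ τ in (0:ℝ)..τ₁, jetSq W g (chi R τ θ)) ∂sig :=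
    integral_nonneg fun θ => intervalIntegral.integral_nonneg hτ₁0.le fun τ _ => jetSq_nonneg _ _ _
  rw [div_mul_eq_mul_div, le_div_iff₀ hm0]
  have z1 := mul_nonneg hD0.le hbF
  have z2 := mul_nonneg (mul_nonneg hE0.le hA0.le) hJ
  linarith

theorem boxInt_congr {X Y : ℝ} {f₁ f₂ : S2 → ℝ → ℝ → ℝ} (hX : 0 ≤ X) (hY : 0 ≤ Y)
    (h₁ : Continuous fun p : S2 × ℝ × ℝ => f₁ p.1 p.2.1 p.2.2)
    (h₂ : Continuous fun p : S2 × ℝ × ℝ => f₂ p.1 p.2.1 p.2.2)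
    (h : ∀ θ, ∀ x ∈ Ioo 0 X, ∀ τ ∈ Ioo 0 Y, f₁ θ x τ = f₂ θ x τ) :
    boxInt X Y f₁ = boxInt X Y f₂ :=
  le_antisymm (boxInt_mono hX hY h₁ h₂ fun θ x hx τ hτ => (h θ x hx τ hτ).le)
    (boxInt_mono hX hY h₂ h₁ fun θ x hx τ hτ => (h θ x hx τ hτ).ge)

section Green
variable {ρ : ℝ} {W W₂ : E3 × ℝ → ℝ} {g g₂ : E3 × ℝ → (E3 × ℝ →L[ℝ] ℝ)}
  {H H₂ : E3 × ℝ → (E3 × ℝ →L[ℝ] E3 × ℝ →L[ℝ] ℝ)}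

/-- Along the characteristic cone, `rvx` is the derivative of `rv`. -/
theorem Pack.deriv_rv_zero (P : Pack ρ W g H) {x : ℝ} (hx : 0 < x) (h : x < ρ) (θ : S2) :
    HasDerivAt (fun x => rv W θ x 0) (rvx W g θ x 0) x := by
  have hm : ∀ y ∈ Ioo 0 ρ, chi y 0 θ ∈ Dcone ρ := fun y hy => by
    refine mem_Dcone_of_le ?_ ?_ <;> rw [norm_chi_fst hy.1.le, chi_snd] <;> linarith [hy.2]
  have d := (P.dW' _ (hm x ⟨hx, h⟩)).comp_hasDerivWithinAt (f := fun y => chi y 0 θ) x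
    ((hasDerivAt_chi_r x 0 θ).hasDerivWithinAt (s := Ioo 0 ρ)) hm
  have d' := d.hasDerivAt (Ioo_mem_nhds hx h)
  refine ((hasDerivAt_id x).mul d').congr_deriv ?_
  simp [rvx]

theorem continuous_boxH : Continuous (boxH : (E3 × ℝ →L[ℝ] E3 × ℝ →L[ℝ] ℝ) → ℝ) := by
  unfold boxH; fun_prop

theorem Pack.green (P : Pack ρ W g H) (P₂ : Pack ρ W₂ g₂ H₂) {c : ℝ} (hc0 : 0 < c)
    (hc : c < 2 * ρ) (h0 : ∀ p : E3 × ℝ, c ≤ ‖p.1‖ + p.2 → W₂ p = 0 ∧ g₂ p = 0 ∧ H₂ p = 0) :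
    boxInt c c (fun θ x τ => x ^ 2 * (W (chi x τ θ) * boxH (H₂ (chi x τ θ))
      - W₂ (chi x τ θ) * boxH (H (chi x τ θ))))
    = ∫ θ, (∫ x in (0:ℝ)..c, 2 * (rv W₂ θ x 0 * rvx W g θ x 0)) ∂sig := by
  have hz : ∀ (θ : S2) (x τ : ℝ), 0 ≤ x → c ≤ 2 * x + τ → W₂ (chi x τ θ) = 0 ∧
      g₂ (chi x τ θ) = 0 ∧ H₂ (chi x τ θ) = 0 := fun θ x τ hx h => by
    refine h0 _ ?_
    rw [norm_chi_fst hx, chi_snd]; linarith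
  have hz' : ∀ (θ : S2) (x τ : ℝ), 0 ≤ x → c ≤ 2 * x + τ → rv W₂ θ x τ = 0 ∧
      rvx W₂ g₂ θ x τ = 0 ∧ rvt g₂ θ x τ = 0 ∧ rvxx g₂ H₂ θ x τ = 0 ∧ rvxt g₂ H₂ θ x τ = 0 :=
    fun θ x τ hx h => by
      obtain ⟨a1, a2, a3⟩ := hz θ x τ hx h
      simp [rv, rvx, rvt, rvxx, rvxt, a1, a2, a3]
  have cv := P.continuous_rv
  have cx := P.continuous_rvx
  have ct := P.continuous_rvt
  have cxx := P.continuous_rvxx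
  have cxt := P.continuous_rvxt
  have cv2 := P₂.continuous_rv
  have cx2 := P₂.continuous_rvx
  have ct2 := P₂.continuous_rvt
  have cxx2 := P₂.continuous_rvxx
  have cxt2 := P₂.continuous_rvxt
  have cA := P.continuous_angTerm
  have cA2 := P₂.continuous_angTerm
  have cW := P.continuous_W₃
  have cW2 := P₂.continuous_W₃
  have cB := continuous_boxH.comp (P.cH.comp continuous_chi₃)
  have cB2 := continuous_boxH.comp (P₂.cH.comp continuous_chi₃)
  have c1 : Continuous fun p : S2 × ℝ × ℝ => p.2.1 := by fun_prop
  have hdiv := boxInt_div (X := c) (Y := c) hc0.le hc0.le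
    (K₁ := fun θ x τ => rv W θ x τ * rvt g₂ θ x τ - rv W₂ θ x τ * rvt g θ x τ
      - rv W θ x τ * rvx W₂ g₂ θ x τ + rv W₂ θ x τ * rvx W g θ x τ)
    (K₂ := fun θ x τ => rv W θ x τ * rvx W₂ g₂ θ x τ - rv W₂ θ x τ * rvx W g θ x τ)
    (D₁ := fun θ x τ => (rvx W g θ x τ * rvt g₂ θ x τ + rv W θ x τ * rvxt g₂ H₂ θ x τ)
      - (rvx W₂ g₂ θ x τ * rvt g θ x τ + rv W₂ θ x τ * rvxt g H θ x τ)
      - (rvx W g θ x τ * rvx W₂ g₂ θ x τ + rv W θ x τ * rvxx g₂ H₂ θ x τ)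
      + (rvx W₂ g₂ θ x τ * rvx W g θ x τ + rv W₂ θ x τ * rvxx g H θ x τ))
    (D₂ := fun θ x τ => (rvt g θ x τ * rvx W₂ g₂ θ x τ + rv W θ x τ * rvxt g₂ H₂ θ x τ)
      - (rvt g₂ θ x τ * rvx W g θ x τ + rv W₂ θ x τ * rvxt g H θ x τ))
    ((((cv.mul ct2).sub (cv2.mul ct)).sub (cv.mul cx2)).add (cv2.mul cx))
    ((cv.mul cx2).sub (cv2.mul cx))
    (((((cx.mul ct2).add (cv.mul cxt2)).sub ((cx2.mul ct).add (cv2.mul cxt))).sub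
      ((cx.mul cx2).add (cv.mul cxx2))).add ((cx2.mul cx).add (cv2.mul cxx)))
    (((ct.mul cx2).add (cv.mul cxt2)).sub ((ct2.mul cx).add (cv2.mul cxt)))
    (by
      intro θ x hx τ hτ
      rcases lt_or_ge (2 * x + τ) (2 * ρ) with h | h
      · exact ((((P.deriv_rv_x hx.1.le hτ.1 h θ).mul (P₂.deriv_rvt_x hx.1.le hτ.1 h θ)).sub
          ((P₂.deriv_rv_x hx.1.le hτ.1 h θ).mul (P.deriv_rvt_x hx.1.le hτ.1 h θ))).sub
          ((P.deriv_rv_x hx.1.le hτ.1 h θ).mul (P₂.deriv_rvx_x hx.1.le hτ.1 h θ))).add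
          ((P₂.deriv_rv_x hx.1.le hτ.1 h θ).mul (P.deriv_rvx_x hx.1.le hτ.1 h θ))
      · obtain ⟨a1, a2, a3, a4, a5⟩ := hz' θ x τ hx.1.le (by linarith)
        refine ((hasDerivAt_const x (0:ℝ)).congr_of_eventuallyEq ?_).congr_deriv ?_
        · filter_upwards [Ioi_mem_nhds hx.1,
            Ioi_mem_nhds (show (c - τ) / 2 < x by linarith)] with y hy hy'
          obtain ⟨a1, a2, a3, a4, a5⟩ := hz' θ y τ (le_of_lt hy)
            (by have := mem_Ioi.1 hy'; linarith)
          simp [a1, a2, a3]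
        · simp [a1, a2, a3, a4, a5])
    (by
      intro θ x hx τ hτ
      rcases lt_or_ge (2 * x + τ) (2 * ρ) with h | h
      · exact ((P.deriv_rv_t hx.1.le hτ.1 h θ).mul (P₂.deriv_rvx_t hx.1.le hτ.1 h θ)).sub
          ((P₂.deriv_rv_t hx.1.le hτ.1 h θ).mul (P.deriv_rvx_t hx.1.le hτ.1 h θ))
      · obtain ⟨a1, a2, a3, a4, a5⟩ := hz' θ x τ hx.1.le (by linarith)
        refine ((hasDerivAt_const τ (0:ℝ)).congr_of_eventuallyEq ?_).congr_deriv ?_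
        · filter_upwards [Ioi_mem_nhds (show c - 2 * x < τ by linarith)] with y hy
          obtain ⟨a1, a2, a3, a4, a5⟩ := hz' θ x y hx.1.le (by have := mem_Ioi.1 hy; linarith)
          simp [a1, a2]
        · simp [a1, a2, a3, a5])
  have cM : Continuous fun p : S2 × ℝ × ℝ => p.2.1 ^ 2 * (W (chi p.2.1 p.2.2 p.1) *
      boxH (H₂ (chi p.2.1 p.2.2 p.1)) -
        W₂ (chi p.2.1 p.2.2 p.1) * boxH (H (chi p.2.1 p.2.2 p.1))) :=
    (c1.pow 2).mul ((cW.mul cB2).sub (cW2.mul cB))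
  have cE : Continuous fun p : S2 × ℝ × ℝ => -p.2.1 * (angTerm p.2.1 p.1 (g (chi p.2.1 p.2.2 p.1))
      (H (chi p.2.1 p.2.2 p.1)) * W₂ (chi p.2.1 p.2.2 p.1) - W (chi p.2.1 p.2.2 p.1) *
      angTerm p.2.1 p.1 (g₂ (chi p.2.1 p.2.2 p.1)) (H₂ (chi p.2.1 p.2.2 p.1))) :=
    c1.neg.mul ((cA.mul cW2).sub (cW.mul cA2))
  have hE : boxInt c c (fun θ x τ => -x *
      (angTerm x θ (g (chi x τ θ)) (H (chi x τ θ)) * W₂ (chi x τ θ)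
      - W (chi x τ θ) * angTerm x θ (g₂ (chi x τ θ)) (H₂ (chi x τ θ)))) = 0 := by
    refine boxInt_eq_zero hc0.le hc0.le cE fun x hx τ hτ => ?_
    rw [integral_const_mul]
    rcases lt_or_ge (2 * x + τ) (2 * ρ) with h | h
    · rw [P.integral_angular_symm P₂ hx.1.le hτ.1 h, mul_zero]
    · refine mul_eq_zero_of_right _ ?_
      rw [← integral_zero S2 ℝ (μ := sig)]
      congr 1; ext θ
      obtain ⟨a1, a2, a3⟩ := hz θ x τ hx.1.le (by linarith)
      simp [a1, a2, a3, angTerm]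
  have hadd := boxInt_add (X := c) (Y := c)
    (f₁ := fun θ x τ => x ^ 2 * (W (chi x τ θ) * boxH (H₂ (chi x τ θ))
      - W₂ (chi x τ θ) * boxH (H (chi x τ θ))))
    (f₂ := fun θ x τ => -x * (angTerm x θ (g (chi x τ θ)) (H (chi x τ θ)) * W₂ (chi x τ θ)
      - W (chi x τ θ) * angTerm x θ (g₂ (chi x τ θ)) (H₂ (chi x τ θ)))) cM cE
  rw [hE, add_zero] at hadd
  rw [← hadd]
  refine (boxInt_congr hc0.le hc0.le (cM.add cE) ?_ ?_).trans (hdiv.trans ?_)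
  · exact (((((cx.mul ct2).add (cv.mul cxt2)).sub ((cx2.mul ct).add (cv2.mul cxt))).sub
      ((cx.mul cx2).add (cv.mul cxx2))).add ((cx2.mul cx).add (cv2.mul cxx))).add
      (((ct.mul cx2).add (cv.mul cxt2)).sub ((ct2.mul cx).add (cv2.mul cxt)))
  · intro θ x hx τ hτ
    rcases lt_or_ge (2 * x + τ) (2 * ρ) with h | h
    · obtain ⟨h1, h2⟩ := chi_mem hx.1.le hτ.1 h θ
      have b1 := box_identity x θ (g (chi x τ θ)) (H (chi x τ θ)) (P.symm _ h1 h2)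
      have b2 := box_identity x θ (g₂ (chi x τ θ)) (H₂ (chi x τ θ)) (P₂.symm _ h1 h2)
      simp only [rv, rvx, rvt, rvxx, rvxt]
      linear_combination (-x * W (chi x τ θ)) * b2 + (x * W₂ (chi x τ θ)) * b1
    · obtain ⟨a1, a2, a3, a4, a5⟩ := hz' θ x τ hx.1.le (by linarith)
      obtain ⟨e1, e2, e3⟩ := hz θ x τ hx.1.le (by linarith)
      simp [a1, a2, a3, a4, a5, e1, e2, e3, boxH, angTerm]
  · congr 1; ext θ
    have k1 : ∀ τ ∈ uIcc 0 c, rv W θ c τ * rvt g₂ θ c τ - rv W₂ θ c τ * rvt g θ c τ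
      - rv W θ c τ * rvx W₂ g₂ θ c τ + rv W₂ θ c τ * rvx W g θ c τ -
      (rv W θ 0 τ * rvt g₂ θ 0 τ - rv W₂ θ 0 τ * rvt g θ 0 τ
      - rv W θ 0 τ * rvx W₂ g₂ θ 0 τ + rv W₂ θ 0 τ * rvx W g θ 0 τ) = 0 := fun τ hτ => by
      rw [uIcc_of_le hc0.le] at hτ
      obtain ⟨a1, a2, a3, a4, a5⟩ := hz' θ c τ hc0.le (by linarith [hτ.1])
      rw [a1, a2, a3]
      simp [rv]
    have k2 : ∀ x ∈ uIcc 0 c, rv W θ x c * rvx W₂ g₂ θ x c - rv W₂ θ x c * rvx W g θ x c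
        - (rv W θ x 0 * rvx W₂ g₂ θ x 0 - rv W₂ θ x 0 * rvx W g θ x 0)
        = 2 * (rv W₂ θ x 0 * rvx W g θ x 0)
          - (rvx W g θ x 0 * rv W₂ θ x 0 + rv W θ x 0 * rvx W₂ g₂ θ x 0) := fun x hx => by
      rw [uIcc_of_le hc0.le] at hx
      obtain ⟨a1, a2, a3, a4, a5⟩ := hz' θ x c hx.1 (by linarith [hx.1])
      rw [a1, a2]; ring
    have sl {f : S2 → ℝ → ℝ → ℝ} (hf : Continuous fun p : S2 × ℝ × ℝ => f p.1 p.2.1 p.2.2) :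
        Continuous fun x => f θ x 0 := hf.comp (f := fun x : ℝ => (θ, x, (0:ℝ))) (by fun_prop)
    have k3 : ∫ x in (0:ℝ)..c, (rvx W g θ x 0 * rv W₂ θ x 0 +
        rv W θ x 0 * rvx W₂ g₂ θ x 0) = 0 := by
      rw [intervalIntegral.integral_eq_sub_of_hasDerivAt_of_le
        (f := fun x => rv W θ x 0 * rv W₂ θ x 0)
        hc0.le ((sl cv).mul (sl cv2)).continuousOn]
      · obtain ⟨a1, a2, a3, a4, a5⟩ := hz' θ c 0 hc0.le (by linarith)
        rw [a1]; simp [rv]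
      · intro x hx
        rcases lt_or_ge x ρ with h | h
        · exact (P.deriv_rv_zero hx.1 h θ).mul (P₂.deriv_rv_zero hx.1 h θ)
        · obtain ⟨a1, a2, a3, a4, a5⟩ := hz' θ x 0 hx.1.le (by linarith)
          refine ((hasDerivAt_const x (0:ℝ)).congr_of_eventuallyEq ?_).congr_deriv ?_
          · filter_upwards [Ioi_mem_nhds hx.1,
              Ioi_mem_nhds (show c / 2 < x by linarith)] with y hy hy'
            obtain ⟨a1, a2, a3, a4, a5⟩ := hz' θ y 0 (le_of_lt hy)
              (by have := mem_Ioi.1 hy'; linarith)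
            simp [a1]
          · simp [a1, a2]
      · exact (((sl cx).mul (sl cv2)).add ((sl cv).mul (sl cx2))).intervalIntegrable _ _
    have i1 : IntervalIntegrable (fun x => 2 * (rv W₂ θ x 0 * rvx W g θ x 0)) volume 0 c :=
      (((sl cv2).mul (sl cx)).const_mul 2).intervalIntegrable _ _
    have i2 : IntervalIntegrable (fun x => rvx W g θ x 0 * rv W₂ θ x 0
        + rv W θ x 0 * rvx W₂ g₂ θ x 0) volume 0 c :=
      (((sl cx).mul (sl cv2)).add ((sl cv).mul (sl cx2))).intervalIntegrable _ _
    rw [intervalIntegral.integral_congr k1, intervalIntegral.integral_congr k2,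
      intervalIntegral.integral_sub i1 i2, k3, intervalIntegral.integral_zero, zero_add, sub_zero]

end Green

/-- The regularized distance `√(|y|² + ε²)`. -/
def rdist (ε : ℝ) (y : E3) : ℝ := √(‖y‖ ^ 2 + ε ^ 2)

theorem rdist_sq (ε : ℝ) (y : E3) : rdist ε y ^ 2 = ‖y‖ ^ 2 + ε ^ 2 := sq_sqrt (by positivity)

theorem rdist_pos {ε : ℝ} (hε : 0 < ε) (y : E3) : 0 < rdist ε y := sqrt_pos.2 (by positivity)

theorem norm_le_rdist (ε : ℝ) (y : E3) : ‖y‖ ≤ rdist ε y :=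
  le_sqrt_of_sq_le (by nlinarith [sq_nonneg ε])

theorem rdist_le {ε : ℝ} (hε : 0 ≤ ε) (y : E3) : rdist ε y ≤ ‖y‖ + ε :=
  sqrt_le_iff.2 ⟨by positivity, by nlinarith [norm_nonneg y]⟩

theorem continuous_rdist (ε : ℝ) : Continuous (rdist ε) := by unfold rdist; fun_prop

/-- The kernel obtained by applying the wave operator to the regularized fundamental solution. -/
def regKer (ε k a b c : ℝ) : ℝ := ε ^ 2 * (a / k ^ 3 + 3 * b / k ^ 4 + 3 * c / k ^ 5)

theorem regKer_le_neg {ε k a b c N m : ℝ} (hk : 0 < k) (ha : |a| ≤ N) (hb : |b| ≤ N)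
    (hc : c ≤ -m) (hkm : N * k ^ 2 + 3 * N * k ≤ 2 * m) :
    regKer ε k a b c ≤ -(m * ε ^ 2 / k ^ 5) := by
  have e : regKer ε k a b c = ε ^ 2 * (a * k ^ 2 + 3 * b * k + 3 * c) / k ^ 5 := by
    unfold regKer; field_simp
  have h1 := (abs_le.1 ha).2
  have h2 := (abs_le.1 hb).2
  rw [e, ← neg_div]
  gcongr
  have h3 : a * k ^ 2 + 3 * b * k + 3 * c ≤ -m := by
    nlinarith [mul_le_mul_of_nonneg_right h1 (sq_nonneg k), mul_le_mul_of_nonneg_right h2 hk.le]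
  nlinarith [mul_le_mul_of_nonneg_left h3 (sq_nonneg ε)]

theorem regKer_le {ε k a b c N η : ℝ} (hη : 0 < η) (hk : η ≤ k) (ha : |a| ≤ N) (hb : |b| ≤ N)
    (hc : |c| ≤ N) :
    regKer ε k a b c ≤ ε ^ 2 * (N / η ^ 3 + 3 * N / η ^ 4 + 3 * N / η ^ 5) := by
  have hN : 0 ≤ N := (abs_nonneg _).trans ha
  have h1 := (abs_le.1 ha).2
  have h2 := (abs_le.1 hb).2
  have h3 := (abs_le.1 hc).2
  have hk0 : 0 < k := hη.trans_le hk
  unfold regKer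
  have e1 : a / k ^ 3 ≤ N / η ^ 3 := by gcongr
  have e2 : 3 * b / k ^ 4 ≤ 3 * N / η ^ 4 := by gcongr
  have e3 : 3 * c / k ^ 5 ≤ 3 * N / η ^ 5 := by gcongr
  exact mul_le_mul_of_nonneg_left (by linarith) (sq_nonneg ε)

theorem nonneg_of_integral_regKer_nonneg {c : ℝ} {x₀ : E3} (hx₀ : ‖x₀‖ < c) {G₀ G₁ G₂ : E3 × ℝ → ℝ}
    (h₀ : Continuous G₀) (h₁ : Continuous G₁) (h₂ : Continuous G₂)
    (h : ∀ ε > 0, 0 ≤ ∫ y in closedBall (0:E3) c, regKer ε (rdist ε (y - x₀))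
      (G₂ (y, rdist ε (y - x₀))) (G₁ (y, rdist ε (y - x₀))) (G₀ (y, rdist ε (y - x₀)))) :
    0 ≤ G₀ (x₀, 0) := by
  by_contra! hneg
  obtain ⟨m, hm⟩ : ∃ m, m = -G₀ (x₀, 0) / 2 := ⟨_, rfl⟩
  have hm0 : 0 < m := by rw [hm]; linarith
  have hev : ∀ᶠ p in nhds (x₀, (0:ℝ)), G₀ p < -m :=
    h₀.continuousAt.eventually_lt continuousAt_const (by rw [hm]; linarith)
  obtain ⟨η₁, hη₁, hη₁'⟩ := Metric.eventually_nhds_iff.1 hev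
  have hc0 : 0 < c := (norm_nonneg _).trans_lt hx₀
  have hK : IsCompact (closedBall (0:E3) c ×ˢ Icc (0:ℝ) (2 * c + 1)) :=
    (isCompact_closedBall _ _).prod isCompact_Icc
  obtain ⟨N₀, hN₀⟩ := hK.exists_bound_of_continuousOn h₀.continuousOn
  obtain ⟨N₁, hN₁⟩ := hK.exists_bound_of_continuousOn h₁.continuousOn
  obtain ⟨N₂, hN₂⟩ := hK.exists_bound_of_continuousOn h₂.continuousOn
  obtain ⟨N, hN⟩ : ∃ N, N = |N₀| + |N₁| + |N₂| := ⟨_, rfl⟩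
  have hN0 : 0 ≤ N := by rw [hN]; positivity
  have a0 := abs_nonneg N₀
  have a1 := abs_nonneg N₁
  have a2 := abs_nonneg N₂
  have b0 := le_abs_self N₀
  have b1 := le_abs_self N₁
  have b2 := le_abs_self N₂
  obtain ⟨η, hη⟩ : ∃ η, η = min (η₁ / 3) (min (1 / 2) (m / (4 * (N + 1)))) := ⟨_, rfl⟩
  have hη0 : 0 < η := by rw [hη]; positivity
  have hη1 : η ≤ η₁ / 3 := by rw [hη]; exact min_le_left _ _
  have hη2 : η ≤ 1 / 2 := by rw [hη]; exact (min_le_right _ _).trans (min_le_left _ _)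
  have hη3 : η ≤ m / (4 * (N + 1)) := by rw [hη]; exact (min_le_right _ _).trans (min_le_right _ _)
  rw [le_div_iff₀ (by positivity)] at hη3
  obtain ⟨C, hC⟩ : ∃ C, C = N / η ^ 3 + 3 * N / η ^ 4 + 3 * N / η ^ 5 := ⟨_, rfl⟩
  have hC0 : 0 ≤ C := by rw [hC]; positivity
  have key : ∀ ε > 0, ε ≤ η → ∀ y ∈ closedBall (0:E3) c,
      regKer ε (rdist ε (y - x₀)) (G₂ (y, rdist ε (y - x₀))) (G₁ (y, rdist ε (y - x₀)))
        (G₀ (y, rdist ε (y - x₀))) ≤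
      ε ^ 2 * C - (closedBall x₀ ε).indicator (fun _ => m / 32 / ε ^ 3) y := by
    intro ε hε hεη y hy
    have hk := rdist_pos hε (y - x₀)
    have hk1 := norm_le_rdist ε (y - x₀)
    have hk2 := rdist_le hε.le (y - x₀)
    have hyn : ‖y‖ ≤ c := by simpa using hy
    have hyx : ‖y - x₀‖ ≤ 2 * c := (norm_sub_le _ _).trans (by linarith)
    have hmem : (y, rdist ε (y - x₀)) ∈ closedBall (0:E3) c ×ˢ Icc (0:ℝ) (2 * c + 1) :=
      ⟨hy, hk.le, by linarith⟩
    have n0 : |G₀ (y, rdist ε (y - x₀))| ≤ N := (hN₀ _ hmem).trans (by linarith)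
    have n1 : |G₁ (y, rdist ε (y - x₀))| ≤ N := (hN₁ _ hmem).trans (by linarith)
    have n2 : |G₂ (y, rdist ε (y - x₀))| ≤ N := (hN₂ _ hmem).trans (by linarith)
    rcases le_or_gt ‖y - x₀‖ η with hn | hn
    · have hG : G₀ (y, rdist ε (y - x₀)) ≤ -m := by
        refine (hη₁' ?_).le
        rw [Prod.dist_eq, max_lt_iff, dist_eq_norm, dist_eq_norm, sub_zero, norm_of_nonneg hk.le]
        constructor <;> linarith
      have hk1' : rdist ε (y - x₀) ≤ 1 := by linarith
      have e1 := regKer_le_neg (ε := ε) hk n2 n1 hG (by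
        nlinarith [mul_nonneg hN0 hk.le, mul_nonneg (mul_nonneg hN0 hk.le) (sub_nonneg.2 hk1'),
          mul_le_mul_of_nonneg_left (show rdist ε (y - x₀) ≤ 2 * η by linarith) hN0])
      refine e1.trans ?_
      by_cases hb : y ∈ closedBall x₀ ε
      · rw [indicator_of_mem hb]
        rw [mem_closedBall, dist_eq_norm] at hb
        have : m / 32 / ε ^ 3 ≤ m * ε ^ 2 / rdist ε (y - x₀) ^ 5 := by
          calc m / 32 / ε ^ 3 = m * ε ^ 2 / (2 * ε) ^ 5 := by field_simp; norm_num
            _ ≤ _ := by gcongr; linarith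
        have := mul_nonneg (sq_nonneg ε) hC0
        linarith
      · rw [indicator_of_notMem hb]
        have : 0 ≤ m * ε ^ 2 / rdist ε (y - x₀) ^ 5 := by positivity
        have := mul_nonneg (sq_nonneg ε) hC0
        linarith
    · rw [indicator_of_notMem (by rw [mem_closedBall, dist_eq_norm]; linarith), sub_zero, hC]
      exact regKer_le hη0 (hn.le.trans hk1) n2 n1 n0
  obtain ⟨v, hv⟩ : ∃ v, v = volume.real (ball (0:E3) 1) := ⟨_, rfl⟩
  have hv0 : 0 < v := by
    rw [hv]
    exact ENNReal.toReal_pos (measure_ball_pos _ _ one_pos).ne' measure_ball_lt_top.ne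
  obtain ⟨V, hV⟩ : ∃ V, V = volume.real (closedBall (0:E3) c) := ⟨_, rfl⟩
  have hV0 : 0 ≤ V := by rw [hV]; exact measureReal_nonneg
  have main : ∀ ε > 0, ε ≤ η → ε ≤ c - ‖x₀‖ → m / 32 * v ≤ ε ^ 2 * C * V := by
    intro ε hε hεη hεc
    have hcr : Continuous fun y => rdist ε (y - x₀) := (continuous_rdist ε).comp (by fun_prop)
    have hne : ∀ y n, rdist ε (y - x₀) ^ n ≠ 0 := fun y n => pow_ne_zero _ (rdist_pos hε _).ne'
    have i1 : IntegrableOn (fun y => regKer ε (rdist ε (y - x₀))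
      (G₂ (y, rdist ε (y - x₀))) (G₁ (y, rdist ε (y - x₀))) (G₀ (y, rdist ε (y - x₀))))
        (closedBall (0:E3) c) := by
      refine ContinuousOn.integrableOn_compact (isCompact_closedBall _ _)
        (Continuous.continuousOn ?_)
      have hpair : Continuous fun y => (y, rdist ε (y - x₀)) := continuous_id.prodMk hcr
      have q0 := h₀.comp hpair
      have q1 := h₁.comp hpair
      have q2 := h₂.comp hpair
      exact continuous_const.mul (((q2.div (hcr.pow 3) fun y => hne y 3).add
        ((continuous_const.mul q1).div (hcr.pow 4) fun y => hne y 4)).add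
        ((continuous_const.mul q0).div (hcr.pow 5) fun y => hne y 5))
    have i2 : IntegrableOn (fun _ : E3 => ε ^ 2 * C) (closedBall (0:E3) c) :=
      integrableOn_const (measure_closedBall_lt_top.ne)
    have i3 : IntegrableOn ((closedBall x₀ ε).indicator (fun _ : E3 => m / 32 / ε ^ 3))
        (closedBall (0:E3) c) :=
      (integrableOn_const (measure_closedBall_lt_top.ne)).indicator measurableSet_closedBall
    have e := (h ε hε).trans (setIntegral_mono_on i1 (i2.sub i3) measurableSet_closedBall
      (key ε hε hεη))
    have hsub : closedBall (0:E3) c ∩ closedBall x₀ ε = closedBall x₀ ε :=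
      inter_eq_right.2 (closedBall_subset_closedBall' (by rw [dist_zero_right]; linarith))
    simp only [Pi.sub_apply] at e
    rw [integral_sub i2 i3, setIntegral_indicator measurableSet_closedBall, hsub, setIntegral_const,
      setIntegral_const, Measure.addHaar_real_closedBall _ _ hε.le, ← hv, ← hV] at e
    simp only [smul_eq_mul, finrank_euclideanSpace, Fintype.card_fin] at e
    have : ε ^ 3 * v * (m / 32 / ε ^ 3) = m / 32 * v := by field_simp
    rw [this] at e
    linarith
  obtain ⟨ε, hε⟩ : ∃ ε, ε = min (min η (c - ‖x₀‖)) (m / 64 * v / (C * V + 1)) := ⟨_, rfl⟩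
  have hCV : 0 ≤ C * V := mul_nonneg hC0 hV0
  have hε0 : 0 < ε := by
    rw [hε]
    exact lt_min (lt_min hη0 (by linarith)) (by positivity)
  have hε1 : ε ≤ η := by rw [hε]; exact (min_le_left _ _).trans (min_le_left _ _)
  have hε2 : ε ≤ c - ‖x₀‖ := by rw [hε]; exact (min_le_left _ _).trans (min_le_right _ _)
  have hε3 : ε ≤ m / 64 * v / (C * V + 1) := by rw [hε]; exact min_le_right _ _
  rw [le_div_iff₀ (by positivity)] at hε3
  have := main ε hε0 hε1 hε2
  have hmv := mul_pos hm0 hv0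
  nlinarith [mul_nonneg hε0.le hCV, mul_nonneg (mul_nonneg hε0.le hCV) (show 0 ≤ 1 - ε by linarith)]

section Goursat

open scoped ContDiff

/-- Regularization of the retarded-type test function `h(t₀ - t - |x - x₀|) / |x - x₀|`. -/
def regTest (h : ℝ → ℝ) (ε : ℝ) (x₀ : E3) (t₀ : ℝ) (p : E3 × ℝ) : ℝ :=
  h (t₀ - p.2 - rdist ε (p.1 - x₀)) / rdist ε (p.1 - x₀)

theorem Pack.of_contDiff {W : E3 × ℝ → ℝ} (hW : ContDiff ℝ ∞ W) (ρ : ℝ) :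
    Pack ρ W (fderiv ℝ W) (fderiv ℝ (fderiv ℝ W)) := by
  have h1 : ContDiff ℝ ∞ (fderiv ℝ W) := hW.fderiv_right (by simp)
  have h2 : ContDiff ℝ ∞ (fderiv ℝ (fderiv ℝ W)) := h1.fderiv_right (by simp)
  have d (p : E3 × ℝ) : HasFDerivAt W (fderiv ℝ W p) p :=
    (hW.differentiable (by simp) p).hasFDerivAt
  exact
    { cW := hW.continuous
      cg := h1.continuous
      cH := h2.continuous
      dW := fun p _ _ => d p
      dg := fun p _ _ => (h1.differentiable (by simp) p).hasFDerivAt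
      symm := fun p _ _ v w => (hW.contDiffAt.isSymmSndFDerivAt
        (by rw [minSmoothness_of_isRCLikeNormedField]; exact WithTop.coe_le_coe.2 le_top)) v w
      dW' := fun p _ => (d p).hasFDerivWithinAt }

section RegTest
variable {h : ℝ → ℝ} {ε : ℝ} {x₀ : E3} {t₀ : ℝ}

theorem contDiff_rdist (hε : 0 < ε) : ContDiff ℝ ∞ (rdist ε) := by
  unfold rdist
  exact ((contDiff_norm_sq ℝ).add contDiff_const).sqrt fun y => by positivity

theorem contDiff_regTest (hh : ContDiff ℝ ∞ h) (hε : 0 < ε) : ContDiff ℝ ∞ (regTest h ε x₀ t₀) := by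
  have hk : ContDiff ℝ ∞ fun p : E3 × ℝ => rdist ε (p.1 - x₀) :=
    (contDiff_rdist hε).comp (contDiff_fst.sub contDiff_const)
  exact (hh.comp ((contDiff_const.sub contDiff_snd).sub hk)).div hk fun p => (rdist_pos hε _).ne'

theorem hasDerivAt_rdist_line (hε : 0 < ε) (y : E3) (i : Fin 3) :
    HasDerivAt (fun s : ℝ => rdist ε (y + s • basis3 i)) (y i / rdist ε y) 0 := by
  have e : (fun s : ℝ => rdist ε (y + s • basis3 i)) =
      fun s => √(‖y‖ ^ 2 + 2 * y i * s + s ^ 2 + ε ^ 2) := by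
    ext s
    rw [rdist, E3.norm_sq, E3.norm_sq]
    congr 1
    fin_cases i <;> simp [basis3] <;> ring
  rw [e]
  have hp : (0:ℝ) < ‖y‖ ^ 2 + ε ^ 2 := by positivity
  have hk := rdist_pos hε y
  have d : HasDerivAt (fun s : ℝ => ‖y‖ ^ 2 + 2 * y i * s + s ^ 2 + ε ^ 2) (2 * y i) 0 := by
    have := ((((hasDerivAt_id (0:ℝ)).const_mul (2 * y i)).const_add (‖y‖ ^ 2)).add
      ((hasDerivAt_id (0:ℝ)).pow 2)).add_const (ε ^ 2)
    simpa using this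
  refine (d.sqrt (by simpa using hp.ne')).congr_deriv ?_
  simp only [mul_zero, add_zero, ne_eq, OfNat.ofNat_ne_zero, not_false_eq_true, zero_pow]
  rw [← rdist]
  field_simp

theorem fderiv_apply_eq {W : E3 × ℝ → ℝ} {p v : E3 × ℝ} {a : ℝ} (hW : DifferentiableAt ℝ W p)
    (d : HasDerivAt (fun s : ℝ => W (p + s • v)) a 0) : fderiv ℝ W p v = a := by
  have hl : HasDerivAt (fun s : ℝ => p + s • v) v 0 := by
    simpa using ((hasDerivAt_id (0:ℝ)).smul_const v).const_add p
  have hW' : HasFDerivAt W (fderiv ℝ W p) (p + (0:ℝ) • v) := by simpa using hW.hasFDerivAt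
  exact (hW'.comp_hasDerivAt (f := fun s : ℝ => p + s • v) 0 hl).unique d

theorem fderiv_fderiv_apply_eq {W : E3 × ℝ → ℝ} (hW : ContDiff ℝ ∞ W) {p v : E3 × ℝ}
    {γ : E3 × ℝ → ℝ} (hγ : ∀ q, fderiv ℝ W q v = γ q) {a : ℝ}
    (d : HasDerivAt (fun s : ℝ => γ (p + s • v)) a 0) : fderiv ℝ (fderiv ℝ W) p v v = a := by
  have h1 : ContDiff ℝ ∞ (fderiv ℝ W) := hW.fderiv_right (by simp)
  have hd := (h1.differentiable (by simp) p).hasFDerivAt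
  have hl : HasDerivAt (fun s : ℝ => p + s • v) v 0 := by
    simpa using ((hasDerivAt_id (0:ℝ)).smul_const v).const_add p
  have hd' : HasFDerivAt (fderiv ℝ W) (fderiv ℝ (fderiv ℝ W) p) (p + (0:ℝ) • v) := by simpa using hd
  have h2 := (hd'.comp_hasDerivAt (f := fun s : ℝ => p + s • v) 0 hl).clm_apply
    (hasDerivAt_const (0:ℝ) v)
  simp only [Function.comp_apply, map_zero, add_zero, hγ] at h2
  exact h2.unique d

theorem boxH_regTest (hh : ContDiff ℝ ∞ h) (hε : 0 < ε) (p : E3 × ℝ) :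
    boxH (fderiv ℝ (fderiv ℝ (regTest h ε x₀ t₀)) p) =
      regKer ε (rdist ε (p.1 - x₀)) (deriv (deriv h) (t₀ - p.2 - rdist ε (p.1 - x₀)))
        (deriv h (t₀ - p.2 - rdist ε (p.1 - x₀))) (h (t₀ - p.2 - rdist ε (p.1 - x₀))) := by
  have hψ := contDiff_regTest (x₀ := x₀) (t₀ := t₀) hh hε
  have hh1 : ContDiff ℝ ∞ (deriv h) := (contDiff_infty_iff_deriv.1 hh).2
  have dh (s : ℝ) : HasDerivAt h (deriv h s) s := (hh.differentiable (by simp) s).hasDerivAt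
  have dh1 (s : ℝ) : HasDerivAt (deriv h) (deriv (deriv h) s) s :=
    (hh1.differentiable (by simp) s).hasDerivAt
  have hk (q : E3 × ℝ) : rdist ε (q.1 - x₀) ≠ 0 := (rdist_pos hε _).ne'
  -- time direction
  have lT (q : E3 × ℝ) (s : ℝ) : (q + s • eT).1 = q.1 ∧ (q + s • eT).2 = q.2 + s := by simp [eT]
  have dT (f : ℝ → ℝ) (f' : ℝ → ℝ) (hf : ∀ s, HasDerivAt f (f' s) s) (q : E3 × ℝ) :
      HasDerivAt (fun s : ℝ => f (t₀ - (q.2 + s) - rdist ε (q.1 - x₀)))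
        (-f' (t₀ - q.2 - rdist ε (q.1 - x₀))) 0 := by
    have d1 : HasDerivAt (fun s : ℝ => t₀ - (q.2 + s) - rdist ε (q.1 - x₀)) (-1) 0 :=
      ((((hasDerivAt_id (0:ℝ)).const_add q.2).const_sub t₀).sub_const _)
    have d2 : HasDerivAt f (f' (t₀ - q.2 - rdist ε (q.1 - x₀)))
        (t₀ - (q.2 + 0) - rdist ε (q.1 - x₀)) := by rw [add_zero]; exact hf _
    exact (d2.comp (h := fun s : ℝ => t₀ - (q.2 + s) - rdist ε (q.1 - x₀)) 0 d1).congr_deriv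
      (by ring)
  have gT (q : E3 × ℝ) : fderiv ℝ (regTest h ε x₀ t₀) q eT =
      -deriv h (t₀ - q.2 - rdist ε (q.1 - x₀)) / rdist ε (q.1 - x₀) := by
    refine fderiv_apply_eq (hψ.differentiable (by simp) q) ?_
    simp only [regTest, lT]
    exact (dT h _ dh q).div_const _
  have HT : fderiv ℝ (fderiv ℝ (regTest h ε x₀ t₀)) p eT eT =
      deriv (deriv h) (t₀ - p.2 - rdist ε (p.1 - x₀)) / rdist ε (p.1 - x₀) := by
    refine fderiv_fderiv_apply_eq hψ gT ?_
    simp only [lT]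
    refine ((dT (deriv h) _ dh1 p).neg.div_const _).congr_deriv ?_
    ring
  -- space directions
  have lX (i : Fin 3) (q : E3 × ℝ) (s : ℝ) :
      (q + s • eX (basis3 i)).1 - x₀ = (q.1 - x₀) + s • basis3 i
      ∧ (q + s • eX (basis3 i)).2 = q.2 := by
    constructor
    · simp only [eX, Prod.fst_add, Prod.smul_fst]; abel
    · simp [eX]
  have dK (i : Fin 3) (q : E3 × ℝ) := hasDerivAt_rdist_line hε (q.1 - x₀) i
  have dX (f : ℝ → ℝ) (f' : ℝ → ℝ) (hf : ∀ s, HasDerivAt f (f' s) s) (i : Fin 3) (q : E3 × ℝ) :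
      HasDerivAt (fun s : ℝ => f (t₀ - q.2 - rdist ε ((q.1 - x₀) + s • basis3 i)))
        (f' (t₀ - q.2 - rdist ε (q.1 - x₀)) * -((q.1 - x₀) i / rdist ε (q.1 - x₀))) 0 := by
    have d1 := (dK i q).const_sub (t₀ - q.2)
    have d2 : HasDerivAt f (f' (t₀ - q.2 - rdist ε (q.1 - x₀)))
        (t₀ - q.2 - rdist ε ((q.1 - x₀) + (0:ℝ) • basis3 i)) := by
      rw [zero_smul, add_zero]; exact hf _
    exact d2.comp (h := fun s : ℝ => t₀ - q.2 - rdist ε ((q.1 - x₀) + s • basis3 i)) 0 d1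
  have hk0 (i : Fin 3) (q : E3 × ℝ) :
      rdist ε ((q.1 - x₀) + (0:ℝ) • basis3 i) = rdist ε (q.1 - x₀) := by
    rw [zero_smul, add_zero]
  have gX (i : Fin 3) (q : E3 × ℝ) : fderiv ℝ (regTest h ε x₀ t₀) q (eX (basis3 i)) =
      -(deriv h (t₀ - q.2 - rdist ε (q.1 - x₀)) / rdist ε (q.1 - x₀) ^ 2
        + h (t₀ - q.2 - rdist ε (q.1 - x₀)) / rdist ε (q.1 - x₀) ^ 3) * (q.1 - x₀) i := by
    refine fderiv_apply_eq (hψ.differentiable (by simp) q) ?_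
    simp only [regTest, lX]
    refine ((dX h _ dh i q).div (dK i q) (by rw [hk0]; exact hk q)).congr_deriv ?_
    have := hk q
    rw [hk0]
    field_simp
    ring
  have HX (i : Fin 3) : fderiv ℝ (fderiv ℝ (regTest h ε x₀ t₀)) p (eX (basis3 i)) (eX (basis3 i)) =
      -(deriv h (t₀ - p.2 - rdist ε (p.1 - x₀)) / rdist ε (p.1 - x₀) ^ 2
        + h (t₀ - p.2 - rdist ε (p.1 - x₀)) / rdist ε (p.1 - x₀) ^ 3)
      + (p.1 - x₀) i ^ 2 * (deriv (deriv h) (t₀ - p.2 - rdist ε (p.1 - x₀)) / rdist ε (p.1 - x₀) ^ 3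
        + 3 * deriv h (t₀ - p.2 - rdist ε (p.1 - x₀)) / rdist ε (p.1 - x₀) ^ 4
        + 3 * h (t₀ - p.2 - rdist ε (p.1 - x₀)) / rdist ε (p.1 - x₀) ^ 5) := by
    refine fderiv_fderiv_apply_eq hψ (gX i) ?_
    simp only [lX]
    have dc : HasDerivAt (fun s : ℝ => ((p.1 - x₀) + s • basis3 i) i) 1 0 := by
      have := (hasDerivAt_id (0:ℝ)).const_add ((p.1 - x₀) i)
      refine this.congr_of_eventuallyEq (Filter.Eventually.of_forall fun s => ?_)
      simp [basis3]
    have e0 : ((p.1 - x₀) + (0:ℝ) • basis3 i) i = (p.1 - x₀) i := by simp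
    refine (((((dX _ _ dh1 i p).div ((dK i p).pow 2)
      (pow_ne_zero 2 ((hk0 i p).trans_ne (hk p)))).add
      ((dX _ _ dh i p).div ((dK i p).pow 3) (pow_ne_zero 3 ((hk0 i p).trans_ne (hk p))))).neg).mul
      dc).congr_deriv ?_
    have := hk p
    simp only [Pi.add_apply, Pi.div_apply, Pi.neg_apply, Pi.pow_apply, hk0, e0]
    field_simp
    push_cast
    ring
  rw [boxH, HT]
  simp only [HX, Fin.sum_univ_three, regKer]
  have e := rdist_sq ε (p.1 - x₀)
  rw [E3.norm_sq] at e
  have := hk p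
  generalize rdist ε (p.1 - x₀) = k at *
  field_simp
  linear_combination (deriv (deriv h) (t₀ - p.2 - k) * k ^ 2 + 3 * deriv h (t₀ - p.2 - k) * k
    + 3 * h (t₀ - p.2 - k)) * e

end RegTest

theorem boxInt_eq_setIntegral {c : ℝ} (hc : 0 ≤ c) {Q : E3 × ℝ → ℝ} (hQ : Continuous Q) :
    boxInt c c (fun θ x τ => x ^ 2 * Q (chi x τ θ)) =
      ∫ y in closedBall (0:E3) c, (∫ τ in (0:ℝ)..c, Q (y, ‖y‖ + τ)) := by
  have hf : Continuous fun y : E3 => ∫ τ in (0:ℝ)..c, Q (y, ‖y‖ + τ) :=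
    intervalIntegral.continuous_parametric_intervalIntegral_of_continuous' (by fun_prop) 0 c
  rw [integral_closedBall_polar hc hf, boxInt]
  refine integral_congr_ae (Filter.Eventually.of_forall fun θ => ?_)
  refine intervalIntegral.integral_congr fun x hx => ?_
  rw [uIcc_of_le hc] at hx
  have e : ‖x • (θ : E3)‖ = x := by simp [norm_smul, abs_of_nonneg hx.1]
  simp only [intervalIntegral.integral_const_mul, e, chi]

theorem regTest_eq_zero {h : ℝ → ℝ} {ε : ℝ} {x₀ : E3} {t₀ : ℝ} (h0 : ∀ s ≤ 0, h s = 0) {p : E3 × ℝ}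
    (hp : ‖x₀‖ + t₀ ≤ ‖p.1‖ + p.2) : regTest h ε x₀ t₀ p = 0 := by
  have h1 := norm_le_rdist ε (p.1 - x₀)
  have h2 := norm_sub_norm_le p.1 x₀
  rw [regTest, h0 _ (by linarith), zero_div]

theorem fderiv_eq_zero_of_eqOn_zero {W : E3 × ℝ → ℝ} {U : Set (E3 × ℝ)} (hU : IsOpen U)
    (h : ∀ p ∈ U, W p = 0) {p : E3 × ℝ} (hp : p ∈ U) :
    W p = 0 ∧ fderiv ℝ W p = 0 ∧ fderiv ℝ (fderiv ℝ W) p = 0 := by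
  have e : W =ᶠ[nhds p] fun _ => 0 := Filter.eventuallyEq_of_mem (hU.mem_nhds hp) h
  have e1 : fderiv ℝ W =ᶠ[nhds p] 0 := by
    simpa using e.fderiv (𝕜 := ℝ)
  exact ⟨h p hp, e1.eq_of_nhds, by rw [e1.fderiv_eq]; simp⟩

section MinPrinciple
variable {ρ : ℝ} {Z : E3 × ℝ → ℝ} {g : E3 × ℝ → (E3 × ℝ →L[ℝ] ℝ)}
  {H : E3 × ℝ → (E3 × ℝ →L[ℝ] E3 × ℝ →L[ℝ] ℝ)}

/-- Testing a supersolution with nonnegative radial characteristic data against `regTest`. -/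
theorem Pack.boxInt_regTest_nonneg (P : Pack ρ Z g H)
    (hbox : ∀ p : E3 × ℝ, ‖p.1‖ < p.2 → ‖p.1‖ + p.2 < 2 * ρ → 0 ≤ boxH (H p))
    (hch : ∀ θ : S2, ∀ x ∈ Ioo 0 ρ, 0 ≤ rvx Z g θ x 0) {h : ℝ → ℝ} (hh : ContDiff ℝ ∞ h)
    (hp : ∀ s, 0 ≤ h s) (h0 : ∀ s ≤ 0, h s = 0) {ε : ℝ} (hε : 0 < ε) {x₀ : E3} {t₀ c : ℝ}
    (hc0 : 0 < c) (hxc : ‖x₀‖ + t₀ < c) (hc : c < 2 * ρ) :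
    0 ≤ boxInt c c (fun θ x τ => x ^ 2 * (Z (chi x τ θ) *
      boxH (fderiv ℝ (fderiv ℝ (regTest h ε x₀ t₀)) (chi x τ θ)))) := by
  have hψ := contDiff_regTest (x₀ := x₀) (t₀ := t₀) hh hε
  have P₂ := Pack.of_contDiff hψ ρ
  have hψ0 (p : E3 × ℝ) : 0 ≤ regTest h ε x₀ t₀ p := div_nonneg (hp _) (rdist_pos hε _).le
  have hU : IsOpen {p : E3 × ℝ | ‖x₀‖ + t₀ < ‖p.1‖ + p.2} :=
    isOpen_lt continuous_const (by fun_prop)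
  have hgr := P.green P₂ hc0 hc fun p hp => fderiv_eq_zero_of_eqOn_zero hU
    (fun q hq => regTest_eq_zero h0 (le_of_lt hq)) (hxc.trans_le hp)
  have hz (x τ : ℝ) (hx : 0 ≤ x) (θ : S2) (hxτ : c ≤ 2 * x + τ) :
      regTest h ε x₀ t₀ (chi x τ θ) = 0 := by
    refine regTest_eq_zero h0 ?_
    rw [norm_chi_fst hx, chi_snd]
    linarith
  have hr : 0 ≤
      ∫ θ, (∫ x in (0:ℝ)..c, 2 * (rv (regTest h ε x₀ t₀) θ x 0 * rvx Z g θ x 0)) ∂sig := by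
    refine integral_nonneg fun θ => intervalIntegral.integral_nonneg hc0.le fun x hx => ?_
    rcases hx.1.eq_or_lt with rfl | hx0
    · simp [rv]
    rcases lt_or_ge x ρ with hxρ | hxρ
    · have := hch θ x ⟨hx0, hxρ⟩
      have h2 : 0 ≤ rv (regTest h ε x₀ t₀) θ x 0 := mul_nonneg hx0.le (hψ0 _)
      positivity
    · simp [rv, hz x 0 hx0.le θ (by linarith)]
  have cZ := P.continuous_W₃
  have cψ := P₂.continuous_W₃
  have cH : Continuous fun p : S2 × ℝ × ℝ => boxH (H (chi p.2.1 p.2.2 p.1)) :=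
    continuous_boxH.comp (P.cH.comp continuous_chi₃)
  have cH₂ : Continuous fun p : S2 × ℝ × ℝ =>
      boxH (fderiv ℝ (fderiv ℝ (regTest h ε x₀ t₀)) (chi p.2.1 p.2.2 p.1)) :=
    continuous_boxH.comp (P₂.cH.comp continuous_chi₃)
  have cx : Continuous fun p : S2 × ℝ × ℝ => p.2.1 ^ 2 := by fun_prop
  refine (hr.trans_eq hgr.symm).trans (boxInt_mono hc0.le hc0.le ?_ ?_ ?_)
  · exact cx.mul ((cZ.mul cH₂).sub (cψ.mul cH))
  · exact cx.mul (cZ.mul cH₂)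
  · intro θ x hx τ hτ
    gcongr
    rw [sub_le_self_iff]
    rcases lt_or_ge (2 * x + τ) c with hl | hl
    · obtain ⟨a1, a2⟩ := chi_mem hx.1.le hτ.1 (hl.trans hc) θ
      exact mul_nonneg (hψ0 _) (hbox _ a1 a2)
    · rw [hz x τ hx.1.le θ hl, zero_mul]

theorem Pack.nonneg_of_box (P : Pack ρ Z g H)
    (hbox : ∀ p : E3 × ℝ, ‖p.1‖ < p.2 → ‖p.1‖ + p.2 < 2 * ρ → 0 ≤ boxH (H p))
    (hch : ∀ θ : S2, ∀ x ∈ Ioo 0 ρ, 0 ≤ rvx Z g θ x 0) {p : E3 × ℝ} (hp1 : ‖p.1‖ < p.2)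
    (hp2 : ‖p.1‖ + p.2 < 2 * ρ) : 0 ≤ Z p := by
  by_contra! hneg
  obtain ⟨x₀, t₁⟩ := p
  simp only at hp1 hp2
  have hev : ∀ᶠ s in nhds t₁, Z (x₀, s) < 0 :=
    (show Continuous fun s => Z (x₀, s) from P.cW.comp (by fun_prop)).continuousAt.eventually_lt
      continuousAt_const hneg
  obtain ⟨η, hη, hη'⟩ := Metric.eventually_nhds_iff.1 hev
  obtain ⟨κ, hκ⟩ : ∃ κ, κ = min (min η (t₁ - ‖x₀‖)) (2 * ρ - ‖x₀‖ - t₁) / 2 := ⟨_, rfl⟩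
  have hn := norm_nonneg x₀
  have hm : 0 < min (min η (t₁ - ‖x₀‖)) (2 * ρ - ‖x₀‖ - t₁) :=
    lt_min (lt_min hη (by linarith)) (by linarith)
  have hm1 := (min_le_left (min η (t₁ - ‖x₀‖)) (2 * ρ - ‖x₀‖ - t₁)).trans (min_le_left _ _)
  have hm2 := (min_le_left (min η (t₁ - ‖x₀‖)) (2 * ρ - ‖x₀‖ - t₁)).trans (min_le_right _ _)
  have hm3 := min_le_right (min η (t₁ - ‖x₀‖)) (2 * ρ - ‖x₀‖ - t₁)
  have hκ0 : 0 < κ := by linarith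
  let b : ContDiffBump κ := ⟨κ / 2, κ, by linarith, by linarith⟩
  obtain ⟨h, hhb⟩ : ∃ h : ℝ → ℝ, h = b := ⟨_, rfl⟩
  have hh : ContDiff ℝ ∞ h := hhb ▸ b.contDiff
  have hpos (s : ℝ) : 0 ≤ h s := hhb ▸ b.nonneg
  have hone : h κ = 1 := by
    rw [hhb]; exact b.one_of_mem_closedBall (mem_closedBall_self b.rIn_pos.le)
  have hzero (s : ℝ) (hs : κ ≤ |s - κ|) : h s = 0 := by
    rw [hhb]; exact b.zero_of_le_dist hs
  have h0 (s : ℝ) (hs : s ≤ 0) : h s = 0 := hzero s (by rw [abs_of_nonpos] <;> linarith)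
  obtain ⟨t₀, ht₀⟩ : ∃ t₀, t₀ = t₁ + κ := ⟨_, rfl⟩
  obtain ⟨c, hc⟩ : ∃ c, c = (‖x₀‖ + t₀ + 2 * ρ) / 2 := ⟨_, rfl⟩
  have hc1 : ‖x₀‖ + t₀ < c := by linarith
  have hc2 : c < 2 * ρ := by linarith
  have hc0 : 0 < c := by linarith
  have hh1 : ContDiff ℝ ∞ (deriv h) := (contDiff_infty_iff_deriv.1 hh).2
  have hh2 : ContDiff ℝ ∞ (deriv (deriv h)) := (contDiff_infty_iff_deriv.1 hh1).2
  obtain ⟨G, hG⟩ : ∃ G : (ℝ → ℝ) → E3 × ℝ → ℝ, ∀ k p, G k p =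
    ∫ τ in (0:ℝ)..c, Z (p.1, ‖p.1‖ + τ) * k (t₀ - (‖p.1‖ + τ) - p.2) := ⟨_, fun _ _ => rfl⟩
  have hGc (k : ℝ → ℝ) (hk : Continuous k) : Continuous (G k) := by
    rw [funext (hG k)]
    have := P.cW
    exact intervalIntegral.continuous_parametric_intervalIntegral_of_continuous' (by fun_prop) 0 c
  have key := nonneg_of_integral_regKer_nonneg (x₀ := x₀) (by linarith) (hGc h hh.continuous)
    (hGc _ hh1.continuous) (hGc _ hh2.continuous) (fun ε hε => by
      have hψ := contDiff_regTest (x₀ := x₀) (t₀ := t₀) hh hε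
      have P₂ := Pack.of_contDiff hψ ρ
      have hnn := P.boxInt_regTest_nonneg hbox hch hh hpos h0 hε hc0 hc1 hc2
      rw [boxInt_eq_setIntegral hc0.le (Q := fun p => Z p *
        boxH (fderiv ℝ (fderiv ℝ (regTest h ε x₀ t₀)) p))
        (P.cW.mul (continuous_boxH.comp P₂.cH))] at hnn
      refine hnn.trans_eq (setIntegral_congr_fun measurableSet_closedBall fun y _ => ?_)
      simp only [boxH_regTest hh hε, regKer, hG]
      have hi (k : ℝ → ℝ) (hk : Continuous k) : IntervalIntegrable (fun τ => Z (y, ‖y‖ + τ) *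
          k (t₀ - (‖y‖ + τ) - rdist ε (y - x₀))) volume 0 c := by
        have := P.cW
        exact Continuous.intervalIntegrable (by fun_prop) _ _
      have i0 := hi h hh.continuous
      have i1 := hi _ hh1.continuous
      have i2 := hi _ hh2.continuous
      rw [← intervalIntegral.integral_const_mul, ← intervalIntegral.integral_const_mul,
        ← intervalIntegral.integral_div, ← intervalIntegral.integral_div,
        ← intervalIntegral.integral_div,
        ← intervalIntegral.integral_add (i2.div_const _) ((i1.const_mul _).div_const _),
        ← intervalIntegral.integral_add ((i2.div_const _).add ((i1.const_mul _).div_const _))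
          ((i0.const_mul _).div_const _), ← intervalIntegral.integral_const_mul]
      refine intervalIntegral.integral_congr fun τ _ => ?_
      ring)
  rw [hG] at key
  simp only [sub_zero] at key
  have hlt : 0 < ∫ τ in (0:ℝ)..c, -(Z (x₀, ‖x₀‖ + τ) * h (t₀ - (‖x₀‖ + τ))) := by
    have := P.cW
    have := hh.continuous
    refine intervalIntegral.integral_pos hc0 (Continuous.continuousOn (by fun_prop)) ?_ ?_
    · intro τ _
      rcases le_or_gt κ |t₀ - (‖x₀‖ + τ) - κ| with hs | hs
      · rw [hzero _ hs]; simp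
      · rw [neg_nonneg]
        refine mul_nonpos_of_nonpos_of_nonneg (hη' ?_).le (hpos _)
        rw [dist_eq, abs_sub_comm]
        rw [show t₀ - (‖x₀‖ + τ) - κ = t₁ - (‖x₀‖ + τ) by rw [ht₀]; ring] at hs
        linarith
    · refine ⟨t₁ - ‖x₀‖, ⟨by linarith, by linarith⟩, ?_⟩
      rw [show t₀ - (‖x₀‖ + (t₁ - ‖x₀‖)) = κ by rw [ht₀]; ring, hone,
        show ‖x₀‖ + (t₁ - ‖x₀‖) = t₁ by ring]
      linarith
  rw [intervalIntegral.integral_neg] at hlt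
  linarith

end MinPrinciple

/-- The barrier `a + b (t² - |x|²)`. -/
def barrier (a b : ℝ) (p : E3 × ℝ) : ℝ := a + b * (p.2 ^ 2 - ‖p.1‖ ^ 2)

theorem contDiff_barrier (a b : ℝ) : ContDiff ℝ ∞ (barrier a b) :=
  contDiff_const.add (contDiff_const.mul ((contDiff_snd.pow 2).sub (contDiff_fst.norm_sq ℝ)))

theorem boxH_barrier (a b : ℝ) (p : E3 × ℝ) :
    boxH (fderiv ℝ (fderiv ℝ (barrier a b)) p) = 8 * b := by
  have hc := contDiff_barrier a b
  have gT (q : E3 × ℝ) : fderiv ℝ (barrier a b) q eT = b * (2 * q.2) := by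
    refine fderiv_apply_eq (hc.differentiable (by simp) q) ?_
    have d : HasDerivAt (fun s : ℝ => a + b * ((q.2 + s) ^ 2 - ‖q.1‖ ^ 2))
        (b * (2 * (q.2 + 0) ^ 1 * 1)) 0 :=
      (((((hasDerivAt_id (0:ℝ)).const_add q.2).pow 2).sub_const _).const_mul b).const_add a
    simpa [barrier, eT] using d
  have gX (i : Fin 3) (q : E3 × ℝ) :
      fderiv ℝ (barrier a b) q (eX (basis3 i)) = b * (-2 * q.1 i) := by
    refine fderiv_apply_eq (hc.differentiable (by simp) q) ?_
    have d : HasDerivAt (fun s : ℝ => a + b * (q.2 ^ 2 - (‖q.1‖ ^ 2 + 2 * q.1 i * s + s ^ 2)))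
        (b * -(2 * q.1 i * 1 + 2 * (0:ℝ) ^ 1 * 1)) 0 :=
      ((((((hasDerivAt_id (0:ℝ)).const_mul (2 * q.1 i)).const_add (‖q.1‖ ^ 2)).add
        ((hasDerivAt_id (0:ℝ)).pow 2)).const_sub _).const_mul b).const_add a
    refine (d.congr_deriv (by ring)).congr_of_eventuallyEq (Filter.Eventually.of_forall fun s => ?_)
    simp only [barrier, eX, Prod.fst_add, Prod.smul_fst, Prod.snd_add, Prod.smul_snd, smul_zero,
      add_zero, E3.norm_sq]
    fin_cases i <;> simp [basis3] <;> ring_nf <;> exact Or.inl trivial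
  have HT : fderiv ℝ (fderiv ℝ (barrier a b)) p eT eT = 2 * b := by
    refine fderiv_fderiv_apply_eq hc gT ?_
    have d : HasDerivAt (fun s : ℝ => b * (2 * (p.2 + s))) (b * (2 * 1)) 0 :=
      (((hasDerivAt_id (0:ℝ)).const_add p.2).const_mul 2).const_mul b
    refine (d.congr_deriv (by ring)).congr_of_eventuallyEq (Filter.Eventually.of_forall fun s => ?_)
    simp [eT]
  have HX (i : Fin 3) :
      fderiv ℝ (fderiv ℝ (barrier a b)) p (eX (basis3 i)) (eX (basis3 i)) = -2 * b := by
    refine fderiv_fderiv_apply_eq hc (gX i) ?_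
    have d : HasDerivAt (fun s : ℝ => b * (-2 * (p.1 i + s))) (b * (-2 * 1)) 0 :=
      (((hasDerivAt_id (0:ℝ)).const_add (p.1 i)).const_mul (-2)).const_mul b
    refine (d.congr_deriv (by ring)).congr_of_eventuallyEq (Filter.Eventually.of_forall fun s => ?_)
    simp [eX, basis3]
  simp only [boxH, HT, HX, Fin.sum_univ_three]
  ring

theorem rvx_barrier (a b : ℝ) (θ : S2) (x : ℝ) :
    rvx (barrier a b) (fderiv ℝ (barrier a b)) θ x 0 = a := by
  have h1 (y : ℝ) : barrier a b (chi y 0 θ) = a := by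
    simp [barrier, chi, norm_smul]
  have h2 : fderiv ℝ (barrier a b) (chi x 0 θ) (eL θ) = 0 := by
    refine fderiv_apply_eq ((contDiff_barrier a b).differentiable (by simp) _) ?_
    have e (s : ℝ) : chi x 0 (θ : E3) + s • eL θ = chi (x + s) 0 θ := by
      simp [chi, eL, add_smul]
    simp only [e, h1]
    exact hasDerivAt_const _ _
  rw [rvx, h1, h2, mul_zero, add_zero]

section Solution
variable {ρ : ℝ} {W : E3 × ℝ → ℝ} {g : E3 × ℝ → (E3 × ℝ →L[ℝ] ℝ)}
  {H : E3 × ℝ → (E3 × ℝ →L[ℝ] E3 × ℝ →L[ℝ] ℝ)}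

theorem Pack.nonneg_add_barrier (hρ : 0 < ρ) (P : Pack ρ W g H) {a b : ℝ}
    (hbox : ∀ p : E3 × ℝ, ‖p.1‖ < p.2 → ‖p.1‖ + p.2 < 2 * ρ → -(8 * b) ≤ boxH (H p))
    (hch : ∀ θ : S2, ∀ x ∈ Ioo 0 ρ, -a ≤ rvx W g θ x 0) {p : E3 × ℝ} (hp : p ∈ Dcone ρ) :
    0 ≤ barrier a b p + W p := by
  have PB := (Pack.of_contDiff (contDiff_barrier a b) ρ).add P
  have hin (q : E3 × ℝ) (h1 : ‖q.1‖ < q.2) (h2 : ‖q.1‖ + q.2 < 2 * ρ) :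
      0 ≤ barrier a b q + W q := by
    refine PB.nonneg_of_box (fun q h h' => ?_) (fun θ x hx => ?_) h1 h2
    · have e : boxH (fderiv ℝ (fderiv ℝ (barrier a b)) q + H q) = 8 * b + boxH (H q) := by
        rw [← boxH_barrier a b q]
        simp only [boxH, add_apply, Fin.sum_univ_three]
        ring
      rw [e]
      linarith [hbox q h h']
    · have e : rvx (fun p => barrier a b p + W p) (fun p => fderiv ℝ (barrier a b) p + g p) θ x 0 =
          a + rvx W g θ x 0 := by
        have := rvx_barrier a b θ x
        simp only [rvx, add_apply] at this ⊢
        linarith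
      rw [e]
      linarith [hch θ x hx]
  have hcont : Continuous fun s : ℝ => barrier a b ((1 - s) • p + s • ((0 : E3), ρ)) +
      W ((1 - s) • p + s • ((0 : E3), ρ)) := PB.cW.comp (by fun_prop)
  have hlim := (hcont.tendsto 0).mono_left (nhdsWithin_le_nhds (s := Ioi 0))
  simp only [sub_zero, one_smul, zero_smul, add_zero] at hlim
  refine ge_of_tendsto hlim ?_
  filter_upwards [Ioo_mem_nhdsGT (zero_lt_one (α := ℝ))] with s hs
  obtain ⟨h1, h2, h3⟩ := hp
  have hs1 : 0 < 1 - s := by linarith [hs.2]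
  have e1 : ‖((1 - s) • p + s • ((0 : E3), ρ)).1‖ = (1 - s) * ‖p.1‖ := by
    simp [norm_smul, abs_of_pos hs1]
  have e2 : ((1 - s) • p + s • ((0 : E3), ρ)).2 = (1 - s) * p.2 + s * ρ := by simp
  have hsρ := mul_pos hs.1 hρ
  refine hin _ ?_ ?_
  · rw [e1, e2]
    nlinarith
  · rw [e1, e2]
    nlinarith

/-- Solutions of the Goursat problem with a small potential are small. -/
theorem Pack.abs_le_two_mul (hρ : 0 < ρ) (P : Pack ρ W g H) {Q : E3 → ℝ} {δ : ℝ}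
    (hδ : δ * ρ ^ 2 ≤ 1) (hQ : ∀ x ∈ closedBall (0:E3) ρ, |Q x| ≤ δ)
    (hbox : ∀ p : E3 × ℝ, ‖p.1‖ < p.2 → ‖p.1‖ + p.2 < 2 * ρ → boxH (H p) = Q p.1 * W p)
    (hch : ∀ θ : S2, ∀ x ∈ Ioo 0 ρ, rvx W g θ x 0 = Q (x • θ.1)) {p : E3 × ℝ} (hp : p ∈ Dcone ρ) :
    |W p| ≤ 2 * δ := by
  obtain ⟨p₀, hp₀, hmax⟩ := (isCompact_Dcone ρ).exists_isMaxOn ⟨p, hp⟩ P.cW.abs.continuousOn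
  obtain ⟨S, hS⟩ : ∃ S, S = |W p₀| := ⟨_, rfl⟩
  have hle (q : E3 × ℝ) (hq : q ∈ Dcone ρ) : |W q| ≤ S := hS ▸ hmax hq
  have hδ0 : 0 ≤ δ := (abs_nonneg _).trans (hQ 0 (mem_closedBall_self hρ.le))
  have hb (q : E3 × ℝ) (h1 : ‖q.1‖ < q.2) (h2 : ‖q.1‖ + q.2 < 2 * ρ) :
      |boxH (H q)| ≤ 8 * (δ * S / 8) := by
    have hq := mem_Dcone_of_le h1.le h2.le
    rw [hbox q h1 h2, abs_mul, mul_div_cancel₀ _ (by norm_num)]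
    exact mul_le_mul (hQ _ (by simpa using hq.1)) (hle q hq) (abs_nonneg _) hδ0
  have hc (θ : S2) (x : ℝ) (hx : x ∈ Ioo 0 ρ) : |rvx W g θ x 0| ≤ δ := by
    rw [hch θ x hx]
    refine hQ _ ?_
    simpa [norm_smul, abs_of_pos hx.1] using hx.2.le
  have h1 := P.nonneg_add_barrier hρ (fun q h h' => (abs_le.1 (hb q h h')).1)
    (fun θ x hx => (abs_le.1 (hc θ x hx)).1) hp₀
  have h2 := (P.const_smul (-1)).nonneg_add_barrier (a := δ) (b := δ * S / 8) hρ
    (fun q h h' => by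
      have e : boxH ((-1 : ℝ) • H q) = -boxH (H q) := by
        simp only [boxH, smul_apply, Fin.sum_univ_three, smul_eq_mul]; ring
      rw [e]
      linarith [(abs_le.1 (hb q h h')).2])
    (fun θ x hx => by
      have e : rvx (fun p => -1 * W p) (fun p => (-1 : ℝ) • g p) θ x 0 = -rvx W g θ x 0 := by
        simp only [rvx, smul_apply, smul_eq_mul]; ring
      rw [e]
      linarith [(abs_le.1 (hc θ x hx)).2]) hp₀
  have hS1 : S ≤ barrier δ (δ * S / 8) p₀ := by
    rw [hS] at h1 h2 ⊢
    exact abs_le'.2 ⟨by linarith, by linarith⟩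
  have hS0 : 0 ≤ S := hS ▸ abs_nonneg _
  have hB : barrier δ (δ * S / 8) p₀ ≤ δ + S / 2 := by
    obtain ⟨a1, a2, a3⟩ := hp₀
    have a4 := norm_nonneg p₀.1
    have hsq : p₀.2 ^ 2 - ‖p₀.1‖ ^ 2 ≤ 4 * ρ ^ 2 := by nlinarith
    have := mul_le_mul_of_nonneg_left hsq (show 0 ≤ δ * S / 8 by positivity)
    have := mul_le_mul_of_nonneg_right hδ hS0
    rw [barrier]
    nlinarith
  linarith [hle p hp]

/-- Along the characteristic cone, `∂_r (r u)` equals the potential. -/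
theorem Pack.rvx_eq_of_goursat (P : Pack ρ W g H) {Q : E3 → ℝ} (hQ : Continuous Q)
    (hW : ∀ x : E3, ‖x‖ ≤ ρ → W (x, ‖x‖) = ∫ σ in (0:ℝ)..1, Q (σ • x)) (θ : S2) {x : ℝ}
    (hx : x ∈ Ioo 0 ρ) : rvx W g θ x 0 = Q (x • θ.1) := by
  have hd : HasDerivAt (fun y => ∫ s in (0:ℝ)..y, Q (s • θ.1)) (Q (x • θ.1)) x :=
    (show Continuous fun s : ℝ => Q (s • θ.1) by fun_prop).integral_hasStrictDerivAt 0 x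
      |>.hasDerivAt
  refine (P.deriv_rv_zero hx.1 hx.2 θ).unique (hd.congr_of_eventuallyEq ?_)
  filter_upwards [Ioo_mem_nhds hx.1 hx.2] with y hy
  have hn : ‖y • θ.1‖ = y := by simp [norm_smul, abs_of_pos hy.1]
  have e : chi y 0 (θ : E3) = (y • θ.1, ‖y • θ.1‖) := by rw [hn]; simp [chi]
  rw [rv, e, hW _ (by rw [hn]; exact hy.2.le)]
  have := intervalIntegral.smul_integral_comp_mul_right (fun s => Q (s • θ.1)) (a := 0) (b := 1) y
  simpa [mul_smul] using this

theorem exists_pack_of_isSolOn (hρ : 0 < ρ) {q : E3 → ℝ} (hq : ContinuousOn q (closedBall 0 ρ))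
    {u : E3 × ℝ → ℝ} (hu : IsSolOn ρ q u) :
    ∃ W g H Q, Pack ρ W g H ∧ EqOn W u (Dcone ρ) ∧ Continuous Q ∧ EqOn Q q (closedBall 0 ρ) ∧
      (∀ p : E3 × ℝ, ‖p.1‖ < p.2 → ‖p.1‖ + p.2 < 2 * ρ → boxH (H p) = Q p.1 * W p) ∧
      ∀ θ : S2, ∀ x ∈ Ioo 0 ρ, rvx W g θ x 0 = Q (x • θ.1) := by
  obtain ⟨W, g, H, P, eW⟩ := exists_pack hρ hu.1
  obtain ⟨Q, cQ, eQ⟩ := exists_continuous_eqOn isClosed_closedBall hq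
  refine ⟨W, g, H, Q, P, eW, cQ, eQ, fun p h h' => ?_, fun θ x hx => ?_⟩
  · have hp := mem_Dcone_of_le h.le h'.le
    rw [P.boxH_eq eW h h', eQ (by simpa using hp.1), eW hp]
    linarith [hu.2.1 p (mem_interior_Dcone h h')]
  · refine P.rvx_eq_of_goursat cQ (fun y hy => ?_) θ hx
    rw [eW (mem_Dcone_of_le le_rfl (by simp only; linarith)), hu.2.2 y hy]
    refine intervalIntegral.integral_congr fun σ hσ => (eQ ?_).symm
    rw [uIcc_of_le zero_le_one] at hσ
    rw [mem_closedBall_zero_iff, norm_smul, norm_of_nonneg hσ.1]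
    exact (mul_le_of_le_one_left (norm_nonneg y) hσ.2).trans hy

end Solution

section Assembly

variable {ρ : ℝ} {W : E3 × ℝ → ℝ} {g : E3 × ℝ → (E3 × ℝ →L[ℝ] ℝ)}
  {H : E3 × ℝ → (E3 × ℝ →L[ℝ] E3 × ℝ →L[ℝ] ℝ)}

theorem integrableOn_sphere {R : ℝ} (hR : 0 < R) {f : E3 → ℝ} (hf : Continuous f) :
    IntegrableOn f (sphere (0 : E3) R) (μH[2] : Measure E3) :=
  hf.continuousOn.integrableOn_of_subset_isCompact (isCompact_sphere 0 R)
    isClosed_sphere.measurableSet subset_rfl (hausdorff_sphere_lt_top hR).ne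

theorem continuous_sphInt {R : ℝ} (hR : 0 < R) {f : E3 × ℝ → ℝ} (hf : Continuous f) :
    Continuous fun t => sphInt R fun x => f (x, t) := by
  have : IsFiniteMeasure ((μH[2] : Measure E3).restrict (sphere 0 R)) :=
    ⟨by simpa using hausdorff_sphere_lt_top hR⟩
  have := continuous_parametric_integral_of_continuous
    (μ := (μH[2] : Measure E3).restrict (sphere 0 R)) (f := fun t x => f (x, t))
    (hf.comp continuous_swap) (isCompact_sphere (0 : E3) R)
  simpa only [sphInt, Measure.restrict_restrict isClosed_sphere.measurableSet, inter_self]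
    using this

theorem exists_integral_jetSq_le {R τ₁ T : ℝ} (hR : 0 < R) (hτ : 0 ≤ τ₁) (hT : R + τ₁ ≤ T) :
    ∃ C > 0, ∀ ρ W g H, Pack ρ W g H →
      ∫ θ : S2, (∫ τ in (0:ℝ)..τ₁, jetSq W g (chi R τ θ)) ∂sig ≤
        C * ∫ t in R..T, sphInt R fun x => jetSq W g (x, t) := by
  obtain ⟨C, hC, h⟩ := exists_integral_sig_le hR
  refine ⟨C, hC, fun ρ W g H P => ?_⟩
  have cJ := P.continuous_jetSq
  have cS := continuous_sphInt hR cJ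
  have hle : ∀ t, ∫ θ : S2, jetSq W g (R • θ.1, t) ∂sig ≤
      C * sphInt R fun x => jetSq W g (x, t) := fun t =>
    h (fun x => jetSq W g (x, t)) (fun x _ => jetSq_nonneg W g _)
      (integrableOn_sphere hR (by fun_prop))
  have c2 : Continuous (Function.uncurry fun (τ : ℝ) (θ : S2) => jetSq W g (chi R τ θ)) := by
    refine cJ.comp ?_
    simp only [chi]
    fun_prop
  rw [S2.integral_intervalIntegral_swap c2]
  calc ∫ τ in (0:ℝ)..τ₁, (∫ θ : S2, jetSq W g (chi R τ θ) ∂sig)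
      ≤ ∫ τ in (0:ℝ)..τ₁, C * sphInt R fun x => jetSq W g (x, R + τ) := by
        refine intervalIntegral.integral_mono_on hτ ?_ ?_ fun τ _ => hle (R + τ)
        · refine Continuous.intervalIntegrable ?_ _ _
          simpa using continuous_parametric_integral_of_continuous (μ := sig) c2 isCompact_univ
        · exact ((cS.comp (continuous_const.add continuous_id)).const_mul C).intervalIntegrable _ _
    _ = C * ∫ t in R..(R + τ₁), sphInt R fun x => jetSq W g (x, t) := by
        rw [intervalIntegral.integral_const_mul,
          intervalIntegral.integral_comp_add_left (fun t => sphInt R fun x => jetSq W g (x, t)),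
          add_zero]
    _ ≤ _ := by
        refine mul_le_mul_of_nonneg_left ?_ hC.le
        refine intervalIntegral.integral_mono_interval le_rfl (by linarith) hT ?_
          (cS.intervalIntegrable _ _)
        exact .of_forall fun t => integral_nonneg fun x => jetSq_nonneg W g _

theorem Pack.sphInt_eq (P : Pack ρ W g H) {u : E3 × ℝ → ℝ} (e : EqOn W u (Dcone ρ)) {R t : ℝ}
    (h : R < t) (h' : R + t < 2 * ρ) :
    (sphInt R fun x => u (x, t) ^ 2 + gradsqX u (x, t) + pdt u (x, t) ^ 2) =
      sphInt R fun x => jetSq W g (x, t) := by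
  refine setIntegral_congr_fun isClosed_sphere.measurableSet fun x hx => ?_
  rw [mem_sphere_zero_iff_norm] at hx
  have h1 : ‖((x, t) : E3 × ℝ).1‖ < ((x, t) : E3 × ℝ).2 := by simpa [hx] using h
  have h2 : ‖((x, t) : E3 × ℝ).1‖ + ((x, t) : E3 × ℝ).2 < 2 * ρ := by simpa [hx] using h'
  simp only [jetSq, gradsqX, gradsq]
  rw [P.pdt_eq e h1 h2, e (mem_Dcone_of_le h1.le h2.le)]
  congr 2
  exact Finset.sum_congr rfl fun i _ => by rw [← P.pd_fixT e h1 h2 i]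

/-- The volume integral over a ball is at most `R²` times the integral without the Jacobian. -/
theorem integral_closedBall_le {R : ℝ} (hR : 0 ≤ R) {f : E3 → ℝ} (hf : Continuous f)
    (h0 : ∀ x, 0 ≤ f x) :
    ∫ x in closedBall (0 : E3) R, f x ≤
      R ^ 2 * ∫ θ : S2, (∫ r in (0:ℝ)..R, f (r • θ.1)) ∂sig := by
  have c1 : Continuous fun p : S2 × ℝ => f (p.2 • p.1.1) := by fun_prop
  have c2 : Continuous fun p : S2 × ℝ => p.2 ^ 2 * f (p.2 • p.1.1) := by fun_prop
  rw [integral_closedBall_polar hR hf, ← integral_const_mul]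
  refine integral_mono (S2.integrable ?_) ((S2.integrable ?_).const_mul _) fun θ => ?_
  · exact intervalIntegral.continuous_parametric_intervalIntegral_of_continuous' (by exact c2) 0 R
  · exact intervalIntegral.continuous_parametric_intervalIntegral_of_continuous' (by exact c1) 0 R
  · simp only
    rw [← intervalIntegral.integral_const_mul]
    refine intervalIntegral.integral_mono_on hR ?_ ?_ fun r hr => ?_
    · exact Continuous.intervalIntegrable (by fun_prop) _ _
    · exact Continuous.intervalIntegrable (by fun_prop) _ _
    · exact mul_le_mul_of_nonneg_right (by nlinarith [hr.1, hr.2]) (h0 _)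

theorem boxInt_mul_sq_le {R τ₁ K : ℝ} (hR : 0 ≤ R) (hτ : 0 ≤ τ₁) {f : E3 → ℝ} (hf : Continuous f)
    {V : E3 × ℝ → ℝ} (hV : Continuous V)
    (hK : ∀ θ : S2, ∀ x ∈ Ioo 0 R, ∀ τ ∈ Ioo 0 τ₁, |V (chi x τ θ)| ≤ K) :
    boxInt R τ₁ (fun θ x τ => x ^ 2 * (f (chi x τ θ).1 * V (chi x τ θ)) ^ 2) ≤
      K ^ 2 * τ₁ * ∫ x in closedBall (0 : E3) R, f x ^ 2 := by
  have c1 : Continuous fun p : S2 × ℝ × ℝ =>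
      p.2.1 ^ 2 * (f (chi p.2.1 p.2.2 p.1).1 * V (chi p.2.1 p.2.2 p.1)) ^ 2 := by
    have := continuous_chi₃
    fun_prop
  have c2 : Continuous fun p : S2 × ℝ × ℝ => K ^ 2 * (p.2.1 ^ 2 * f (p.2.1 • p.1.1) ^ 2) := by
    fun_prop
  refine (boxInt_mono (f₂ := fun θ x _ => K ^ 2 * (x ^ 2 * f (x • θ.1) ^ 2)) hR hτ c1 c2
    fun θ x hx τ hτ => ?_).trans_eq ?_
  · have := sq_le_sq' (abs_le.1 (hK θ x hx τ hτ)).1 (abs_le.1 (hK θ x hx τ hτ)).2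
    have := mul_le_mul_of_nonneg_left this
      (show 0 ≤ x ^ 2 * f (x • θ.1) ^ 2 by positivity)
    have e : (chi x τ (θ : E3)).1 = x • θ.1 := rfl
    rw [e]
    linarith
  · rw [integral_closedBall_polar hR (f := fun x => f x ^ 2) (hf.pow 2), boxInt,
      ← integral_const_mul]
    congr 1
    ext θ
    rw [← intervalIntegral.integral_const_mul]
    congr 1
    ext x
    rw [intervalIntegral.integral_const, smul_eq_mul]
    ring

end Assembly

end Goursat

/-- **Theorem 1.5.** Stability for the transmission problem when one of the
potentials is small: there are `δ, C > 0` depending only on `R, T, M` so that if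
`‖q₂‖_∞ ≤ δ` then the `L²` norm of `q₁ − q₂` over `|x| ≤ R` is controlled by the Cauchy
data of `u₁ − u₂` on the cylinder `|x| = R`, `R ≤ t ≤ T`. -/
theorem stmt5 (R T M : ℝ) (hR : 0 < R) (hRT : 3 * R < T) (hM : 0 < M) :
    ∃ δ > (0:ℝ), ∃ C > (0:ℝ), ∀ q1 q2 : E3 → ℝ,
      ContDiffOn ℝ 8 q1 (closedBall (0:E3) ((R + T) / 2)) →
      ContDiffOn ℝ 8 q2 (closedBall (0:E3) ((R + T) / 2)) →
      (∀ x ∈ closedBall (0:E3) ((R + T) / 2), |q1 x| ≤ M) →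
      (∀ x ∈ closedBall (0:E3) ((R + T) / 2), |q2 x| ≤ M) →
      ∀ u1 u2 : E3 × ℝ → ℝ,
        IsSolOn ((R + T) / 2) q1 u1 → IsSolOn ((R + T) / 2) q2 u2 →
        (∀ x ∈ closedBall (0:E3) ((R + T) / 2), |q2 x| ≤ δ) →
        (∫ x in closedBall (0:E3) R, (q1 x - q2 x) ^ 2) ≤
          C * ∫ t in R..T, sphInt R (fun x =>
            (u1 (x, t) - u2 (x, t)) ^ 2
            + gradsqX (fun p => u1 p - u2 p) (x, t)
            + (pdt (fun p => u1 p - u2 p) (x, t)) ^ 2) := by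
  set ρ := (R + T) / 2 with hρd
  have hτ₁ : 2 * R < ρ := by linarith
  have hρ : 0 < ρ := by linarith
  obtain ⟨τ₁, hτR, hτρ⟩ : ∃ τ₁, 2 * R < τ₁ ∧ 2 * R + τ₁ < 2 * ρ :=
    ⟨ρ, hτ₁, by linarith⟩
  have hτ0 : 0 < τ₁ := by linarith
  obtain ⟨C₁, hC₁, carl⟩ := carleman_estimate M hR hτR hτρ
  obtain ⟨C₂, hC₂, jet⟩ := exists_integral_jetSq_le (T := T) hR hτ0.le (by linarith)
  obtain ⟨δ, hδ, hδρ, hδC⟩ : ∃ δ > 0, δ * ρ ^ 2 ≤ 1 ∧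
      R ^ 2 * C₁ * ((2 * δ) ^ 2 * τ₁) ≤ 1 / 2 := by
    have e1 : ∀ᶠ δ in nhdsWithin (0:ℝ) (Ioi 0), δ * ρ ^ 2 < 1 :=
      nhdsWithin_le_nhds ((show Continuous fun δ : ℝ => δ * ρ ^ 2 by fun_prop).continuousAt
        |>.eventually_lt_const (by simp))
    have e2 : ∀ᶠ δ in nhdsWithin (0:ℝ) (Ioi 0), R ^ 2 * C₁ * ((2 * δ) ^ 2 * τ₁) < 1 / 2 :=
      nhdsWithin_le_nhds ((show Continuous fun δ : ℝ => R ^ 2 * C₁ * ((2 * δ) ^ 2 * τ₁) by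
        fun_prop).continuousAt |>.eventually_lt_const (by simp))
    obtain ⟨δ, h1, h2, h3⟩ := (e1.and (e2.and self_mem_nhdsWithin)).exists
    exact ⟨δ, h3, h1.le, h2.le⟩
  refine ⟨δ, hδ, 2 * R ^ 2 * C₁ * C₂, by positivity,
    fun q1 q2 hq1 hq2 hM1 _ u1 u2 hu1 hu2 hδ2 => ?_⟩
  obtain ⟨W1, g1, H1, Q1, P1, eW1, cQ1, eQ1, box1, ch1⟩ :=
    exists_pack_of_isSolOn hρ hq1.continuousOn hu1
  obtain ⟨W2, g2, H2, Q2, P2, eW2, cQ2, eQ2, box2, ch2⟩ :=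
    exists_pack_of_isSolOn hρ hq2.continuousOn hu2
  have hW2 : ∀ p ∈ Dcone ρ, |W2 p| ≤ 2 * δ := fun p hp =>
    P2.abs_le_two_mul hρ hδρ (fun x hx => by rw [eQ2 hx]; exact hδ2 x hx) box2 ch2 hp
  have P := P1.sub P2
  have eW : EqOn (fun p => W1 p - W2 p) (fun p => u1 p - u2 p) (Dcone ρ) := fun p hp => by
    simp only [eW1 hp, eW2 hp]
  have cQ : Continuous fun x => Q1 x - Q2 x := cQ1.sub cQ2
  have hmem : ∀ θ : S2, ∀ x ∈ Ioo 0 R, ∀ τ ∈ Ioo 0 τ₁,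
      ‖(chi x τ (θ : E3)).1‖ < (chi x τ (θ : E3)).2 ∧
        ‖(chi x τ (θ : E3)).1‖ + (chi x τ (θ : E3)).2 < 2 * ρ := fun θ x hx τ hτ =>
    chi_mem hx.1.le hτ.1 (by linarith [hx.2, hτ.2]) θ
  have est := carl _ _ _ P (fun p => (Q1 p.1 - Q2 p.1) * W2 p)
    ((cQ.comp continuous_fst).mul P2.cW) fun θ x hx τ hτ => by
      obtain ⟨h, h'⟩ := hmem θ x hx τ hτ
      set p := chi x τ (θ : E3)
      have hQ : |Q1 p.1| ≤ M := by
        have hp : p.1 ∈ closedBall (0 : E3) ρ := by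
          rw [mem_closedBall_zero_iff]; linarith
        rw [eQ1 hp]
        exact hM1 _ hp
      have e : boxH (H1 p - H2 p) = Q1 p.1 * (W1 p - W2 p) + (Q1 p.1 - Q2 p.1) * W2 p := by
        have : boxH (H1 p - H2 p) = boxH (H1 p) - boxH (H2 p) := by
          simp only [boxH, sub_apply, Fin.sum_univ_three]; ring
        rw [this, box1 p h h', box2 p h h']
        ring
      rw [e]
      refine (abs_add_le _ _).trans (add_le_add_left ?_ _)
      rw [abs_mul]
      exact mul_le_mul_of_nonneg_right hQ (abs_nonneg _)
  have eA : ∫ θ : S2, (∫ x in (0:ℝ)..R,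
      rvx (fun p => W1 p - W2 p) (fun p => g1 p - g2 p) θ x 0 ^ 2) ∂sig =
      ∫ θ : S2, (∫ x in (0:ℝ)..R, (Q1 (x • θ.1) - Q2 (x • θ.1)) ^ 2) ∂sig := by
    congr 1
    ext θ
    refine intervalIntegral.integral_congr_Ioo_of_le hR.le fun x hx => ?_
    have hx' : x ∈ Ioo 0 ρ := ⟨hx.1, by linarith [hx.2]⟩
    have : rvx (fun p => W1 p - W2 p) (fun p => g1 p - g2 p) θ x 0 =
        rvx W1 g1 θ x 0 - rvx W2 g2 θ x 0 := by
      simp only [rvx, sub_apply]; ring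
    simp only [this, ch1 θ x hx', ch2 θ x hx']
  have eD : ∫ x in closedBall (0:E3) R, (q1 x - q2 x) ^ 2 =
      ∫ x in closedBall (0:E3) R, (Q1 x - Q2 x) ^ 2 := by
    refine setIntegral_congr_fun measurableSet_closedBall fun x hx => ?_
    have hx' := closedBall_subset_closedBall (by linarith : R ≤ ρ) hx
    simp only [eQ1 hx', eQ2 hx']
  have eR : (∫ t in R..T, sphInt R (fun x => (u1 (x, t) - u2 (x, t)) ^ 2
      + gradsqX (fun p => u1 p - u2 p) (x, t) + (pdt (fun p => u1 p - u2 p) (x, t)) ^ 2)) =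
      ∫ t in R..T, sphInt R fun x =>
        jetSq (fun p => W1 p - W2 p) (fun p => g1 p - g2 p) (x, t) :=
    intervalIntegral.integral_congr_Ioo_of_le (by linarith) fun t ht =>
      P.sphInt_eq eW ht.1 (by linarith [ht.2])
  have hB := boxInt_mul_sq_le hR.le hτ0.le cQ P2.cW fun θ x hx τ hτ =>
    hW2 _ (mem_Dcone_of_le (hmem θ x hx τ hτ).1.le (hmem θ x hx τ hτ).2.le)
  have hJ := jet _ _ _ _ P
  have hA := integral_closedBall_le (f := fun x => (Q1 x - Q2 x) ^ 2) hR.le (cQ.pow 2)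
    fun x => sq_nonneg _
  rw [eA] at est
  rw [eD, eR]
  have hD0 : 0 ≤ ∫ x in closedBall (0:E3) R, (Q1 x - Q2 x) ^ 2 :=
    integral_nonneg fun x => sq_nonneg _
  have key := hA.trans (mul_le_mul_of_nonneg_left
    (est.trans (mul_le_mul_of_nonneg_left (add_le_add hB hJ) hC₁.le)) (sq_nonneg R))
  have := mul_le_mul_of_nonneg_right hδC hD0
  linarith
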